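/- Let Ω ⊂ ℂⁿ be a bounded pseudoconvex domain and φ ∈ SPSH(Ω). Then for every z ∈ Ω, lim_{k→∞} k^{−n} B_{kφ}(z) e^{−kφ(z)} = π^{−n} det H_φ(z), where B_{kφ}(z) is the diagonal of the reproducing kernel of H(kφ). -/

import Mathlib

open MeasureTheory Complex Filter
open scoped ENNReal Topology BigOperators Real ComplexOrder

noncomputable section

variable {n : ℕ}

/-- Wirtinger derivative `∂f/∂z_j` of a function on `ℂⁿ`. -/
def wDeriv (f : (Fin n → ℂ) → ℂ) (j : Fin n) (z : Fin n → ℂ) : ℂ :=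
  (1/2) * (fderiv ℝ f z (Pi.single j 1) - Complex.I * fderiv ℝ f z (Pi.single j Complex.I))

/-- Wirtinger derivative `∂f/∂z̄_j` of a function on `ℂⁿ`. -/
def wDerivBar (f : (Fin n → ℂ) → ℂ) (j : Fin n) (z : Fin n → ℂ) : ℂ :=
  (1/2) * (fderiv ℝ f z (Pi.single j 1) + Complex.I * fderiv ℝ f z (Pi.single j Complex.I))

/-- Complex Hessian `H_φ(z) = (∂²φ/∂z_j∂z̄_k)_{j,k}` of a real-valued function on `ℂⁿ`. -/
def cHessian (φ : (Fin n → ℂ) → ℝ) (z : Fin n → ℂ) : Matrix (Fin n) (Fin n) ℂ :=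
  Matrix.of fun j k => wDerivBar (fun w => wDeriv (fun v => (φ v : ℂ)) j w) k z

/-- A function is plurisubharmonic on `Ω` if it is upper semicontinuous on `Ω` and satisfies
the sub-mean value inequality on every closed complex disc contained in `Ω`. -/
def PlurisubharmonicOn (Ω : Set (Fin n → ℂ)) (f : (Fin n → ℂ) → ℝ) : Prop :=
  UpperSemicontinuousOn f Ω ∧
  ∀ a b : Fin n → ℂ, (∀ ζ : ℂ, ‖ζ‖ ≤ 1 → a + ζ • b ∈ Ω) →
    f a ≤ (2 * π)⁻¹ * ∫ θ in (0:ℝ)..(2*π), f (a + Complex.exp (θ * Complex.I) • b)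

/-- A (bounded) open set `Ω ⊆ ℂⁿ` is pseudoconvex iff `z ↦ -log dist(z, Ωᶜ)` is
plurisubharmonic on `Ω`. -/
def Pseudoconvex (Ω : Set (Fin n → ℂ)) : Prop :=
  PlurisubharmonicOn Ω fun z => -Real.log (Metric.infDist z Ωᶜ)

/-- `φ ∈ SPSH(Ω)`: smooth on `Ω` with positive definite complex Hessian at every point of `Ω`. -/
def SPSHOn (Ω : Set (Fin n → ℂ)) (φ : (Fin n → ℂ) → ℝ) : Prop :=
  ContDiffOn ℝ (⊤ : ℕ∞) φ Ω ∧ ∀ z ∈ Ω, (cHessian φ z).PosDef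

/-- Squared weighted Bergman norm `∫_Ω |f|² e^{-ψ} dλ` (as an extended real,
so that finiteness encodes square-integrability). -/
def wnorm2 (Ω : Set (Fin n → ℂ)) (ψ : (Fin n → ℂ) → ℝ) (f : (Fin n → ℂ) → ℂ) : ℝ≥0∞ :=
  ∫⁻ z in Ω, ENNReal.ofReal (‖f z‖ ^ 2 * Real.exp (-ψ z))

/-- Membership in the weighted Bergman space `H(ψ)`: holomorphic on `Ω` and
`∫_Ω |f|² e^{-ψ} dλ < ∞`. -/
def MemBergman (Ω : Set (Fin n → ℂ)) (ψ : (Fin n → ℂ) → ℝ) (f : (Fin n → ℂ) → ℂ) : Prop :=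
  DifferentiableOn ℂ f Ω ∧ wnorm2 Ω ψ f < ⊤

/-- The diagonal of the Bergman kernel of `H(ψ)`:
`B_ψ(z) = sup {|f(z)|² : f ∈ H(ψ), ‖f‖_ψ ≤ 1}`. -/
def bergmanDiag (Ω : Set (Fin n → ℂ)) (ψ : (Fin n → ℂ) → ℝ) (z : Fin n → ℂ) : ℝ :=
  sSup {t : ℝ | ∃ f, DifferentiableOn ℂ f Ω ∧ wnorm2 Ω ψ f ≤ 1 ∧ t = ‖f z‖ ^ 2}

/-- Weighted inner product `⟨f,g⟩_ψ = ∫_Ω f ḡ e^{-ψ} dλ`. -/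
def wInner (Ω : Set (Fin n → ℂ)) (ψ : (Fin n → ℂ) → ℝ) (f g : (Fin n → ℂ) → ℂ) : ℂ :=
  ∫ z in Ω, f z * (starRingEnd ℂ) (g z) * Real.exp (-ψ z)

/-- Mixed determinants `D_j(A,B)`, defined so that
`det (s•A + r•B) = ∑_j (n choose j) s^j r^(n-j) D_j(A,B)`: explicitly `D_j(A,B)` is
`(n choose j)⁻¹` times the sum over all `j`-element subsets `S` of the row indices of the
determinant of the matrix whose rows are those of `A` on `S` and those of `B` elsewhere. -/
def mixedDet (A B : Matrix (Fin n) (Fin n) ℂ) (j : ℕ) : ℂ :=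
  ((n.choose j : ℂ))⁻¹ *
    ∑ S ∈ Finset.univ.powersetCard j,
      Matrix.det (Matrix.of fun i k => if i ∈ S then A i k else B i k)

open scoped ComplexConjugate

/-- generic Wirtinger type derivative: `c = -I` gives `∂_j`, `c = I` gives `∂̄_j` -/
def dw (c : ℂ) (j : Fin n) (f : (Fin n → ℂ) → ℂ) (z : Fin n → ℂ) : ℂ :=
  (1/2) * (fderiv ℝ f z (Pi.single j 1) + c * fderiv ℝ f z (Pi.single j Complex.I))

abbrev Sm (f : (Fin n → ℂ) → ℂ) : Prop := ContDiff ℝ (⊤ : ℕ∞) f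
abbrev SmR (f : (Fin n → ℂ) → ℝ) : Prop := ContDiff ℝ (⊤ : ℕ∞) f

lemma wDeriv_eq (f : (Fin n → ℂ) → ℂ) (j : Fin n) (z) : wDeriv f j z = dw (-I) j f z := by
  simp only [wDeriv, dw]; ring

lemma wDerivBar_eq (f : (Fin n → ℂ) → ℂ) (j : Fin n) (z) : wDerivBar f j z = dw I j f z := rfl

lemma cHessian_eq (φ : (Fin n → ℂ) → ℝ) (z) (j k : Fin n) :
    cHessian φ z j k = dw I k (dw (-I) j (fun v => (φ v : ℂ))) z := by
  simp only [cHessian, Matrix.of_apply, wDerivBar_eq]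
  congr 1
  ext w
  rw [wDeriv_eq]

lemma Sm.da {f : (Fin n → ℂ) → ℂ} (hf : Sm f) (z) : DifferentiableAt ℝ f z :=
  (hf.differentiable (by simp)) z

lemma SmR.ofReal {f : (Fin n → ℂ) → ℝ} (hf : SmR f) : Sm (fun x => (f x : ℂ)) :=
  Complex.ofRealCLM.contDiff.comp hf

lemma Sm.conj {f : (Fin n → ℂ) → ℂ} (hf : Sm f) : Sm (fun x => conj (f x)) :=
  Complex.conjCLE.toContinuousLinearMap.contDiff.comp hf

lemma dw_add (c : ℂ) (j : Fin n) {f g : (Fin n → ℂ) → ℂ} {z} (hf : DifferentiableAt ℝ f z)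
    (hg : DifferentiableAt ℝ g z) :
    dw c j (fun x => f x + g x) z = dw c j f z + dw c j g z := by
  simp only [dw, fderiv_fun_add hf hg, add_apply]; ring

lemma dw_sub (c : ℂ) (j : Fin n) {f g : (Fin n → ℂ) → ℂ} {z} (hf : DifferentiableAt ℝ f z)
    (hg : DifferentiableAt ℝ g z) :
    dw c j (fun x => f x - g x) z = dw c j f z - dw c j g z := by
  simp only [dw, fderiv_fun_sub hf hg, sub_apply]; ring

lemma dw_mul (c : ℂ) (j : Fin n) {f g : (Fin n → ℂ) → ℂ} {z} (hf : DifferentiableAt ℝ f z)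
    (hg : DifferentiableAt ℝ g z) :
    dw c j (fun x => f x * g x) z = dw c j f z * g z + f z * dw c j g z := by
  simp only [dw, fderiv_fun_mul hf hg, add_apply, smul_apply,
    smul_eq_mul]; ring

lemma dw_const (c : ℂ) (j : Fin n) (a : ℂ) (z) : dw c j (fun _ => a) z = 0 := by
  simp [dw]

lemma dw_const_mul (c : ℂ) (j : Fin n) (a : ℂ) {f : (Fin n → ℂ) → ℂ} {z}
    (hf : DifferentiableAt ℝ f z) :
    dw c j (fun x => a * f x) z = a * dw c j f z := by
  rw [dw_mul c j (by fun_prop) hf, dw_const]; ring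

lemma dw_sum {ι : Type*} (c : ℂ) (j : Fin n) (s : Finset ι) {f : ι → (Fin n → ℂ) → ℂ} {z}
    (hf : ∀ i ∈ s, DifferentiableAt ℝ (f i) z) :
    dw c j (fun x => ∑ i ∈ s, f i x) z = ∑ i ∈ s, dw c j (f i) z := by
  simp only [dw, fderiv_fun_sum hf, sum_apply, Finset.mul_sum,
    ← Finset.sum_add_distrib]

lemma dw_conj (c : ℂ) (j : Fin n) {f : (Fin n → ℂ) → ℂ} {z} (hf : DifferentiableAt ℝ f z) :
    dw c j (fun x => conj (f x)) z = conj (dw (conj c) j f z) := by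
  have h : HasFDerivAt (fun x => conj (f x))
      (Complex.conjCLE.toContinuousLinearMap.comp (fderiv ℝ f z)) z :=
    (Complex.conjCLE.toContinuousLinearMap.hasFDerivAt).comp z hf.hasFDerivAt
  have h2 : (starRingEnd ℂ) 2 = 2 := map_ofNat _ 2
  simp [dw, h.fderiv, h2]

lemma dw_congr (c : ℂ) (j : Fin n) {f g : (Fin n → ℂ) → ℂ} {z} (h : f =ᶠ[𝓝 z] g) :
    dw c j f z = dw c j g z := by
  simp only [dw, h.fderiv_eq]

/-- chain rule for real functions -/
lemma dw_compReal (c : ℂ) (j : Fin n) {f : (Fin n → ℂ) → ℝ} {g : ℝ → ℝ} {g' : ℝ} {z}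
    (hf : DifferentiableAt ℝ f z) (hg : HasDerivAt g g' (f z)) :
    dw c j (fun x => ((g (f x) : ℝ) : ℂ)) z = g' * dw c j (fun x => (f x : ℂ)) z := by
  have h1 : HasFDerivAt (fun x => ((g (f x) : ℝ) : ℂ))
      (Complex.ofRealCLM.comp (g' • fderiv ℝ f z)) z :=
    (Complex.ofRealCLM.hasFDerivAt).comp z (hg.comp_hasFDerivAt z hf.hasFDerivAt)
  have h2 : HasFDerivAt (fun x => ((f x : ℝ) : ℂ))
      (Complex.ofRealCLM.comp (fderiv ℝ f z)) z :=
    (Complex.ofRealCLM.hasFDerivAt).comp z hf.hasFDerivAt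
  simp [dw, h1.fderiv, h2.fderiv]; ring

lemma dw_real_conj (c : ℂ) (j : Fin n) {f : (Fin n → ℂ) → ℝ} {z} (hf : DifferentiableAt ℝ f z) :
    conj (dw c j (fun x => (f x : ℂ)) z) = dw (conj c) j (fun x => (f x : ℂ)) z := by
  have hf' : DifferentiableAt ℝ (fun x => (f x : ℂ)) z :=
    (Complex.ofRealCLM.differentiableAt).comp z hf
  have := dw_conj (conj c) j hf'
  simp at this
  exact this.symm

lemma Sm.dw {f : (Fin n → ℂ) → ℂ} (hf : Sm f) (c : ℂ) (j : Fin n) : Sm (dw c j f) := by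
  have h : ContDiff ℝ (⊤ : ℕ∞) (fderiv ℝ f) := hf.fderiv_right (by simp)
  exact contDiff_const.mul ((h.clm_apply contDiff_const).add
    (contDiff_const.mul (h.clm_apply contDiff_const)))

lemma dw_hcs {f : (Fin n → ℂ) → ℂ} (hf : HasCompactSupport f) (c : ℂ) (j : Fin n) :
    HasCompactSupport (dw c j f) := by
  have h := hf.fderiv (𝕜 := ℝ)
  refine h.mono ?_
  intro x hx
  simp only [Function.mem_support, dw] at hx ⊢
  contrapose! hx
  simp [hx]

lemma dw_eq_zero {f : (Fin n → ℂ) → ℂ} {x} (hx : x ∉ tsupport f) (c : ℂ) (j : Fin n) :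
    dw c j f x = 0 := by
  have : f =ᶠ[𝓝 x] (fun _ => 0) := notMem_tsupport_iff_eventuallyEq.1 hx
  rw [dw_congr c j this, dw_const]

lemma tsupport_dw_subset (f : (Fin n → ℂ) → ℂ) (c : ℂ) (j : Fin n) :
    tsupport (dw c j f) ⊆ tsupport f := by
  apply closure_minimal _ (isClosed_tsupport f)
  intro x hx
  by_contra h
  exact hx (dw_eq_zero h c j)

lemma dw_comm {f : (Fin n → ℂ) → ℂ} {z} (hf : ContDiffAt ℝ (⊤ : ℕ∞) f z) (c d : ℂ) (j k : Fin n) :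
    dw c j (dw d k f) z = dw d k (dw c j f) z := by
  have hd : DifferentiableAt ℝ (fderiv ℝ f) z :=
    (hf.fderiv_right (m := 1) (by norm_cast)).differentiableAt (by simp)
  have hs : IsSymmSndFDerivAt ℝ f z := hf.isSymmSndFDerivAt (by simp; norm_cast)
  have key : ∀ (d : ℂ) (k : Fin n), fderiv ℝ (dw d k f) z = (1/2 : ℂ) •
      (((fderiv ℝ (fderiv ℝ f) z).flip (Pi.single k 1)) +
        d • ((fderiv ℝ (fderiv ℝ f) z).flip (Pi.single k Complex.I))) := by
    intro d k
    have h1 : ∀ v, HasFDerivAt (fun x => fderiv ℝ f x v) ((fderiv ℝ (fderiv ℝ f) z).flip v) z := by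
      intro v
      have := hd.hasFDerivAt.clm_apply (hasFDerivAt_const v z)
      simpa using this
    exact (((h1 (Pi.single k 1)).add ((h1 (Pi.single k Complex.I)).const_mul d)).const_mul
      (1/2 : ℂ)).fderiv
  have e := fun v w => hs.eq v w
  rw [dw, dw, key, key]
  simp only [one_div, smul_apply, add_apply,
    ContinuousLinearMap.flip_apply, smul_eq_mul]
  rw [e (Pi.single k 1) (Pi.single j 1), e (Pi.single k 1) (Pi.single j I),
    e (Pi.single k I) (Pi.single j 1), e (Pi.single k I) (Pi.single j I)]
  ring

lemma Sm.comm {f : (Fin n → ℂ) → ℂ} (hf : Sm f) (c d : ℂ) (j k : Fin n) :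
    _root_.dw c j (_root_.dw d k f) = _root_.dw d k (_root_.dw c j f) := by
  ext z; exact dw_comm hf.contDiffAt c d j k

lemma int_of_test {f : (Fin n → ℂ) → ℂ} (hf : Continuous f) (h : HasCompactSupport f) :
    Integrable f := hf.integrable_of_hasCompactSupport h

lemma integral_dw {f : (Fin n → ℂ) → ℂ} (hf : Sm f) (h : HasCompactSupport f) (c : ℂ) (j : Fin n) :
    ∫ x, dw c j f x = 0 := by
  have hc : Continuous (fderiv ℝ f) := (hf.fderiv_right (m := 0) (by simp)).continuous
  have h0 : ∀ v, Integrable (fun x => fderiv ℝ f x v) := fun v =>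
    int_of_test (by fun_prop) (h.fderiv_apply (𝕜 := ℝ) v)
  have h1 : ∀ v, ∫ x, fderiv ℝ f x v = 0 := by
    intro v
    have := integral_smul_fderiv_eq_neg_fderiv_smul_of_integrable (𝕜 := ℝ)
      (μ := (volume : Measure (Fin n → ℂ))) (f := fun _ => (1:ℝ)) (g := f) (v := v)
      (by simp) (by simpa using h0 v) (by simpa using int_of_test hf.continuous h) (by fun_prop)
      (fun x _ => hf.da x)
    simpa using this
  simp only [dw]
  rw [integral_const_mul, integral_add (h0 _) ((h0 _).const_mul c), integral_const_mul, h1, h1]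
  simp

lemma ibp {f g : (Fin n → ℂ) → ℂ} (hf : Sm f) (hg : Sm g) (h : HasCompactSupport g)
    (c : ℂ) (j : Fin n) :
    ∫ x, f x * dw c j g x = - ∫ x, dw c j f x * g x := by
  have h1 := integral_dw (f := fun x => f x * g x) (hf.mul hg) h.mul_left c j
  have h2 : ∀ x, dw c j (fun x => f x * g x) x = dw c j f x * g x + f x * dw c j g x := fun x =>
    dw_mul c j (hf.da x) (hg.da x)
  simp only [h2] at h1
  have i1 : Integrable (fun x => dw c j f x * g x) :=
    int_of_test ((hf.dw c j).continuous.mul hg.continuous) h.mul_left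
  have i2 : Integrable (fun x => f x * dw c j g x) :=
    int_of_test (hf.continuous.mul (hg.dw c j).continuous) (dw_hcs h c j).mul_left
  rw [integral_add i1 i2] at h1
  exact (neg_eq_of_add_eq_zero_right h1).symm

abbrev oR (φ : (Fin n → ℂ) → ℝ) : (Fin n → ℂ) → ℂ := fun x => (φ x : ℂ)

/-- complex Hessian entries -/
def Hs (φ : (Fin n → ℂ) → ℝ) (j k : Fin n) (x : Fin n → ℂ) : ℂ := dw I k (dw (-I) j (oR φ)) x

/-- Levi form -/
def Lev (φ : (Fin n → ℂ) → ℝ) (x : Fin n → ℂ) (a : Fin n → ℂ) : ℝ :=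
  (∑ j, ∑ k, Hs φ j k x * a j * conj (a k)).re

/-- twisted derivative -/
def tw (Ψ : (Fin n → ℂ) → ℝ) (j : Fin n) (f : (Fin n → ℂ) → ℂ) (x : Fin n → ℂ) : ℂ :=
  dw (-I) j f x - dw (-I) j (oR Ψ) x * f x

abbrev ew (Ψ : (Fin n → ℂ) → ℝ) : (Fin n → ℂ) → ℂ := fun x => ((Real.exp (-Ψ x) : ℝ) : ℂ)

lemma ew_sm {Ψ : (Fin n → ℂ) → ℝ} (h : SmR Ψ) : Sm (ew Ψ) :=
  SmR.ofReal (Real.contDiff_exp.comp h.neg)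

lemma dw_ew {Ψ : (Fin n → ℂ) → ℝ} (h : SmR Ψ) (c : ℂ) (j : Fin n) (x) :
    dw c j (ew Ψ) x = - (dw c j (oR Ψ) x * ew Ψ x) := by
  have h1 : HasDerivAt (fun t : ℝ => Real.exp (-t)) (-Real.exp (-Ψ x)) (Ψ x) := by
    simpa using ((hasDerivAt_id (Ψ x)).neg.exp)
  have := dw_compReal c j (h.differentiable (by simp) x) h1
  rw [this]
  simp [ew]; ring

lemma tw_sm {Ψ : (Fin n → ℂ) → ℝ} (h : SmR Ψ) (j : Fin n) {f : (Fin n → ℂ) → ℂ} (hf : Sm f) :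
    Sm (tw Ψ j f) :=
  (hf.dw _ j).sub ((h.ofReal.dw _ j).mul hf)

lemma tw_hcs {Ψ : (Fin n → ℂ) → ℝ} (j : Fin n) {f : (Fin n → ℂ) → ℂ} (hf : HasCompactSupport f) :
    HasCompactSupport (tw Ψ j f) :=
  (dw_hcs hf _ j).sub hf.mul_left

lemma dw_ew_mul {Ψ : (Fin n → ℂ) → ℝ} (h : SmR Ψ) (j : Fin n) {f : (Fin n → ℂ) → ℂ}
    (hf : Sm f) (x) : dw (-I) j (fun x => ew Ψ x * f x) x = ew Ψ x * tw Ψ j f x := by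
  rw [dw_mul _ _ ((ew_sm h).da x) (hf.da x), dw_ew h, tw]; ring

lemma cj_real (r : ℝ) : conj (r : ℂ) = (r : ℂ) := Complex.conj_ofReal r

lemma dwI_ew_conj {Ψ : (Fin n → ℂ) → ℝ} (h : SmR Ψ) (k : Fin n) {g : (Fin n → ℂ) → ℂ}
    (hg : Sm g) (x) : dw I k (fun x => ew Ψ x * conj (g x)) x = ew Ψ x * conj (tw Ψ k g x) := by
  have e1 : (fun x => ew Ψ x * conj (g x)) = fun x => conj (ew Ψ x * g x) := by
    ext x; rw [map_mul]; congr 1; exact (cj_real _).symm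
  rw [e1, dw_conj _ _ (Sm.da ((ew_sm h).mul hg) x)]
  have : conj I = -I := Complex.conj_I
  rw [this, dw_ew_mul h k hg, map_mul]; congr 1; exact cj_real _

lemma BI_pair {Ψ : (Fin n → ℂ) → ℝ} (h : SmR Ψ) (j k : Fin n) {f g : (Fin n → ℂ) → ℂ}
    (hf : Sm f) (hg : Sm g) (cg : HasCompactSupport g) :
    ∫ x, (tw Ψ j f x * conj (tw Ψ k g x) - Hs Ψ j k x * f x * conj (g x)
      - dw I k f x * conj (dw I j g x)) * ew Ψ x = 0 := by
  have hcg : HasCompactSupport (fun x => conj (g x)) := cg.comp_left (map_zero _)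
  have hI : Sm (dw I k (tw Ψ j f)) := (tw_sm h j hf).dw _ _
  have hew := ew_sm h
  have s1 : Sm (fun x => ew Ψ x * conj (g x)) := hew.mul hg.conj
  have c1 : HasCompactSupport (fun x => ew Ψ x * conj (g x)) := hcg.mul_left
  have A : ∫ x, tw Ψ j f x * (ew Ψ x * conj (tw Ψ k g x))
      = - ∫ x, dw I k (tw Ψ j f) x * (ew Ψ x * conj (g x)) := by
    rw [← ibp (tw_sm h j hf) s1 c1]
    congr 1; ext x; rw [dwI_ew_conj h k hg]
  have B : ∫ x, (ew Ψ x * dw I k f x) * conj (dw I j g x)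
      = - ∫ x, (ew Ψ x * tw Ψ j (dw I k f) x) * conj (g x) := by
    have := ibp (hew.mul (hf.dw I k)) hg.conj hcg (-I) j
    have e2 : ∀ x, dw (-I) j (fun x => conj (g x)) x = conj (dw I j g x) := by
      intro x
      rw [dw_conj _ _ (hg.da x)]
      simp
    simp only [e2, dw_ew_mul h j (hf.dw I k)] at this
    exact this
  have C : ∀ x, dw I k (tw Ψ j f) x = tw Ψ j (dw I k f) x - Hs Ψ j k x * f x := by
    intro x
    have hp := h.ofReal.dw (-I) j
    unfold tw
    rw [dw_sub _ _ ((hf.dw _ _).da x) (Sm.da (hp.mul hf) x),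
      dw_mul _ _ (hp.da x) (hf.da x), hf.comm, Hs]
    ring
  have cont1 : Continuous (tw Ψ j f) := (tw_sm h j hf).continuous
  have cont2 : Continuous (tw Ψ k g) := (tw_sm h k hg).continuous
  have cont3 : Continuous (tw Ψ j (dw I k f)) := (tw_sm h j (hf.dw _ _)).continuous
  have cont4 : Continuous (dw I k f) := (hf.dw _ _).continuous
  have cont5 : Continuous (dw I j g) := (hg.dw _ _).continuous
  have cont6 : Continuous (ew Ψ) := hew.continuous
  have cont7 : Continuous (fun x => Hs Ψ j k x) :=
    ((h.ofReal.dw _ _).dw _ _).continuous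
  have cont8 := hg.continuous
  have cont9 := hf.continuous
  have conj_c : Continuous (starRingEnd ℂ) := Complex.continuous_conj
  have t1 : HasCompactSupport (fun x => conj (tw Ψ k g x)) :=
    (tw_hcs k cg).comp_left (map_zero _)
  have t2 : HasCompactSupport (fun x => conj (dw I j g x)) :=
    (dw_hcs cg _ _).comp_left (map_zero _)
  have i1 : Integrable (fun x => tw Ψ j f x * (ew Ψ x * conj (tw Ψ k g x))) :=
    int_of_test (by fun_prop) (t1.mul_left.mul_left)
  have i2 : Integrable (fun x => (Hs Ψ j k x * f x) * (ew Ψ x * conj (g x))) :=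
    int_of_test (by fun_prop) (hcg.mul_left.mul_left)
  have i3 : Integrable (fun x => (ew Ψ x * dw I k f x) * conj (dw I j g x)) :=
    int_of_test (by fun_prop) t2.mul_left
  have i4 : Integrable (fun x => (ew Ψ x * tw Ψ j (dw I k f) x) * conj (g x)) :=
    int_of_test (by fun_prop) hcg.mul_left
  have e : ∀ x, (tw Ψ j f x * conj (tw Ψ k g x) - Hs Ψ j k x * f x * conj (g x)
      - dw I k f x * conj (dw I j g x)) * ew Ψ x =
      tw Ψ j f x * (ew Ψ x * conj (tw Ψ k g x)) - (Hs Ψ j k x * f x) * (ew Ψ x * conj (g x))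
      - (ew Ψ x * dw I k f x) * conj (dw I j g x) := fun x => by ring
  have e' : ∀ x, dw I k (tw Ψ j f) x * (ew Ψ x * conj (g x)) =
    (ew Ψ x * tw Ψ j (dw I k f) x) * conj (g x) - (Hs Ψ j k x * f x) * (ew Ψ x * conj (g x)) := by
    intro x; rw [C]; ring
  simp only [e]
  rw [integral_sub (by exact i1.sub i2) i3, integral_sub i1 i2, A, B]
  simp only [e']
  rw [integral_sub i4 i2]
  ring

lemma curl_alg (x : Fin n → Fin n → ℂ) :
    (1/2) * ∑ j, ∑ k, ‖x j k - x k j‖^2 + (∑ j, ∑ k, x j k * conj (x k j)).re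
      = ∑ j, ∑ k, ‖x j k‖^2 := by
  have h : ∀ j k, ‖x j k - x k j‖^2 = ‖x j k‖^2 + ‖x k j‖^2 - 2 * (x j k * conj (x k j)).re := by
    intro j k
    rw [← Complex.normSq_eq_norm_sq, ← Complex.normSq_eq_norm_sq, ← Complex.normSq_eq_norm_sq,
      Complex.normSq_sub]
  simp only [h, Finset.sum_sub_distrib, Finset.sum_add_distrib, Complex.re_sum, ← Finset.mul_sum]
  have h2 : ∑ j, ∑ k, ‖x k j‖^2 = ∑ j, ∑ k, ‖x j k‖^2 := Finset.sum_comm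
  rw [h2]; ring

lemma BI {Ψ : (Fin n → ℂ) → ℝ} (h : SmR Ψ) {a : Fin n → (Fin n → ℂ) → ℂ}
    (ha : ∀ j, Sm (a j)) (ca : ∀ j, HasCompactSupport (a j)) :
    0 ≤ ∫ x, (‖∑ j, tw Ψ j (a j) x‖^2
      + (1/2) * ∑ j, ∑ k, ‖dw I k (a j) x - dw I j (a k) x‖^2
      - Lev Ψ x (fun j => a j x)) * Real.exp (-Ψ x) := by
  have hint : ∀ j k, Integrable (fun x => (tw Ψ j (a j) x * conj (tw Ψ k (a k) x)
      - Hs Ψ j k x * a j x * conj (a k x)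
      - dw I k (a j) x * conj (dw I j (a k) x)) * ew Ψ x) := by
    intro j k
    have cont1 : Continuous (tw Ψ j (a j)) := (tw_sm h j (ha j)).continuous
    have cont2 : Continuous (tw Ψ k (a k)) := (tw_sm h k (ha k)).continuous
    have cont4 : Continuous (dw I k (a j)) := ((ha j).dw _ _).continuous
    have cont5 : Continuous (dw I j (a k)) := ((ha k).dw _ _).continuous
    have cont6 : Continuous (ew Ψ) := (ew_sm h).continuous
    have cont7 : Continuous (fun x => Hs Ψ j k x) :=
      ((h.ofReal.dw _ _).dw _ _).continuous
    have cont8 := (ha k).continuous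
    have cont9 := (ha j).continuous
    have conj_c : Continuous (starRingEnd ℂ) := Complex.continuous_conj
    refine int_of_test (by fun_prop) ?_
    exact HasCompactSupport.mul_right (((tw_hcs j (ca j)).mul_right.sub
      ((ca j).mul_left.mul_right)).sub (dw_hcs (ca j) _ _).mul_right)
  have G0 : ∫ x, ∑ j, ∑ k, (tw Ψ j (a j) x * conj (tw Ψ k (a k) x)
      - Hs Ψ j k x * a j x * conj (a k x)
      - dw I k (a j) x * conj (dw I j (a k) x)) * ew Ψ x = 0 := by
    rw [integral_finsetSum _ (fun j _ => integrable_finsetSum _ fun k _ => hint j k)]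
    refine Finset.sum_eq_zero fun j _ => ?_
    rw [integral_finsetSum _ (fun k _ => hint j k)]
    exact Finset.sum_eq_zero fun k _ => BI_pair h j k (ha j) (ha k) (ca k)
  have Gi := integrable_finsetSum Finset.univ
    (fun j (_ : j ∈ (Finset.univ : Finset (Fin n))) =>
      integrable_finsetSum Finset.univ
        fun k (_ : k ∈ (Finset.univ : Finset (Fin n))) => hint j k)
  have G1 := congrArg Complex.re G0
  have G2 := integral_re Gi
  simp only [RCLike.re_eq_complex_re] at G2
  rw [← G2] at G1
  have hsq : ∀ j k, Integrable (fun x => ‖dw I k (a j) x‖^2 * Real.exp (-Ψ x)) := by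
    intro j k
    have cont4 : Continuous (dw I k (a j)) := ((ha j).dw _ _).continuous
    have cont6 : Continuous Ψ := h.continuous
    refine Continuous.integrable_of_hasCompactSupport (by fun_prop) ?_
    apply HasCompactSupport.mul_right
    exact (dw_hcs (ca j) _ _).comp_left (g := fun t : ℂ => ‖t‖^2) (by simp)
  have key : ∀ x, (‖∑ j, tw Ψ j (a j) x‖^2
      + (1/2) * ∑ j, ∑ k, ‖dw I k (a j) x - dw I j (a k) x‖^2
      - Lev Ψ x (fun j => a j x)) * Real.exp (-Ψ x) =
      (∑ j, ∑ k, (tw Ψ j (a j) x * conj (tw Ψ k (a k) x)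
      - Hs Ψ j k x * a j x * conj (a k x)
      - dw I k (a j) x * conj (dw I j (a k) x)) * ew Ψ x).re
      + ∑ j, ∑ k, ‖dw I k (a j) x‖^2 * Real.exp (-Ψ x) := by
    intro x
    have e1 : ‖∑ j, tw Ψ j (a j) x‖^2 = (∑ j, ∑ k, tw Ψ j (a j) x * conj (tw Ψ k (a k) x)).re := by
      rw [← Complex.normSq_eq_norm_sq, ← Finset.sum_mul_sum, ← map_sum, Complex.mul_conj]
      simp
    have e2 := curl_alg (fun j k => dw I k (a j) x)
    simp only [← Finset.sum_mul, ← e2, e1, Lev, Finset.sum_sub_distrib]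
    rw [Complex.re_mul_ofReal]
    simp only [Complex.sub_re]
    ring
  simp only [key]
  have hG1 : ∫ x, (∑ j, ∑ k, (tw Ψ j (a j) x * conj (tw Ψ k (a k) x)
      - Hs Ψ j k x * a j x * conj (a k x)
      - dw I k (a j) x * conj (dw I j (a k) x)) * ew Ψ x).re = 0 := by simpa using G1
  have Gre : Integrable (fun x => (∑ j, ∑ k, (tw Ψ j (a j) x * conj (tw Ψ k (a k) x)
      - Hs Ψ j k x * a j x * conj (a k x)
      - dw I k (a j) x * conj (dw I j (a k) x)) * ew Ψ x).re) := Gi.re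
  have hs := integrable_finsetSum Finset.univ
    (fun j (_ : j ∈ (Finset.univ : Finset (Fin n))) =>
      integrable_finsetSum Finset.univ
        fun k (_ : k ∈ (Finset.univ : Finset (Fin n))) => hsq j k)
  rw [integral_add Gre hs, hG1, zero_add]
  exact integral_nonneg fun x => Finset.sum_nonneg fun j _ => Finset.sum_nonneg fun k _ => by
    positivity

/-! ### mollifiers -/
def nsq (y : Fin n → ℂ) : ℝ := ∑ j, ‖y j‖ ^ 2

lemma nsq_nonneg (y : Fin n → ℂ) : 0 ≤ nsq y := Finset.sum_nonneg fun _ _ => by positivity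

lemma nsq_smooth : SmR (nsq (n := n)) := by
  unfold nsq
  refine ContDiff.sum fun j _ => ?_
  exact (contDiff_norm_sq ℝ).comp (contDiff_apply ℝ ℂ j)

lemma nsq_smul (c : ℂ) (y : Fin n → ℂ) : nsq (c • y) = ‖c‖ ^ 2 * nsq y := by
  simp [nsq, Finset.mul_sum, mul_pow]

lemma norm_sq_le_nsq (y : Fin n → ℂ) : ‖y‖ ^ 2 ≤ nsq y := by
  have : ‖y‖ ≤ √(nsq y) := by
    rw [pi_norm_le_iff_of_nonneg (by positivity)]
    intro i
    apply Real.le_sqrt_of_sq_le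
    exact Finset.single_le_sum (f := fun j => ‖y j‖^2) (fun _ _ => by positivity) (Finset.mem_univ i)
  calc ‖y‖ ^ 2 ≤ √(nsq y) ^ 2 := by gcongr
    _ = nsq y := Real.sq_sqrt (nsq_nonneg y)

lemma nsq_le (y : Fin n → ℂ) : nsq y ≤ n * ‖y‖ ^ 2 := by
  calc nsq y ≤ ∑ j : Fin n, ‖y‖ ^ 2 := Finset.sum_le_sum fun j _ => by
        gcongr; exact norm_le_pi_norm y j
    _ = _ := by simp

def eta0 (m : ℕ) (y : Fin n → ℂ) : ℝ := Real.smoothTransition (1 - (m + 1 : ℝ) ^ 2 * nsq y)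

lemma eta0_smooth (m : ℕ) : SmR (eta0 (n := n) m) :=
  Real.smoothTransition.contDiff.comp (contDiff_const.sub (contDiff_const.mul nsq_smooth))

lemma eta0_nonneg (m : ℕ) (y : Fin n → ℂ) : 0 ≤ eta0 m y := Real.smoothTransition.nonneg _

lemma eta0_zero (m : ℕ) {y : Fin n → ℂ} (h : 1 / (m + 1 : ℝ) ≤ ‖y‖) : eta0 m y = 0 := by
  apply Real.smoothTransition.zero_of_nonpos
  have h1 := norm_sq_le_nsq y
  have h3 : (0:ℝ) < m + 1 := by positivity
  rw [div_le_iff₀ h3] at h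
  nlinarith [mul_le_mul_of_nonneg_left h1 (sq_nonneg (m + 1 : ℝ))]

lemma hcs_of_zero {F : Type*} [Zero F] {f : (Fin n → ℂ) → F} {R : ℝ}
    (h : ∀ y, R ≤ ‖y‖ → f y = 0) : HasCompactSupport f := by
  refine HasCompactSupport.intro (isCompact_closedBall (0 : Fin n → ℂ) R) fun x hx => h x ?_
  simp at hx; exact hx.le

lemma eta0_hcs (m : ℕ) : HasCompactSupport (eta0 (n := n) m) := hcs_of_zero fun _ => eta0_zero m

lemma eta0_int_pos (m : ℕ) : 0 < ∫ y : Fin n → ℂ, eta0 m y := by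
  refine (eta0_smooth m).continuous.integral_pos_of_hasCompactSupport_nonneg_nonzero
    (eta0_hcs m) (eta0_nonneg m) (x := 0) ?_
  have : eta0 (n := n) m 0 = 1 := Real.smoothTransition.one_of_one_le (by simp [nsq])
  rw [this]; norm_num

/-- circle invariant mollifiers -/
def mol (m : ℕ) (y : Fin n → ℂ) : ℝ := (∫ y : Fin n → ℂ, eta0 m y)⁻¹ * eta0 m y

lemma eta_smooth (m : ℕ) : SmR (mol (n := n) m) := contDiff_const.mul (eta0_smooth m)

lemma eta_nonneg (m : ℕ) (y : Fin n → ℂ) : 0 ≤ mol m y :=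
  mul_nonneg (inv_nonneg.2 (eta0_int_pos m).le) (eta0_nonneg m y)

lemma eta_zero (m : ℕ) {y : Fin n → ℂ} (h : 1 / (m + 1 : ℝ) ≤ ‖y‖) : mol m y = 0 := by
  simp [mol, eta0_zero m h]

lemma eta_hcs (m : ℕ) : HasCompactSupport (mol (n := n) m) := hcs_of_zero fun _ => eta_zero m

lemma eta_int (m : ℕ) : ∫ y : Fin n → ℂ, mol m y = 1 := by
  simp only [mol]
  rw [integral_const_mul, inv_mul_cancel₀ (eta0_int_pos m).ne']

lemma eta_circ (m : ℕ) (c : ℂ) (hc : ‖c‖ = 1) (y : Fin n → ℂ) : mol m (c • y) = mol m y := by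
  simp [mol, eta0, nsq_smul, hc]

lemma eta_neg (m : ℕ) (y : Fin n → ℂ) : mol m (-y) = mol m y := by
  simpa using eta_circ m (-1) (by simp) y

lemma eta_integrable (m : ℕ) : Integrable (mol (n := n) m) :=
  (eta_smooth m).continuous.integrable_of_hasCompactSupport (eta_hcs m)

def etaC (m : ℕ) (y : Fin n → ℂ) : ℂ := (mol m y : ℂ)

lemma etaC_smooth (m : ℕ) : Sm (etaC (n := n) m) := (eta_smooth m).ofReal

lemma etaC_hcs (m : ℕ) : HasCompactSupport (etaC (n := n) m) :=
  hcs_of_zero (R := 1 / (m + 1 : ℝ)) fun _ h => by simp [etaC, eta_zero m h]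

open scoped Convolution in
/-- mollification (with arbitrary kernel) -/
def cv (η f : (Fin n → ℂ) → ℂ) : (Fin n → ℂ) → ℂ := η ⋆[ContinuousLinearMap.mul ℝ ℂ, volume] f

lemma cv_apply (η f : (Fin n → ℂ) → ℂ) (x) : cv η f x = ∫ t, η t * f (x - t) := rfl

lemma cv_apply' (η f : (Fin n → ℂ) → ℂ) (x) : cv η f x = ∫ t, η (x - t) * f t := by
  rw [cv_apply, ← integral_sub_left_eq_self _ volume x]
  simp

lemma cv_smooth {η f : (Fin n → ℂ) → ℂ} (hη : Sm η) (h : HasCompactSupport η)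
    (hf : LocallyIntegrable f) : Sm (cv η f) :=
  h.contDiff_convolution_left (n := (⊤:ℕ∞)) _ hη hf

lemma cv_dw {η f : (Fin n → ℂ) → ℂ} (hη : Sm η) (h : HasCompactSupport η)
    (hf : LocallyIntegrable f) (c : ℂ) (j : Fin n) : dw c j (cv η f) = cv (dw c j η) f := by
  ext x
  have h1 := h.hasFDerivAt_convolution_left (ContinuousLinearMap.mul ℝ ℂ) (μ := volume)
    (hη.of_le (by norm_cast)) hf x
  have hc : Continuous (fderiv ℝ η) := (hη.fderiv_right (m := 0) (by simp)).continuous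
  have hi : Integrable (fun t => ((ContinuousLinearMap.mul ℝ ℂ).precompL (Fin n → ℂ))
      (fderiv ℝ η t) (f (x - t))) :=
    ((h.fderiv (𝕜 := ℝ)).convolutionExists_left _ hc hf) x
  have h2 : ∀ v, fderiv ℝ (cv η f) x v = ∫ t, fderiv ℝ η t v * f (x - t) := by
    intro v
    have : HasFDerivAt (cv η f) _ x := h1
    rw [this.fderiv, convolution_def, ContinuousLinearMap.integral_apply hi]
    rfl
  have i2 : ∀ v, Integrable (fun t => fderiv ℝ η t v * f (x - t)) := fun v =>
    ((h.fderiv_apply (𝕜 := ℝ) v).convolutionExists_left (ContinuousLinearMap.mul ℝ ℂ)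
      (by fun_prop) hf) x
  rw [dw, h2, h2, cv_apply, ← integral_const_mul, ← integral_add (i2 _) ((i2 _).const_mul _),
    ← integral_const_mul]
  simp only [dw]
  congr 1; ext t; ring

/-- the reflected translate of a test function -/
lemma dw_reflect {η : (Fin n → ℂ) → ℂ} (h : Sm η) (c : ℂ) (j : Fin n) (x t) :
    dw c j (fun t => η (x - t)) t = - dw c j η (x - t) := by
  have h1 := (h.da (x - t)).hasFDerivAt.comp t ((hasFDerivAt_id (𝕜 := ℝ) t).const_sub x)
  have h2 : fderiv ℝ (fun t => η (x - t)) t = _ := h1.fderiv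
  simp only [dw, h2]
  simp; ring

lemma reflect_hcs {η : (Fin n → ℂ) → ℂ} (h : HasCompactSupport η) (x) :
    HasCompactSupport (fun t => η (x - t)) :=
  h.comp_homeomorph (Homeomorph.subLeft x)

lemma reflect_sm {η : (Fin n → ℂ) → ℂ} (h : Sm η) (x) : Sm (fun t => η (x - t)) :=
  h.comp (contDiff_const.sub contDiff_id)

lemma cv_zero {f : (Fin n → ℂ) → ℂ} {R : ℝ} (hf : ∀ y, R ≤ ‖y‖ → f y = 0) (m : ℕ) (x)
    (hx : R + 1 ≤ ‖x‖) : cv (etaC m) f x = 0 := by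
  rw [cv_apply]
  refine integral_eq_zero_of_ae (ae_of_all _ fun t => ?_)
  by_cases h : 1 / (m + 1 : ℝ) ≤ ‖t‖
  · simp [etaC, eta_zero m h]
  · push Not at h
    have h1 : 1 / (m + 1 : ℝ) ≤ 1 := by
      rw [div_le_one (by positivity)]; linarith [(Nat.cast_nonneg m : (0:ℝ) ≤ m)]
    have h2 := norm_sub_norm_le x t
    simp [hf (x - t) (by linarith)]

lemma cv_congr {η f g : (Fin n → ℂ) → ℂ} (h : f =ᵐ[volume] g) : cv η f = cv η g := by
  ext x
  rw [cv_apply', cv_apply']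
  refine integral_congr_ae ?_
  filter_upwards [h] with t ht
  rw [ht]

lemma trans_cont {f : (Fin n → ℂ) → ℂ} (hf : MemLp f 2) :
    Tendsto (fun y => eLpNorm (fun x => f (x - y) - f x) 2 volume) (𝓝 0) (𝓝 0) := by
  have : Fact ((1:ℝ≥0∞) ≤ 2) := ⟨by norm_num⟩
  let F : Lp ℂ 2 (volume : Measure (Fin n → ℂ)) := hf.toLp f
  let g : C((Fin n → ℂ), C((Fin n → ℂ), (Fin n → ℂ))) :=
    (ContinuousMap.mk (fun a : (Fin n → ℂ) × (Fin n → ℂ) ↦ a.2 - a.1) (by fun_prop)).curry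
  have hg : ∀ y, MeasurePreserving (g y) volume volume := fun y =>
    measurePreserving_sub_right volume y
  have hc : Continuous (fun y => Lp.compMeasurePreserving (g y) (hg y) F) :=
    (continuous_const (y := F)).compMeasurePreservingLp g.continuous hg (by norm_num)
  have h0 := (hc.tendsto 0)
  have h00 : Lp.compMeasurePreserving (g 0) (hg 0) F = F := by
    apply Lp.ext
    refine (Lp.coeFn_compMeasurePreserving F (hg 0)).trans ?_
    have : (g 0 : (Fin n → ℂ) → (Fin n → ℂ)) = id := by ext x; simp [g]
    rw [this]; rfl
  rw [h00] at h0
  rw [tendsto_iff_edist_tendsto_0] at h0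
  refine h0.congr fun y => ?_
  rw [Lp.edist_def]
  refine eLpNorm_congr_ae ?_
  have e1 := Lp.coeFn_compMeasurePreserving F (hg y)
  have e2 : F =ᵐ[volume] f := hf.coeFn_toLp
  have e3 := (hg y).quasiMeasurePreserving.ae_eq_comp e2
  filter_upwards [e1, e2, e3] with x h1 h2 h3
  simp only [Pi.sub_apply, h1, h2, h3]
  rfl

lemma sq_lintegral_le {X : Type*} [MeasurableSpace X] (P : Measure X) [IsProbabilityMeasure P]
    {g : X → ℝ≥0∞} (hg : AEMeasurable g P) : (∫⁻ y, g y ∂P) ^ 2 ≤ ∫⁻ y, g y ^ 2 ∂P := by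
  have h := ENNReal.lintegral_mul_le_Lp_mul_Lq P (p := 2) (q := 2)
    (by constructor <;> norm_num) hg (aemeasurable_const (b := (1:ℝ≥0∞)))
  simp only [Pi.mul_apply, mul_one, ENNReal.one_rpow, lintegral_one, measure_univ] at h
  calc (∫⁻ y, g y ∂P) ^ 2 ≤ ((∫⁻ a, g a ^ (2:ℝ) ∂P) ^ (1 / 2 : ℝ)) ^ 2 := by gcongr
    _ = ∫⁻ y, g y ^ 2 ∂P := by
      rw [← ENNReal.rpow_natCast, ← ENNReal.rpow_mul]; norm_num

def molM (m : ℕ) : Measure (Fin n → ℂ) := volume.withDensity fun y => ENNReal.ofReal (mol m y)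

instance molM_prob (m : ℕ) : IsProbabilityMeasure (molM (n := n) m) := by
  constructor
  rw [molM, withDensity_apply _ MeasurableSet.univ, setLIntegral_univ,
    ← ofReal_integral_eq_lintegral_ofReal (eta_integrable m) (ae_of_all _ (eta_nonneg m)), eta_int]
  simp

lemma eLpNorm_two_sq {X : Type*} [MeasurableSpace X] {μ : Measure X} (f : X → ℂ) :
    eLpNorm f 2 μ ^ 2 = ∫⁻ x, ‖f x‖ₑ ^ 2 ∂μ := by
  have := eLpNorm_nnreal_pow_eq_lintegral (μ := μ) (f := f) (p := 2) (by norm_num)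
  norm_cast at this ⊢
  simpa using this

lemma moll_L2 {f : (Fin n → ℂ) → ℂ} (hf : MemLp f 2) :
    Tendsto (fun m => eLpNorm (fun x => cv (etaC m) f x - f x) 2 volume) atTop (𝓝 0) := by
  wlog hm : StronglyMeasurable f generalizing f with H
  · have h1 := H (f := hf.1.mk f) ((memLp_congr_ae hf.1.ae_eq_mk).1 hf) hf.1.stronglyMeasurable_mk
    refine h1.congr fun m => ?_
    rw [cv_congr hf.1.ae_eq_mk]
    refine eLpNorm_congr_ae ?_
    filter_upwards [hf.1.ae_eq_mk] with x hx
    rw [← hx]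
  rw [ENNReal.tendsto_nhds_zero]
  intro ε hε
  have h1 := (ENNReal.tendsto_nhds_zero.1 (trans_cont hf)) ε hε
  obtain ⟨δ, hδ, hb⟩ := Metric.eventually_nhds_iff.1 h1
  obtain ⟨M, hM⟩ := exists_nat_one_div_lt hδ
  filter_upwards [eventually_ge_atTop M] with m hm'
  have hmM : 1 / (m + 1 : ℝ) ≤ 1 / (M + 1 : ℝ) := by gcongr
  have hmeas : Measurable (fun p : (Fin n → ℂ) × (Fin n → ℂ) => ‖f (p.1 - p.2) - f p.1‖ₑ ^ 2) := by
    have := hm.measurable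
    fun_prop
  have hem : Measurable (fun y : Fin n → ℂ => ENNReal.ofReal (mol m y)) :=
    ((eta_smooth m).continuous.measurable).ennreal_ofReal
  have hpt : ∀ x, ‖cv (etaC m) f x - f x‖ₑ ^ 2 ≤ ∫⁻ y, ‖f (x - y) - f x‖ₑ ^ 2 ∂(molM m) := by
    intro x
    have hli : LocallyIntegrable f := hf.locallyIntegrable (by norm_num)
    have i1 : Integrable (fun t => etaC m t * f (x - t)) :=
      ((etaC_hcs m).convolutionExists_left (ContinuousLinearMap.mul ℝ ℂ)
        (etaC_smooth m).continuous hli) x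
    have i2 : Integrable (fun t => etaC (n := n) m t) := (eta_integrable m).ofReal
    have e1 : cv (etaC m) f x - f x = ∫ t, etaC m t * (f (x - t) - f x) := by
      simp only [mul_sub]
      rw [integral_sub i1 (i2.mul_const _), integral_mul_const, cv_apply]
      have : ∫ t, etaC (n := n) m t = 1 := by
        simp only [etaC]; rw [integral_complex_ofReal, eta_int]; simp
      rw [this, one_mul]
    have e2 : ‖cv (etaC m) f x - f x‖ₑ ≤ ∫⁻ y, ‖f (x - y) - f x‖ₑ ∂(molM m) := by
      rw [e1, molM, lintegral_withDensity_eq_lintegral_mul _ hem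
        (by have := hm.measurable; fun_prop)]
      refine (enorm_integral_le_lintegral_enorm _).trans (le_of_eq ?_)
      congr 1; ext t
      rw [enorm_mul]
      congr 1
      simp only [etaC]
      rw [← ofReal_norm]
      simp [abs_of_nonneg (eta_nonneg m t)]
    calc ‖cv (etaC m) f x - f x‖ₑ ^ 2 ≤ (∫⁻ y, ‖f (x - y) - f x‖ₑ ∂(molM m)) ^ 2 := by gcongr
      _ ≤ _ := sq_lintegral_le _ (by have := hm.measurable; fun_prop)
  have hsq : eLpNorm (fun x => cv (etaC m) f x - f x) 2 volume ^ 2 ≤ ε ^ 2 := by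
    rw [eLpNorm_two_sq]
    calc _ ≤ ∫⁻ x, ∫⁻ y, ‖f (x - y) - f x‖ₑ ^ 2 ∂(molM m) := lintegral_mono hpt
      _ = ∫⁻ y, (∫⁻ x, ‖f (x - y) - f x‖ₑ ^ 2) ∂(molM m) := by
        rw [lintegral_lintegral_swap hmeas.aemeasurable]
      _ ≤ ∫⁻ y, ε ^ 2 ∂(molM (n := n) m) := by
        rw [molM, lintegral_withDensity_eq_lintegral_mul _ hem hmeas.lintegral_prod_left',
          lintegral_withDensity_eq_lintegral_mul _ hem measurable_const]
        refine lintegral_mono fun y => ?_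
        simp only [Pi.mul_apply]
        by_cases h : 1 / (m + 1 : ℝ) ≤ ‖y‖
        · simp [eta_zero m h]
        · push Not at h
          gcongr
          rw [← eLpNorm_two_sq]
          gcongr
          exact hb (by simpa using lt_of_lt_of_le h (hmM.trans hM.le))
      _ = ε ^ 2 := by simp
  exact (ENNReal.pow_le_pow_left_iff (by norm_num)).1 hsq

lemma L2int {f g : (Fin n → ℂ) → ℂ} (hf : MemLp f 2) (hg : MemLp g 2) :
    Integrable (fun x => f x * conj (g x)) := by
  exact hf.integrable_mul (hg.star)

lemma L2lim {F G : ℕ → (Fin n → ℂ) → ℂ} {f g : (Fin n → ℂ) → ℂ} (hF : ∀ m, MemLp (F m) 2)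
    (hG : ∀ m, MemLp (G m) 2) (hf : MemLp f 2) (hg : MemLp g 2)
    (tF : Tendsto (fun m => eLpNorm (fun x => F m x - f x) 2 volume) atTop (𝓝 0))
    (tG : Tendsto (fun m => eLpNorm (fun x => G m x - g x) 2 volume) atTop (𝓝 0)) :
    Tendsto (fun m => ∫ x, F m x * conj (G m x)) atTop (𝓝 (∫ x, f x * conj (g x))) := by
  have : Fact ((1:ℝ≥0∞) ≤ 2) := ⟨by norm_num⟩
  have h1 : Tendsto (fun m => (hF m).toLp (F m)) atTop (𝓝 (hf.toLp f)) :=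
    (Lp.tendsto_Lp_iff_tendsto_eLpNorm'' F hF f hf).2 tF
  have h2 : Tendsto (fun m => (hG m).toLp (G m)) atTop (𝓝 (hg.toLp g)) :=
    (Lp.tendsto_Lp_iff_tendsto_eLpNorm'' G hG g hg).2 tG
  have h3 := h2.inner (𝕜 := ℂ) h1
  have key : ∀ (u v : (Fin n → ℂ) → ℂ) (hu : MemLp u 2) (hv : MemLp v 2),
      inner ℂ (hv.toLp v) (hu.toLp u) = ∫ x, u x * conj (v x) := by
    intro u v hu hv
    rw [L2.inner_def]
    refine integral_congr_ae ?_
    filter_upwards [hu.coeFn_toLp, hv.coeFn_toLp] with x h1 h2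
    rw [h1, h2]; rfl
  simpa only [key] using h3

/-- L² convergence with uniformly compact support -/
structure TL (R : ℝ) (F : ℕ → (Fin n → ℂ) → ℂ) (f : (Fin n → ℂ) → ℂ) : Prop where
  mF : ∀ m, MemLp (F m) 2
  mf : MemLp f 2
  zF : ∀ m y, R ≤ ‖y‖ → F m y = 0
  zf : ∀ y, R ≤ ‖y‖ → f y = 0
  t : Tendsto (fun m => eLpNorm (fun x => F m x - f x) 2 volume) atTop (𝓝 0)

lemma TL.add {R : ℝ} {F G : ℕ → (Fin n → ℂ) → ℂ} {f g : (Fin n → ℂ) → ℂ} (hF : TL R F f)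
    (hG : TL R G g) : TL R (fun m x => F m x + G m x) (fun x => f x + g x) where
  mF m := (hF.mF m).add (hG.mF m)
  mf := hF.mf.add hG.mf
  zF m y h := by simp [hF.zF m y h, hG.zF m y h]
  zf y h := by simp [hF.zf y h, hG.zf y h]
  t := by
    have := hF.t.add hG.t
    rw [add_zero] at this
    refine tendsto_of_tendsto_of_tendsto_of_le_of_le tendsto_const_nhds this
      (fun _ => zero_le) (fun m => ?_)
    refine le_trans (le_of_eq ?_) (eLpNorm_add_le ((hF.mF m).sub hF.mf).1
      ((hG.mF m).sub hG.mf).1 (by norm_num))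
    congr 1; ext x; simp; ring

lemma TL.zero {R : ℝ} : TL (n := n) R (fun _ _ => 0) (fun _ => 0) where
  mF m := MemLp.zero
  mf := MemLp.zero
  zF m y h := rfl
  zf y h := rfl
  t := by simp

lemma TL.sum {ι : Type*} {R : ℝ} (s : Finset ι) {F : ι → ℕ → (Fin n → ℂ) → ℂ}
    {f : ι → (Fin n → ℂ) → ℂ} (h : ∀ i ∈ s, TL R (F i) (f i)) :
    TL R (fun m x => ∑ i ∈ s, F i m x) (fun x => ∑ i ∈ s, f i x) := by
  classical
  induction s using Finset.induction_on with
  | empty => simpa using TL.zero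
  | insert a s ha ih =>
    simp only [Finset.sum_insert ha]
    exact (h a (by simp)).add (ih fun i hi => h i (by simp [hi]))

lemma exists_bd {g : (Fin n → ℂ) → ℂ} (hg : Continuous g) (R : ℝ) :
    ∃ C : ℝ, 0 ≤ C ∧ ∀ y, ‖y‖ ≤ R → ‖g y‖ ≤ C := by
  obtain ⟨C, hC⟩ := (isCompact_closedBall (0 : Fin n → ℂ) R).exists_bound_of_continuousOn
    hg.continuousOn
  exact ⟨max C 0, le_max_right _ _, fun y hy => (hC y (by simpa using hy)).trans (le_max_left _ _)⟩

lemma memLp_cmul {g f : (Fin n → ℂ) → ℂ} (hg : Continuous g) {R : ℝ} (hf : MemLp f 2)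
    (hz : ∀ y, R ≤ ‖y‖ → f y = 0) : MemLp (fun x => g x * f x) 2 := by
  obtain ⟨C, hC0, hC⟩ := exists_bd hg R
  refine MemLp.of_le_mul (c := C) hf (hg.aestronglyMeasurable.mul hf.1) (ae_of_all _ fun x => ?_)
  rw [norm_mul]
  by_cases h : R ≤ ‖x‖
  · simp [hz x h]
  · gcongr; exact hC x (by push Not at h; exact h.le)

lemma TL.cmul {R : ℝ} {F : ℕ → (Fin n → ℂ) → ℂ} {f g : (Fin n → ℂ) → ℂ} (hF : TL R F f)
    (hg : Continuous g) : TL R (fun m x => g x * F m x) (fun x => g x * f x) where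
  mF m := memLp_cmul hg (hF.mF m) (hF.zF m)
  mf := memLp_cmul hg hF.mf hF.zf
  zF m y h := by simp [hF.zF m y h]
  zf y h := by simp [hF.zf y h]
  t := by
    obtain ⟨C, hC0, hC⟩ := exists_bd hg R
    have := ENNReal.Tendsto.const_mul (a := ENNReal.ofReal C) hF.t (Or.inr (by simp))
    rw [mul_zero] at this
    refine tendsto_of_tendsto_of_tendsto_of_le_of_le tendsto_const_nhds this
      (fun _ => zero_le) (fun m => ?_)
    refine eLpNorm_le_mul_eLpNorm_of_ae_le_mul (ae_of_all _ fun x => ?_) 2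
    rw [← mul_sub, norm_mul]
    by_cases h : R ≤ ‖x‖
    · simp [hF.zf x h, hF.zF m x h]
    · gcongr; exact hC x (by push Not at h; exact h.le)

lemma TL.lim {R : ℝ} {F G : ℕ → (Fin n → ℂ) → ℂ} {f g : (Fin n → ℂ) → ℂ} (hF : TL R F f)
    (hG : TL R G g) :
    Tendsto (fun m => ∫ x, F m x * conj (G m x)) atTop (𝓝 (∫ x, f x * conj (g x))) :=
  L2lim hF.mF hG.mF hF.mf hG.mf hF.t hG.t

lemma cv_memLp {f : (Fin n → ℂ) → ℂ} {R : ℝ} (hf : MemLp f 2)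
    (hz : ∀ y, R ≤ ‖y‖ → f y = 0) (m : ℕ) : MemLp (cv (etaC m) f) 2 :=
  (cv_smooth (etaC_smooth m) (etaC_hcs m) (hf.locallyIntegrable (by norm_num))).continuous.memLp_of_hasCompactSupport
    (hcs_of_zero (cv_zero hz m))

lemma TL.moll {f : (Fin n → ℂ) → ℂ} {R : ℝ} (hf : MemLp f 2)
    (hz : ∀ y, R ≤ ‖y‖ → f y = 0) : TL (R + 1) (fun m => cv (etaC m) f) f where
  mF := cv_memLp hf hz
  mf := hf
  zF := cv_zero hz
  zf y h := hz y (by linarith)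
  t := moll_L2 hf

/-- the quadratic form of the basic inequality -/
def QF (Ψ : (Fin n → ℂ) → ℝ) (b : Fin n → (Fin n → ℂ) → ℂ) (p : (Fin n → ℂ) → ℂ)
    (q : Fin n → Fin n → (Fin n → ℂ) → ℂ) (x : Fin n → ℂ) : ℝ :=
  (‖p x + ∑ j, (- dw (-I) j (oR Ψ) x) * b j x‖ ^ 2 + (1/2) * ∑ j, ∑ k, ‖q j k x‖ ^ 2
    - Lev Ψ x (fun j => b j x)) * Real.exp (-Ψ x)

def QC (Ψ : (Fin n → ℂ) → ℝ) (b : Fin n → (Fin n → ℂ) → ℂ) (p : (Fin n → ℂ) → ℂ)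
    (q : Fin n → Fin n → (Fin n → ℂ) → ℂ) (x : Fin n → ℂ) : ℂ :=
  (ew Ψ x * (p x + ∑ j, (- dw (-I) j (oR Ψ) x) * b j x)) *
    conj (p x + ∑ j, (- dw (-I) j (oR Ψ) x) * b j x)
  + (∑ j, ∑ k, ((1/2 * ew Ψ x) * q j k x) * conj (q j k x)
    + ∑ j, ∑ k, ((- (ew Ψ x * Hs Ψ j k x)) * b j x) * conj (b k x))

lemma QF_eq (Ψ : (Fin n → ℂ) → ℝ) (b : Fin n → (Fin n → ℂ) → ℂ) (p : (Fin n → ℂ) → ℂ)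
    (q : Fin n → Fin n → (Fin n → ℂ) → ℂ) (x : Fin n → ℂ) : QF Ψ b p q x = (QC Ψ b p q x).re := by
  have h1 : ∀ z : ℂ, (ew Ψ x * z) * conj z = ((‖z‖ ^ 2 * Real.exp (-Ψ x) : ℝ) : ℂ) := by
    intro z
    rw [mul_assoc, Complex.mul_conj, Complex.normSq_eq_norm_sq, ew]; push_cast; ring
  have h2 : ∀ z : ℂ, (1/2 * ew Ψ x * z) * conj z
      = ((1/2 * (‖z‖ ^ 2 * Real.exp (-Ψ x)) : ℝ) : ℂ) := by
    intro z
    rw [mul_assoc, mul_assoc, ← mul_assoc (ew Ψ x), h1]; push_cast; ring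
  have h3 : ∑ j, ∑ k, ((- (ew Ψ x * Hs Ψ j k x)) * b j x) * conj (b k x)
      = ((- Real.exp (-Ψ x) : ℝ) : ℂ) * ∑ j, ∑ k, Hs Ψ j k x * b j x * conj (b k x) := by
    simp only [Finset.mul_sum, ew]
    refine Finset.sum_congr rfl fun j _ => Finset.sum_congr rfl fun k _ => ?_
    push_cast; ring
  rw [QC, h1, h3]
  simp only [h2, Complex.add_re, Complex.re_ofReal_mul, Complex.ofReal_re, QF, Lev,
    ← Complex.ofReal_sum, ← Finset.mul_sum, ← Finset.sum_mul]
  ring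

lemma QC_lim {Ψ : (Fin n → ℂ) → ℝ} (h : SmR Ψ) {R : ℝ} {B : Fin n → ℕ → (Fin n → ℂ) → ℂ}
    {P : ℕ → (Fin n → ℂ) → ℂ} {Q : Fin n → Fin n → ℕ → (Fin n → ℂ) → ℂ}
    {b : Fin n → (Fin n → ℂ) → ℂ} {p : (Fin n → ℂ) → ℂ}
    {q : Fin n → Fin n → (Fin n → ℂ) → ℂ} (hB : ∀ j, TL R (B j) (b j)) (hP : TL R P p)
    (hQ : ∀ j k, TL R (Q j k) (q j k)) :
    (∀ m, Integrable (QC Ψ (fun j => B j m) (P m) (fun j k => Q j k m))) ∧ Integrable (QC Ψ b p q) ∧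
    Tendsto (fun m => ∫ x, QC Ψ (fun j => B j m) (P m) (fun j k => Q j k m) x) atTop
      (𝓝 (∫ x, QC Ψ b p q x)) := by
  have ce : Continuous (ew Ψ) := (ew_sm h).continuous
  have cd : ∀ j, Continuous (dw (-I) j (oR Ψ)) := fun j => (h.ofReal.dw _ _).continuous
  have cH : ∀ j k, Continuous (fun x => Hs Ψ j k x) := fun j k =>
    ((h.ofReal.dw _ _).dw _ _).continuous
  have T1 : TL R (fun m x => P m x + ∑ j, (- dw (-I) j (oR Ψ) x) * B j m x)
      (fun x => p x + ∑ j, (- dw (-I) j (oR Ψ) x) * b j x) :=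
    hP.add (TL.sum Finset.univ fun j _ => (hB j).cmul (cd j).neg)
  have T2 := T1.cmul ce
  have T3 : ∀ j k, TL R (fun m x => (1/2 * ew Ψ x) * Q j k m x)
      (fun x => (1/2 * ew Ψ x) * q j k x) := fun j k => (hQ j k).cmul (continuous_const.mul ce)
  have T4 : ∀ j k, TL R (fun m x => (- (ew Ψ x * Hs Ψ j k x)) * B j m x)
      (fun x => (- (ew Ψ x * Hs Ψ j k x)) * b j x) := fun j k =>
    (hB j).cmul (ce.mul (cH j k)).neg
  have I1 := fun m => L2int (T2.mF m) (T1.mF m)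
  have I2 := fun j k m => L2int ((T3 j k).mF m) ((hQ j k).mF m)
  have I3 := fun j k m => L2int ((T4 j k).mF m) ((hB k).mF m)
  have J1 := L2int T2.mf T1.mf
  have J2 := fun j k => L2int (T3 j k).mf (hQ j k).mf
  have J3 := fun j k => L2int (T4 j k).mf (hB k).mf
  have S : ∀ (G : Fin n → Fin n → (Fin n → ℂ) → ℂ), (∀ j k, Integrable (G j k)) →
      Integrable (fun x => ∑ j, ∑ k, G j k x) ∧
      ∫ x, ∑ j, ∑ k, G j k x = ∑ j, ∑ k, ∫ x, G j k x := by
    intro G hG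
    have h1 : ∀ j, Integrable (fun x => ∑ k, G j k x) := fun j =>
      integrable_finsetSum _ fun k _ => hG j k
    refine ⟨integrable_finsetSum _ fun j _ => h1 j, ?_⟩
    rw [integral_finsetSum _ fun j _ => h1 j]
    refine Finset.sum_congr rfl fun j _ => ?_
    rw [integral_finsetSum _ fun k _ => hG j k]
  have A1 := fun m => S _ (fun j k => I2 j k m)
  have A2 := fun m => S _ (fun j k => I3 j k m)
  have A3 := S _ J2
  have A4 := S _ J3
  refine ⟨fun m => (I1 m).add ((A1 m).1.add (A2 m).1), J1.add (A3.1.add A4.1), ?_⟩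
  have E1 : ∀ m, ∫ x, QC Ψ (fun j => B j m) (P m) (fun j k => Q j k m) x = _ := fun m =>
    (integral_add (I1 m) ((A1 m).1.add (A2 m).1)).trans
      (congrArg _ ((integral_add (A1 m).1 (A2 m).1).trans (congrArg₂ _ (A1 m).2 (A2 m).2)))
  have E2 : ∫ x, QC Ψ b p q x = _ := 
    (integral_add J1 (A3.1.add A4.1)).trans
      (congrArg _ ((integral_add A3.1 A4.1).trans (congrArg₂ _ A3.2 A4.2)))
  rw [E2]
  simp only [E1]
  refine (T2.lim T1).add (Tendsto.add ?_ ?_)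
  · exact tendsto_finsetSum _ fun j _ => tendsto_finsetSum _ fun k _ => (T3 j k).lim (hQ j k)
  · exact tendsto_finsetSum _ fun j _ => tendsto_finsetSum _ fun k _ => (T4 j k).lim (hB k)

lemma BIweak {Ψ : (Fin n → ℂ) → ℝ} (h : SmR Ψ) {R : ℝ}
    {b : Fin n → (Fin n → ℂ) → ℂ} {p : (Fin n → ℂ) → ℂ}
    {q : Fin n → Fin n → (Fin n → ℂ) → ℂ} (hb : ∀ j, MemLp (b j) 2) (hp : MemLp p 2)
    (hq : ∀ j k, MemLp (q j k) 2) (zb : ∀ j y, R ≤ ‖y‖ → b j y = 0)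
    (zp : ∀ y, R ≤ ‖y‖ → p y = 0) (zq : ∀ j k y, R ≤ ‖y‖ → q j k y = 0)
    (wp : ∀ w, Sm w → HasCompactSupport w →
      ∑ j, ∫ x, dw (-I) j w x * b j x = - ∫ x, w x * p x)
    (wq : ∀ j k w, Sm w → HasCompactSupport w →
      (∫ x, dw I k w x * b j x) - (∫ x, dw I j w x * b k x) = - ∫ x, w x * q j k x) :
    Integrable (QF Ψ b p q) ∧ 0 ≤ ∫ x, QF Ψ b p q x := by
  have lb : ∀ j, LocallyIntegrable (b j) := fun j => (hb j).locallyIntegrable (by norm_num)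
  have Dc : ∀ m c j k x, dw c k (cv (etaC m) (b j)) x
      = - ∫ t, dw c k (fun t => etaC m (x - t)) t * b j t := by
    intro m c j k x
    rw [cv_dw (etaC_smooth m) (etaC_hcs m) (lb j), cv_apply', ← integral_neg]
    congr 1; ext t
    rw [dw_reflect (etaC_smooth m)]; ring
  have e1 : ∀ m x, ∑ j, dw (-I) j (cv (etaC m) (b j)) x = cv (etaC m) p x := by
    intro m x
    simp only [Dc, Finset.sum_neg_distrib]
    rw [wp _ (reflect_sm (etaC_smooth m) x) (reflect_hcs (etaC_hcs m) x), neg_neg, cv_apply']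
  have e2 : ∀ m j k x, dw I k (cv (etaC m) (b j)) x - dw I j (cv (etaC m) (b k)) x
      = cv (etaC m) (q j k) x := by
    intro m j k x
    have := wq j k _ (reflect_sm (etaC_smooth m) x) (reflect_hcs (etaC_hcs m) x)
    rw [Dc, Dc, cv_apply', ← neg_eq_iff_eq_neg.2 this]; ring
  obtain ⟨i1, i2, t⟩ := QC_lim h (fun j => TL.moll (hb j) (zb j)) (TL.moll hp zp)
    (fun j k => TL.moll (hq j k) (zq j k))
  have hre : ∀ {G : (Fin n → ℂ) → ℂ}, Integrable G → ∫ x, (G x).re = (∫ x, G x).re := by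
    intro G hG
    exact integral_re hG
  have iQ : Integrable (QF Ψ b p q) := by
    have : QF Ψ b p q = fun x => (QC Ψ b p q x).re := by ext x; exact QF_eq ..
    rw [this]; exact i2.re
  refine ⟨iQ, ?_⟩
  simp only [QF_eq]
  rw [hre i2]
  have t' := (Complex.continuous_re.tendsto _).comp t
  refine ge_of_tendsto' t' fun m => ?_
  simp only [Function.comp]
  rw [← hre (i1 m)]
  have hBI := BI h (a := fun j => cv (etaC m) (b j))
    (fun j => cv_smooth (etaC_smooth m) (etaC_hcs m) (lb j))
    (fun j => hcs_of_zero (cv_zero (zb j) m))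
  refine hBI.trans (le_of_eq ?_)
  congr 1; ext x
  rw [← QF_eq, QF]
  simp only [tw, Finset.sum_sub_distrib, e1, e2]
  congr 4
  simp [sub_eq_add_neg]

/-- test functions -/
structure Tst (w : (Fin n → ℂ) → ℂ) : Prop where
  sm : Sm w
  cs : HasCompactSupport w

lemma Tst.conj {w : (Fin n → ℂ) → ℂ} (h : Tst w) : Tst (fun x => conj (w x)) :=
  ⟨Sm.conj h.sm, h.cs.comp_left (g := fun z => conj z) (by simp)⟩

lemma Tst.mul_left {g w : (Fin n → ℂ) → ℂ} (h : Tst w) (hg : Sm g) : Tst (fun x => g x * w x) :=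
  ⟨ContDiff.mul hg h.sm, h.cs.mul_left⟩

lemma Tst.dw {w : (Fin n → ℂ) → ℂ} (h : Tst w) (c : ℂ) (j) : Tst (dw c j w) :=
  ⟨h.sm.dw c j, dw_hcs h.cs c j⟩

lemma Tst.memLp {w : (Fin n → ℂ) → ℂ} (h : Tst w) : MemLp w 2 :=
  h.sm.continuous.memLp_of_hasCompactSupport h.cs

abbrev L2C (n : ℕ) := Lp ℂ 2 (volume : Measure (Fin n → ℂ))

def Tst.L {w : (Fin n → ℂ) → ℂ} (h : Tst w) : L2C n := h.memLp.toLp w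

lemma inner_L2 {u v : (Fin n → ℂ) → ℂ} {f g : L2C n} (hf : f =ᵐ[volume] u) (hg : g =ᵐ[volume] v) :
    inner ℂ f g = ∫ x, v x * conj (u x) := by
  rw [L2.inner_def]
  refine integral_congr_ae ?_
  filter_upwards [hf, hg] with x h1 h2
  rw [h1, h2]; rfl

lemma Tst.inner_left {w : (Fin n → ℂ) → ℂ} (h : Tst w) (f : L2C n) :
    inner ℂ h.L f = ∫ x, f x * conj (w x) := inner_L2 h.memLp.coeFn_toLp (ae_eq_refl _)

lemma Tst.inner_both {w v : (Fin n → ℂ) → ℂ} (h : Tst w) (h' : Tst v) :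
    inner ℂ h.L h'.L = ∫ x, v x * conj (w x) := inner_L2 h.memLp.coeFn_toLp h'.memLp.coeFn_toLp

lemma norm_sq_L2 {u : (Fin n → ℂ) → ℂ} {f : L2C n} (hf : f =ᵐ[volume] u) :
    ‖f‖ ^ 2 = ∫ x, ‖u x‖ ^ 2 := by
  have h1 := inner_L2 hf hf
  rw [inner_self_eq_norm_sq_to_K] at h1
  have h2 : ∀ x, u x * conj (u x) = ((‖u x‖ ^ 2 : ℝ) : ℂ) := by
    intro x; rw [Complex.mul_conj, Complex.normSq_eq_norm_sq]
  simp only [h2] at h1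
  rw [integral_complex_ofReal] at h1
  norm_cast at h1
  exact Complex.ofReal_injective h1

abbrev HV (n : ℕ) := PiLp 2 (fun _ : Fin n => L2C n)

lemma curl_zero {w v : (Fin n → ℂ) → ℂ} (hw : Tst w) (hv : Tst v) (j k : Fin n) :
    ∫ x, dw I k w x * dw I j v x = ∫ x, dw I j w x * dw I k v x := by
  rw [ibp (hw.dw I k).sm hv.sm hv.cs, ibp (hw.dw I j).sm hv.sm hv.cs, hw.sm.comm]

lemma ew_mul_neg (Θ : (Fin n → ℂ) → ℝ) (x) :
    ew (fun x => Θ x / 2) x * ew (fun x => -(Θ x / 2)) x = 1 := by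
  simp only [ew]
  rw [← Complex.ofReal_mul, ← Real.exp_add]; simp

lemma PROJ {Θ : (Fin n → ℂ) → ℝ} (hΘ : SmR Θ) {A : Fin n → (Fin n → ℂ) → ℂ} (hA : ∀ j, Tst (A j)) :
    ∃ g : Fin n → (Fin n → ℂ) → ℂ, (∀ j, MemLp (g j) 2) ∧
      (∑ j, ∫ x, ‖g j x‖ ^ 2 ≤ ∑ j, ∫ x, ‖A j x‖ ^ 2 * Real.exp (Θ x)) ∧
      (∀ w, Tst w → ∑ j, ∫ x, ew (fun x => Θ x / 2) x * g j x * conj (dw I j w x)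
        = ∑ j, ∫ x, A j x * conj (dw I j w x)) ∧
      (∀ w, Tst w → ∀ j k, ∫ x, dw I j w x * (ew (fun x => -(Θ x / 2)) x * g k x) =
        ∫ x, dw I k w x * (ew (fun x => -(Θ x / 2)) x * g j x)) := by
  have s1 : Sm (ew (fun x => Θ x / 2)) := ew_sm (hΘ.div_const _)
  have s2 : Sm (ew (fun x => -(Θ x / 2))) := ew_sm (hΘ.div_const _).neg
  have hX : ∀ w, Tst w → ∀ j, Tst (fun x => ew (fun x => -(Θ x / 2)) x * conj (dw I j w x)) :=
    fun w hw j => (hw.dw I j).conj.mul_left s2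
  have hα : ∀ j, Tst (fun x => ew (fun x => -(Θ x / 2)) x * A j x) := fun j => (hA j).mul_left s2
  have hG : ∀ w, Tst w → ∀ j, Tst (fun x => ew (fun x => (Θ x / 2)) x * dw I j w x) :=
    fun w hw j => (hw.dw I j).mul_left s1
  let gen : {w : (Fin n → ℂ) → ℂ // Tst w} × Fin n × Fin n → HV n := fun t =>
    WithLp.toLp 2 (Pi.single t.2.2 (hX _ t.1.2 t.2.1).L - Pi.single t.2.1 (hX _ t.1.2 t.2.2).L)
  let V : Submodule ℂ (HV n) := Submodule.span ℂ (Set.range gen)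
  let α : HV n := WithLp.toLp 2 fun j => (hα j).L
  have hc0 : CompleteSpace (HV n) := inferInstance
  have hc : CompleteSpace (Submodule.orthogonal V) := (Submodule.isClosed_orthogonal V).completeSpace_coe
  have hp : (Submodule.orthogonal V).HasOrthogonalProjection :=
    Submodule.HasOrthogonalProjection.ofCompleteSpace _
  let β : HV n := (Submodule.orthogonal V).starProjection α
  have hβ : β ∈ (Submodule.orthogonal V) := Submodule.starProjection_apply_mem _ _
  have hαβ : α - β ∈ Submodule.orthogonal (Submodule.orthogonal V) := Submodule.sub_starProjection_mem_orthogonal _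
  have hn : ‖β‖ ≤ ‖α‖ := Submodule.norm_starProjection_apply_le _ _
  have geninner : ∀ t (y : HV n), inner ℂ (gen t) y
      = inner ℂ (hX _ t.1.2 t.2.1).L (y t.2.2) - inner ℂ (hX _ t.1.2 t.2.2).L (y t.2.1) := by
    intro t y
    rw [PiLp.inner_apply]
    simp only [gen, Pi.sub_apply, inner_sub_left, Finset.sum_sub_distrib]
    congr 1
    · rw [Finset.sum_eq_single t.2.2]
      · simp
      · intro b _ hb; simp [Pi.single_eq_of_ne hb]
      · simp
    · rw [Finset.sum_eq_single t.2.1]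
      · simp
      · intro b _ hb; simp [Pi.single_eq_of_ne hb]
      · simp
  refine ⟨fun j => (β j : (Fin n → ℂ) → ℂ), fun j => Lp.memLp _, ?_, ?_, ?_⟩
  · have h2 : ‖β‖ ^ 2 ≤ ‖α‖ ^ 2 := by gcongr
    rw [PiLp.norm_sq_eq_of_L2, PiLp.norm_sq_eq_of_L2] at h2
    simp only [norm_sq_L2 (ae_eq_refl _)] at h2
    refine h2.trans (le_of_eq ?_)
    refine Finset.sum_congr rfl fun j _ => ?_
    refine integral_congr_ae ?_
    have := (hα j).memLp.coeFn_toLp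
    filter_upwards [this] with x hx
    have e : (α.ofLp j) x = ew (fun x => -(Θ x / 2)) x * A j x := hx
    rw [e, norm_mul, mul_pow, mul_comm]
    congr 1
    simp only [ew, Complex.norm_real, Real.norm_eq_abs, Real.abs_exp]
    rw [← Real.exp_nat_mul]; congr 1; push_cast; ring
  · intro w hw
    let γ : HV n := WithLp.toLp 2 fun j => (hG w hw j).L
    have hγ : γ ∈ (Submodule.orthogonal V) := by
      rw [Submodule.mem_orthogonal]
      intro v hv
      induction hv using Submodule.span_induction with
      | mem v hv =>
        obtain ⟨⟨⟨v, hv⟩, j, k⟩, rfl⟩ := hv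
        rw [geninner]
        simp only [γ]
        rw [Tst.inner_both, Tst.inner_both, sub_eq_zero]
        have e : ∀ x j k, ew (fun x => Θ x / 2) x * dw I k w x *
          conj (ew (fun x => -(Θ x / 2)) x * conj (dw I j v x)) = dw I k w x * dw I j v x := by
          intro x j k
          have := ew_mul_neg Θ x
          simp only [map_mul, Complex.conj_conj, ew, Complex.conj_ofReal] at this ⊢
          linear_combination (dw I k w x * dw I j v x) * this
        simp only [e]
        exact curl_zero hw hv j k
      | zero => simp
      | add x y _ _ h1 h2 => rw [inner_add_left, h1, h2, add_zero]
      | smul a x _ h => rw [inner_smul_left, h, mul_zero]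
    have h0 := (Submodule.mem_orthogonal _ _).1 hαβ γ hγ
    rw [inner_sub_right, sub_eq_zero, PiLp.inner_apply, PiLp.inner_apply] at h0
    simp only [γ, α, Tst.inner_both] at h0
    simp only [Tst.inner_left] at h0
    convert h0.symm using 3 with j _ j
    · ext x; simp only [map_mul, ew, Complex.conj_ofReal]; ring
    · ext x
      have := ew_mul_neg Θ x
      simp only [map_mul, ew, Complex.conj_ofReal] at this ⊢
      linear_combination -(A j x * conj (dw I j w x)) * this
  · intro w hw j k
    have h0 := (Submodule.mem_orthogonal _ _).1 hβ _
      (Submodule.subset_span ⟨⟨⟨w, hw⟩, j, k⟩, rfl⟩)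
    rw [geninner, sub_eq_zero, Tst.inner_left, Tst.inner_left] at h0
    convert h0 using 3 with x x <;>
    · simp only [map_mul, ew, Complex.conj_ofReal, Complex.conj_conj]; ring

lemma cs_nsq (c b : Fin n → ℂ) : ‖∑ j, c j * b j‖ ^ 2 ≤ nsq c * nsq b := by
  calc ‖∑ j, c j * b j‖ ^ 2 ≤ (∑ j, ‖c j‖ * ‖b j‖) ^ 2 := by
        gcongr
        refine (norm_sum_le _ _).trans (le_of_eq ?_)
        simp
    _ ≤ _ := Finset.sum_mul_sq_le_sq_mul_sq _ _ _

lemma wedge_nsq (c b : Fin n → ℂ) :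
    (1/2) * ∑ j, ∑ k, ‖c k * b j - c j * b k‖ ^ 2 ≤ nsq c * nsq b := by
  have h : ∀ j k, ‖c k * b j - c j * b k‖ ^ 2 = ‖c k‖ ^ 2 * ‖b j‖ ^ 2 + ‖c j‖ ^ 2 * ‖b k‖ ^ 2
      - 2 * ((c k * conj (b k)) * conj (c j * conj (b j))).re := by
    intro j k
    simp only [← Complex.normSq_eq_norm_sq]
    rw [Complex.normSq_sub, Complex.normSq_mul, Complex.normSq_mul]
    congr 3
    simp only [map_mul, Complex.conj_conj]
    ring
  have e1 : ∑ j, ∑ k, ‖c k‖ ^ 2 * ‖b j‖ ^ 2 = nsq c * nsq b := by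
    simp only [nsq]; rw [Finset.sum_mul_sum, Finset.sum_comm]
  have e2 : ∑ j, ∑ k, ‖c j‖ ^ 2 * ‖b k‖ ^ 2 = nsq c * nsq b := by
    simp only [nsq]; rw [Finset.sum_mul_sum]
  have e3 : 0 ≤ ∑ j, ∑ k, ((c k * conj (b k)) * conj (c j * conj (b j))).re := by
    simp only [← Complex.re_sum]
    rw [Finset.sum_comm, ← Finset.sum_mul_sum, ← map_sum, Complex.mul_conj, Complex.ofReal_re]
    exact Complex.normSq_nonneg _
  simp only [h, Finset.sum_sub_distrib, Finset.sum_add_distrib, e1, e2]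
  simp only [← Finset.mul_sum]
  linarith

lemma nsq_add_le (a b : Fin n → ℂ) : nsq (fun j => a j - b j) ≤ 2 * nsq a + 2 * nsq b := by
  simp only [nsq, Finset.mul_sum, ← Finset.sum_add_distrib]
  refine Finset.sum_le_sum fun j _ => ?_
  have := norm_sub_le (a j) (b j)
  nlinarith [norm_nonneg (a j - b j), sq_nonneg (‖a j‖ - ‖b j‖)]

/-- gradient -/
def gr (f : (Fin n → ℂ) → ℝ) (x : Fin n → ℂ) : Fin n → ℂ := fun j => dw (-I) j (oR f) x

lemma gr_bar {f : (Fin n → ℂ) → ℝ} (hf : SmR f) (x) (j : Fin n) :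
    dw I j (oR f) x = conj (gr f x j) := by
  change _ = conj (dw (-I) j (fun x => (f x : ℂ)) x)
  rw [dw_real_conj _ _ ((hf.differentiable (by simp)) x)]
  simp

lemma oR_sm {f : (Fin n → ℂ) → ℝ} (hf : SmR f) : Sm (oR f) := hf.ofReal

lemma Lev_smul (Ψ : (Fin n → ℂ) → ℝ) (x a : Fin n → ℂ) (r : ℝ) :
    Lev Ψ x (fun j => (r : ℂ) * a j) = r ^ 2 * Lev Ψ x a := by
  simp only [Lev]
  rw [← Complex.re_ofReal_mul, Finset.mul_sum]
  congr 1
  refine Finset.sum_congr rfl fun j _ => ?_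
  rw [Finset.mul_sum]
  refine Finset.sum_congr rfl fun k _ => ?_
  simp; ring

lemma int_mul_L2 {u v : (Fin n → ℂ) → ℂ} (hu : Tst u) (hv : MemLp v 2) :
    Integrable (fun x => u x * v x) := by
  have := L2int hv hu.conj.memLp
  refine this.congr (ae_of_all _ fun x => ?_)
  simp [mul_comm]


/-- auxiliary: the weak equations and resulting pointwise estimate -/
lemma CORE {Ψ σ χ : (Fin n → ℂ) → ℝ} (hΨ : SmR Ψ) (hσ : SmR σ) (hχ : SmR χ)
    {A : Fin n → (Fin n → ℂ) → ℂ} (hA : ∀ j, Tst (A j)) {R : ℝ} (zχ : ∀ y, R ≤ ‖y‖ → χ y = 0)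
    {U W : Set (Fin n → ℂ)} (hU : IsOpen U) (hχU : ∀ x ∈ U, χ x = 1)
    (hAU : ∀ j, tsupport (A j) ⊆ U) (hW : MeasurableSet W) (hWU : W ⊆ U) {c ε : ℝ} (hc : 0 < c)
    (H2 : ∀ x, nsq (gr χ x) ≤ ε * Real.exp (σ x))
    (H3 : ∀ x, χ x ≠ 0 → ∀ a, 2 * nsq (gr σ x) * nsq a + W.indicator (fun _ => c) x * nsq a
      ≤ Lev Ψ x a) :
    ∃ g : Fin n → (Fin n → ℂ) → ℂ, (∀ j, MemLp (g j) 2) ∧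
      (∀ w, Tst w → ∑ j, ∫ x, ew (fun x => (σ x + Ψ x) / 2) x * g j x * conj (dw I j w x)
        = ∑ j, ∫ x, A j x * conj (dw I j w x)) ∧
      IntegrableOn (fun x => Real.exp (-σ x) * nsq (fun j => g j x)) W ∧
      c * ∫ x in W, Real.exp (-σ x) * nsq (fun j => g j x) ≤
        (∫ x, ‖∑ j, dw (-I) j (A j) x‖ ^ 2 * Real.exp (Ψ x))
          + 3 * ε * ∑ j, ∫ x, ‖A j x‖ ^ 2 * Real.exp (σ x + Ψ x) := by
  obtain ⟨g, hg, hn, ha, hb⟩ := PROJ (hσ.add hΨ) hA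
  refine ⟨g, hg, ha, ?_⟩
  have hε : 0 ≤ ε := by
    have := (nsq_nonneg _).trans (H2 0)
    exact nonneg_of_mul_nonneg_left this (Real.exp_pos _)
  have hχcs : HasCompactSupport (oR χ) := hcs_of_zero (R := R) fun y hy => by simp [zχ y hy]
  have tχ : Tst (oR χ) := ⟨oR_sm hχ, hχcs⟩
  -- weights
  let E1 : (Fin n → ℂ) → ℂ := ew (fun x => (σ x - Ψ x) / 2)
  have sE1 : Sm E1 := ew_sm ((hσ.sub hΨ).div_const _)
  let β : Fin n → (Fin n → ℂ) → ℂ := fun j x => E1 x * g j x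
  let P0 : (Fin n → ℂ) → ℂ := fun x => ∑ j, dw (-I) j (A j) x
  let cc : Fin n → (Fin n → ℂ) → ℂ := fun k x => dw I k (oR χ) x - χ x * dw I k (oR σ) x
  let b : Fin n → (Fin n → ℂ) → ℂ := fun j x => χ x * β j x
  let p : (Fin n → ℂ) → ℂ := fun x => (∑ j, (dw (-I) j (oR χ) x * β j x
    + (χ x * dw (-I) j (oR Ψ) x) * β j x)) + (χ x * ew (fun x => - Ψ x) x) * P0 x
  let q : Fin n → Fin n → (Fin n → ℂ) → ℂ := fun j k x => cc k x * β j x - cc j x * β k x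
  have tb : ∀ {u : (Fin n → ℂ) → ℂ}, Tst u → ∀ j, MemLp (fun x => u x * β j x) 2 := by
    intro u hu j
    obtain ⟨R', hR'⟩ := hu.cs.isCompact.isBounded.subset_closedBall (0 : Fin n → ℂ)
    have h1 := (hu.mul_left sE1)
    obtain ⟨C, hC⟩ := h1.sm.continuous.bounded_above_of_compact_support h1.cs
    refine MemLp.of_le_mul (c := C) (hg j) ?_ (ae_of_all _ fun x => ?_)
    · exact hu.sm.continuous.aestronglyMeasurable.mul
        (sE1.continuous.aestronglyMeasurable.mul (hg j).1)
    · have : u x * β j x = (E1 x * u x) * g j x := by simp only [β]; ring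
      rw [this, norm_mul]
      gcongr
      exact hC x
  have tD : ∀ (c : ℂ) (j), Tst (dw c j (oR χ)) := fun c j => tχ.dw c j
  have tS : ∀ {f : (Fin n → ℂ) → ℂ}, Sm f → Tst (fun x => (χ x : ℂ) * f x) := fun hf => by
    have := tχ.mul_left hf
    simpa only [mul_comm] using this
  have tcc : ∀ k, Tst (cc k) := fun k =>
    ⟨ContDiff.sub (tD I k).sm (tS ((oR_sm hσ).dw I k)).sm, (tD I k).cs.sub (tS ((oR_sm hσ).dw I k)).cs⟩
  have sΨ : Sm (ew (fun x => - Ψ x)) := ew_sm hΨ.neg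
  have tP0 : Tst P0 := by
    refine ⟨ContDiff.sum fun j _ => ((hA j).dw _ _).sm, ?_⟩
    refine HasCompactSupport.intro (K := ⋃ j, tsupport (A j))
      (isCompact_iUnion fun j => (hA j).cs) fun x hx => ?_
    refine Finset.sum_eq_zero fun j _ => dw_eq_zero (fun h => hx (Set.mem_iUnion.2 ⟨j, h⟩)) _ _
  have tP1 : Tst (fun x => (χ x * ew (fun x => - Ψ x) x) * P0 x) := tP0.mul_left (tS sΨ).sm
  have zR : ∀ (c : ℂ) j x, R + 1 ≤ ‖x‖ → dw c j (oR χ) x = 0 := by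
    intro c j x hx
    have : oR χ =ᶠ[𝓝 x] fun _ => 0 := by
      have h1 : ∀ᶠ y in 𝓝 x, R < ‖y‖ := continuous_norm.continuousAt.eventually
        (lt_mem_nhds (by linarith))
      filter_upwards [h1] with y hy
      simp [zχ y hy.le]
    rw [dw_congr _ _ this, dw_const]
  have hmb : ∀ j, MemLp (b j) 2 := fun j => tb tχ j
  have hmp : MemLp p 2 := by
    refine MemLp.add (memLp_finsetSum _ fun j _ => ?_) tP1.memLp
    exact (tb (tD (-I) j) j).add (tb (tS ((oR_sm hΨ).dw (-I) j)) j)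
  have hmq : ∀ j k, MemLp (q j k) 2 := fun j k => (tb (tcc k) j).sub (tb (tcc j) k)
  have intb : ∀ {u v : (Fin n → ℂ) → ℂ}, Tst u → Sm v → ∀ j,
      Integrable (fun x => v x * u x * β j x) := by
    intro u v hu hv j
    have := int_mul_L2 ((hu.mul_left sE1).mul_left hv) (hg j)
    refine this.congr (ae_of_all _ fun x => ?_)
    simp only [β]; ring
  have wp : ∀ w, Sm w → HasCompactSupport w →
      ∑ j, ∫ x, dw (-I) j w x * b j x = - ∫ x, w x * p x := by
    intro w hw hwc
    have tw : Tst w := ⟨hw, hwc⟩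
    have tv0 : Tst (fun x => w x * (χ x * ew (fun x => - Ψ x) x)) := by
      have := tw.mul_left (tS sΨ).sm
      simpa only [mul_comm] using this
    have h1 := ha _ tv0.conj
    have dv : ∀ j x, conj (dw I j (fun x => conj (w x * (χ x * ew (fun x => - Ψ x) x))) x)
        = (dw (-I) j w x * χ x + w x * dw (-I) j (oR χ) x + w x * (χ x * dw (-I) j (oR Ψ) x))
          * ew (fun x => - Ψ x) x := by
      intro j x
      rw [dw_conj _ _ (tv0.sm.da x), Complex.conj_conj, Complex.conj_I,
        dw_mul _ _ (hw.da x) (Sm.da (tS sΨ).sm x), dw_mul _ _ ((oR_sm hχ).da x) (sΨ.da x),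
        dw_ew hΨ.neg]
      have : dw (-I) j (oR fun x => -Ψ x) x = - dw (-I) j (oR Ψ) x := by
        have := dw_const_mul (-I) j (-1) ((oR_sm hΨ).da x)
        simp only [neg_mul, one_mul] at this
        rw [← this]; congr 1; ext y; simp
      rw [this]; ring
    have eL : ∀ j x, ew (fun x => (σ x + Ψ x) / 2) x * g j x *
        conj (dw I j (fun x => conj (w x * (χ x * ew (fun x => - Ψ x) x))) x)
        = dw (-I) j w x * χ x * β j x + (w x * dw (-I) j (oR χ) x * β j x
          + w x * (χ x * dw (-I) j (oR Ψ) x) * β j x) := by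
      intro j x
      rw [dv]
      have : ew (fun x => (σ x + Ψ x) / 2) x * ew (fun x => - Ψ x) x = E1 x := by
        simp only [E1, ew, ← Complex.ofReal_mul, ← Real.exp_add]
        congr 2; ring
      simp only [β, ← this]; ring
    have eR : ∀ j, ∫ x, A j x *
        conj (dw I j (fun x => conj (w x * (χ x * ew (fun x => - Ψ x) x))) x)
        = - ∫ x, dw (-I) j (A j) x * (w x * (χ x * ew (fun x => - Ψ x) x)) := by
      intro j
      rw [← ibp (hA j).sm tv0.sm tv0.cs]
      congr 1; ext x
      rw [dw_conj _ _ (tv0.sm.da x), Complex.conj_conj, Complex.conj_I]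
    simp only [eL, eR] at h1
    have j1 : ∀ j, Integrable (fun x => dw (-I) j w x * χ x * β j x) := fun j =>
      intb tχ (hw.dw _ _) j
    have j2 : ∀ j, Integrable (fun x => w x * dw (-I) j (oR χ) x * β j x) := fun j =>
      intb (tD _ _) hw j
    have j3 : ∀ j, Integrable (fun x => w x * (χ x * dw (-I) j (oR Ψ) x) * β j x) := fun j =>
      intb (tS ((oR_sm hΨ).dw _ _)) hw j
    have j23 : ∀ j, Integrable (fun x => w x * dw (-I) j (oR χ) x * β j x
        + w x * (χ x * dw (-I) j (oR Ψ) x) * β j x) := fun j => (j2 j).add (j3 j)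
    have j4 : ∀ j, Integrable (fun x => dw (-I) j (A j) x * (w x * (χ x * ew (fun x => - Ψ x) x))) :=
      fun j => int_of_test (((hA j).dw _ _).sm.continuous.mul tv0.sm.continuous) tv0.cs.mul_left
    have k1 : ∀ j, _ := fun j => integral_add (j1 j) (j23 j)
    simp only [k1, Finset.sum_add_distrib, Finset.sum_neg_distrib] at h1
    rw [← integral_finsetSum _ (fun j _ => j23 j),
      ← integral_finsetSum _ (fun j _ => j4 j)] at h1
    have k2 : ∫ x, w x * p x = (∫ x, ∑ j, (w x * dw (-I) j (oR χ) x * β j x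
          + w x * (χ x * dw (-I) j (oR Ψ) x) * β j x)) +
        ∫ x, ∑ j, dw (-I) j (A j) x * (w x * (χ x * ew (fun x => - Ψ x) x)) := by
      rw [← integral_add (integrable_finsetSum _ fun j _ => j23 j)
        (integrable_finsetSum _ fun j _ => j4 j)]
      congr 1; ext x
      simp only [p, P0]
      rw [mul_add, Finset.mul_sum, Finset.mul_sum, Finset.mul_sum]
      congr 1
      · exact Finset.sum_congr rfl fun j _ => by ring
      · exact Finset.sum_congr rfl fun j _ => by ring
    rw [k2]
    have k3 : ∀ j, ∫ x, dw (-I) j w x * b j x = ∫ x, dw (-I) j w x * χ x * β j x := by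
      intro j; congr 1; ext x; simp only [b]; ring
    simp only [k3]
    linear_combination h1
  have wq : ∀ j k w, Sm w → HasCompactSupport w →
      (∫ x, dw I k w x * b j x) - (∫ x, dw I j w x * b k x) = - ∫ x, w x * q j k x := by
    intro j k w hw hwc
    have sσ : Sm (ew σ) := ew_sm hσ
    have tv0 : Tst (fun x => w x * (χ x * ew σ x)) := by
      have := Tst.mul_left (w := w) ⟨hw, hwc⟩ (tS sσ).sm
      simpa only [mul_comm] using this
    have h1 := hb _ tv0 j k
    have dv : ∀ j x, dw I j (fun x => w x * (χ x * ew σ x)) x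
        = (dw I j w x * χ x + w x * cc j x) * ew σ x := by
      intro j x
      rw [dw_mul _ _ (hw.da x) (Sm.da (tS sσ).sm x), dw_mul _ _ ((oR_sm hχ).da x) (sσ.da x),
        dw_ew hσ]
      simp only [cc]; ring
    have eE : ∀ x, ew σ x * ew (fun x => -((σ x + Ψ x) / 2)) x = E1 x := by
      intro x
      simp only [E1, ew, ← Complex.ofReal_mul, ← Real.exp_add]
      congr 2; ring
    have eL : ∀ j k x, dw I j (fun x => w x * (χ x * ew σ x)) x *
        (ew (fun x => -((σ x + Ψ x) / 2)) x * g k x)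
        = dw I j w x * χ x * β k x + w x * cc j x * β k x := by
      intro j k x
      rw [dv]
      simp only [β, ← eE]; ring
    simp only [eL] at h1
    have j1 : ∀ j k, Integrable (fun x => dw I j w x * χ x * β k x) := fun j k =>
      intb tχ (hw.dw _ _) k
    have j2 : ∀ j k, Integrable (fun x => w x * cc j x * β k x) := fun j k =>
      intb (tcc j) hw k
    rw [integral_add (j1 _ _) (j2 _ _), integral_add (j1 _ _) (j2 _ _)] at h1
    have k2 : ∫ x, w x * q j k x = (∫ x, w x * cc k x * β j x) - ∫ x, w x * cc j x * β k x := by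
      rw [← integral_sub (j2 _ _) (j2 _ _)]
      congr 1; ext x
      simp only [q]; ring
    have k3 : ∀ j k, ∫ x, dw I k w x * b j x = ∫ x, dw I k w x * χ x * β j x := by
      intro j k; congr 1; ext x; simp only [b]; ring
    rw [k2, k3, k3]
    linear_combination -h1
  have z0 : ∀ x, R + 1 ≤ ‖x‖ → χ x = 0 := fun x hx => zχ x (by linarith)
  have BW := BIweak hΨ (R := R + 1) hmb hmp hmq (fun j y hy => by simp [b, z0 y hy])
    (fun y hy => by simp [p, z0 y hy, zR _ _ y hy])
    (fun j k y hy => by simp [q, cc, z0 y hy, zR _ _ y hy]) wp wq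
  have hgm : Integrable (fun x => nsq (fun j => g j x)) := by
    refine integrable_finsetSum _ fun j _ => ?_
    exact (hg j).integrable_norm_pow (by norm_num)
  have iP : Integrable (fun x => ‖P0 x‖ ^ 2 * Real.exp (Ψ x)) := by
    refine Continuous.integrable_of_hasCompactSupport
      ((tP0.sm.continuous.norm.pow 2).mul hΨ.continuous.rexp) ?_
    refine tP0.cs.mono fun x hx => ?_
    simp only [Function.mem_support] at hx ⊢
    intro h; simp [h] at hx
  have nβ : ∀ x, nsq (fun j => β j x) * Real.exp (-Ψ x)
      = Real.exp (-σ x) * nsq (fun j => g j x) := by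
    intro x
    simp only [β, E1, ew]
    rw [show (fun j => ((Real.exp (-((σ x - Ψ x) / 2)) : ℝ) : ℂ) * g j x) =
      (fun j => ((Real.exp (-((σ x - Ψ x) / 2)) : ℝ) : ℂ) • g j x) from rfl]
    simp only [nsq, norm_smul, mul_pow, ← Finset.mul_sum, Complex.norm_real, Real.norm_eq_abs,
      Real.abs_exp]
    rw [mul_right_comm]
    congr 1
    rw [← Real.exp_nat_mul, ← Real.exp_add]; congr 1; push_cast; ring
  have key : ∀ x, QF Ψ b p q x ≤ ‖P0 x‖ ^ 2 * Real.exp (Ψ x) + 3 * ε * nsq (fun j => g j x)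
      - c * W.indicator (fun x => Real.exp (-σ x) * nsq (fun j => g j x)) x := by
    intro x
    have hT : p x + ∑ j, (-dw (-I) j (oR Ψ) x) * b j x
        = (∑ j, gr χ x j * β j x) + χ x * ew (fun x => - Ψ x) x * P0 x := by
      simp only [p, b, gr, Finset.sum_add_distrib]
      have : ∑ j, (-dw (-I) j (oR Ψ) x) * (χ x * β j x)
          = - ∑ j, (χ x * dw (-I) j (oR Ψ) x) * β j x := by
        rw [← Finset.sum_neg_distrib]; exact Finset.sum_congr rfl fun j _ => by ring
      rw [this]; ring
    have hL : χ x ^ 2 * (2 * nsq (gr σ x) * nsq (fun j => β j x)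
        + W.indicator (fun _ => c) x * nsq (fun j => β j x)) ≤ Lev Ψ x (fun j => b j x) := by
      rw [show Lev Ψ x (fun j => b j x) = χ x ^ 2 * Lev Ψ x (fun j => β j x) from Lev_smul _ _ _ _]
      by_cases h : χ x = 0
      · simp [h]
      · exact mul_le_mul_of_nonneg_left (H3 x h _) (sq_nonneg _)
    have hq : (1/2) * ∑ j, ∑ k, ‖q j k x‖ ^ 2 ≤ nsq (fun k => cc k x) * nsq (fun j => β j x) :=
      wedge_nsq (fun k => cc k x) (fun j => β j x)
    have hcc : ∀ k, cc k x = conj (gr χ x k - χ x * gr σ x k) := by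
      intro k
      simp only [cc, gr_bar hχ, gr_bar hσ]; simp
    have hcn : nsq (fun k => cc k x) = nsq (fun k => gr χ x k - χ x * gr σ x k) := by
      simp only [nsq, hcc, Complex.norm_conj]
    have hcσ : nsq (fun k => (χ x : ℂ) * gr σ x k) = χ x ^ 2 * nsq (gr σ x) := by
      simp [nsq, mul_pow, Finset.mul_sum]
    have nn1 := nsq_nonneg (fun j => β j x)
    have nn2 := nsq_nonneg (gr σ x)
    have nn3 := nsq_nonneg (fun j => g j x)
    have ee : Real.exp (σ x) * Real.exp (-σ x) = 1 := by rw [← Real.exp_add]; simp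
    have eP : Real.exp (Ψ x) * Real.exp (-Ψ x) = 1 := by rw [← Real.exp_add]; simp
    have ep := Real.exp_pos (-Ψ x)
    unfold QF
    rw [hT]
    by_cases hx : x ∈ U
    · have g0 : gr χ x = 0 := by
        ext j
        have : oR χ =ᶠ[𝓝 x] fun _ => 1 := by
          filter_upwards [hU.mem_nhds hx] with y hy
          simp [hχU y hy]
        simp only [gr]
        rw [dw_congr _ _ this, dw_const]; rfl
      have c1 := hχU x hx
      rw [hcn] at hq
      simp only [g0, c1, Pi.zero_apply, zero_mul, Finset.sum_const_zero, zero_add, Complex.ofReal_one,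
        one_mul, zero_sub] at hq hL ⊢
      have e2 : nsq (fun k => - gr σ x k) = nsq (gr σ x) := by simp [nsq]
      rw [e2] at hq
      have e3 : ‖ew (fun x => - Ψ x) x * P0 x‖ ^ 2 * Real.exp (-Ψ x)
          = ‖P0 x‖ ^ 2 * Real.exp (Ψ x) := by
        simp only [ew, neg_neg, norm_mul, Complex.norm_real, Real.norm_eq_abs, Real.abs_exp]
        linear_combination (‖P0 x‖ ^ 2 * Real.exp (Ψ x)) * eP
      have e4 : W.indicator (fun _ => c) x * nsq (fun j => β j x) * Real.exp (-Ψ x)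
          = c * W.indicator (fun x => Real.exp (-σ x) * nsq (fun j => g j x)) x := by
        by_cases hw : x ∈ W
        · simp only [Set.indicator_of_mem hw]; rw [mul_assoc, nβ]
        · simp [Set.indicator_of_notMem hw]
      rw [sub_mul, add_mul, e3, ← e4]
      have h5 : (1/2) * ∑ j, ∑ k, ‖q j k x‖ ^ 2 - Lev Ψ x (fun j => b j x)
          + W.indicator (fun _ => c) x * nsq (fun j => β j x) ≤ 0 := by nlinarith [mul_nonneg nn2 nn1]
      have h6 := mul_nonpos_of_nonpos_of_nonneg h5 ep.le
      have h7 : 0 ≤ 3 * ε * nsq (fun j => g j x) := by positivity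
      linarith [h6, h7]
    · have hP : P0 x = 0 := Finset.sum_eq_zero fun j _ => dw_eq_zero (fun h => hx (hAU j h)) _ _
      have hw : x ∉ W := fun h => hx (hWU h)
      simp only [Set.indicator_of_notMem hw, hP] at hL ⊢
      have h1 := cs_nsq (gr χ x) (fun j => β j x)
      have h2 : nsq (fun k => cc k x) ≤ 2 * nsq (gr χ x) + 2 * (χ x ^ 2 * nsq (gr σ x)) := by
        rw [hcn, ← hcσ]; exact nsq_add_le _ _
      have h3 := mul_le_mul_of_nonneg_right h2 nn1
      have h4 : (‖(∑ j, gr χ x j * β j x)‖ ^ 2 + (1/2) * ∑ j, ∑ k, ‖q j k x‖ ^ 2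
          - Lev Ψ x (fun j => b j x)) ≤ 3 * (nsq (gr χ x) * nsq (fun j => β j x)) := by
        nlinarith
      have h5 : nsq (gr χ x) * nsq (fun j => β j x) * Real.exp (-Ψ x) ≤ ε * nsq (fun j => g j x) := by
        rw [mul_assoc, nβ]
        have := mul_le_mul_of_nonneg_right (H2 x) (mul_nonneg (Real.exp_pos (-σ x)).le nn3)
        refine this.trans (le_of_eq ?_)
        linear_combination (ε * nsq (fun j => g j x)) * ee
      have h6 := mul_le_mul_of_nonneg_right h4 ep.le
      simp only [mul_zero, add_zero]
      refine h6.trans ?_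
      simp only [norm_zero]
      norm_num
      linarith
  have iW : Integrable (fun x => c * W.indicator (fun x => Real.exp (-σ x) * nsq (fun j => g j x)) x) := by
    refine Integrable.mono' ((iP.add (hgm.const_mul (3 * ε))).sub BW.1) ?_ (ae_of_all _ fun x => ?_)
    · refine AEStronglyMeasurable.const_mul ?_ _
      refine AEStronglyMeasurable.indicator ?_ hW
      exact (hσ.continuous.neg.rexp.aestronglyMeasurable).mul hgm.1
    · rw [Real.norm_of_nonneg]
      · have := key x
        simp only [Pi.sub_apply, Pi.add_apply]; linarith
      · refine mul_nonneg hc.le (Set.indicator_nonneg (fun x _ => ?_) _)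
        exact mul_nonneg (Real.exp_pos _).le (nsq_nonneg _)
  have h1 := BW.2.trans (integral_mono BW.1 ((iP.add (hgm.const_mul (3 * ε))).sub iW) key)
  have h2 : ∫ x, (‖P0 x‖ ^ 2 * Real.exp (Ψ x) + 3 * ε * nsq (fun j => g j x)
      - c * W.indicator (fun x => Real.exp (-σ x) * nsq (fun j => g j x)) x) =
      (∫ x, ‖P0 x‖ ^ 2 * Real.exp (Ψ x)) + 3 * ε * (∫ x, nsq (fun j => g j x)) -
      c * ∫ x in W, Real.exp (-σ x) * nsq (fun j => g j x) := by
    have iPg : Integrable (fun x => ‖P0 x‖ ^ 2 * Real.exp (Ψ x) + 3 * ε * nsq (fun j => g j x)) :=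
      iP.add (hgm.const_mul (3 * ε))
    rw [integral_sub iPg iW, integral_add iP (hgm.const_mul (3 * ε)),
      integral_const_mul, integral_const_mul, integral_indicator hW]
  have h3 : ∫ x, nsq (fun j => g j x) = ∑ j, ∫ x, ‖g j x‖ ^ 2 := by
    simp only [nsq]
    exact integral_finsetSum _ fun j _ => (hg j).integrable_norm_pow (by norm_num)
  have h4 := mul_le_mul_of_nonneg_left hn (show 0 ≤ 3 * ε by positivity)
  have h1 := h1.trans_eq h2
  rw [h3] at h1
  simp only [P0] at h1
  refine ⟨?_, by linarith⟩
  rw [← integrable_indicator_iff hW]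
  have := iW.const_mul c⁻¹
  refine this.congr (ae_of_all _ fun x => ?_)
  simp only; rw [← mul_assoc, inv_mul_cancel₀ hc.ne', one_mul]

lemma cs_int {μ : Measure (Fin n → ℂ)} {F G : Fin n → (Fin n → ℂ) → ℂ}
    (hF : Integrable (fun x => nsq (fun j => F j x)) μ)
    (hG : Integrable (fun x => nsq (fun j => G j x)) μ) :
    ‖∫ x, ∑ j, F j x * G j x ∂μ‖ ^ 2 ≤
      (∫ x, nsq (fun j => F j x) ∂μ) * ∫ x, nsq (fun j => G j x) ∂μ := by
  have p1 : 0 ≤ ∫ x, nsq (fun j => F j x) ∂μ := integral_nonneg fun x => nsq_nonneg _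
  have p2 : 0 ≤ ∫ x, nsq (fun j => G j x) ∂μ := integral_nonneg fun x => nsq_nonneg _
  by_cases hi : Integrable (fun x => ∑ j, F j x * G j x) μ
  swap
  · rw [integral_undef hi]; simp; positivity
  have h := norm_integral_le_integral_norm (μ := μ) (fun x => ∑ j, F j x * G j x)
  set X := ∫ x, ‖∑ j, F j x * G j x‖ ∂μ
  have key : ∀ t : ℝ, 0 ≤ (∫ x, nsq (fun j => F j x) ∂μ) * (t * t) + (-2 * X) * t
      + ∫ x, nsq (fun j => G j x) ∂μ := by
    intro t
    have h1 : ∫ x, (2 * t) * ‖∑ j, F j x * G j x‖ ∂μ ≤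
        ∫ x, (t ^ 2 * nsq (fun j => F j x) + nsq (fun j => G j x)) ∂μ := by
      refine integral_mono (hi.norm.const_mul _) ((hF.const_mul _).add hG) fun x => ?_
      have h2 := cs_nsq (fun j => F j x) (fun j => G j x)
      have n1 := nsq_nonneg (fun j => F j x)
      have n2 := nsq_nonneg (fun j => G j x)
      simp only [Pi.add_apply]
      set Y := ‖∑ j, F j x * G j x‖
      have hY : 0 ≤ Y := norm_nonneg _
      set a := nsq (fun j => F j x)
      set b := nsq (fun j => G j x)
      refine abs_le_of_sq_le_sq' ?_ (by positivity) |>.2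
      nlinarith [sq_nonneg (t ^ 2 * a - b), mul_le_mul_of_nonneg_left h2 (sq_nonneg t)]
    rw [integral_const_mul, integral_add (hF.const_mul _) hG, integral_const_mul] at h1
    simp only [X]; linarith
  have := discrim_le_zero key
  unfold discrim at this
  nlinarith [norm_nonneg (∫ x, ∑ j, F j x * G j x ∂μ)]

lemma CORE2 {Ψ σ χ : (Fin n → ℂ) → ℝ} (hΨ : SmR Ψ) (hσ : SmR σ) (hχ : SmR χ)
    {A : Fin n → (Fin n → ℂ) → ℂ} (hA : ∀ j, Tst (A j)) {R : ℝ} (zχ : ∀ y, R ≤ ‖y‖ → χ y = 0)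
    {U W : Set (Fin n → ℂ)} (hU : IsOpen U) (hχU : ∀ x ∈ U, χ x = 1)
    (hAU : ∀ j, tsupport (A j) ⊆ U) (hW : MeasurableSet W) (hWU : W ⊆ U) {c ε : ℝ} (hc : 0 < c)
    (H2 : ∀ x, nsq (gr χ x) ≤ ε * Real.exp (σ x))
    (H3 : ∀ x, χ x ≠ 0 → ∀ a, 2 * nsq (gr σ x) * nsq a + W.indicator (fun _ => c) x * nsq a
      ≤ Lev Ψ x a) {u : (Fin n → ℂ) → ℂ} (hu : Tst u) (huW : ∀ j, ∀ x ∉ W, dw I j u x = 0) :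
    c * ‖∑ j, ∫ x, A j x * conj (dw I j u x)‖ ^ 2 ≤
      (∫ x, nsq (fun j => dw I j u x) * Real.exp (-Ψ x)) *
      ((∫ x, ‖∑ j, dw (-I) j (A j) x‖ ^ 2 * Real.exp (Ψ x))
          + 3 * ε * ∑ j, ∫ x, ‖A j x‖ ^ 2 * Real.exp (σ x + Ψ x)) := by
  obtain ⟨g, hg, ha, hi, he⟩ := CORE hΨ hσ hχ hA zχ hU hχU hAU hW hWU hc H2 H3
  rw [← ha u hu]
  let F : Fin n → (Fin n → ℂ) → ℂ := fun j x => ew (fun x => σ x / 2) x * g j x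
  let G : Fin n → (Fin n → ℂ) → ℂ := fun j x => ew (fun x => Ψ x / 2) x * conj (dw I j u x)
  have nF : ∀ x, nsq (fun j => F j x) = Real.exp (-σ x) * nsq (fun j => g j x) := by
    intro x
    simp only [nsq, F, norm_mul, mul_pow, ← Finset.mul_sum, ew, Complex.norm_real, Real.norm_eq_abs,
      Real.abs_exp]
    congr 1
    rw [← Real.exp_nat_mul]; congr 1; push_cast; ring
  have nG : ∀ x, nsq (fun j => G j x) = nsq (fun j => dw I j u x) * Real.exp (-Ψ x) := by
    intro x
    simp only [nsq, G, norm_mul, mul_pow, ← Finset.mul_sum, ew, Complex.norm_real, Real.norm_eq_abs,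
      Real.abs_exp, Complex.norm_conj]
    rw [mul_comm]
    congr 1
    rw [← Real.exp_nat_mul]; congr 1; push_cast; ring
  have iG : Integrable (fun x => nsq (fun j => G j x)) := by
    refine integrable_finsetSum _ fun j _ => ?_
    have : Tst (G j) := (hu.dw I j).conj.mul_left (ew_sm (hΨ.div_const _))
    exact this.memLp.integrable_norm_pow (by norm_num)
  have e1 : ∑ j, ∫ x, ew (fun x => (σ x + Ψ x) / 2) x * g j x * conj (dw I j u x)
      = ∫ x in W, ∑ j, F j x * G j x := by
    have hFG : ∀ j x, ew (fun x => (σ x + Ψ x) / 2) x * g j x * conj (dw I j u x) = F j x * G j x := by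
      intro j x
      have : ew (fun x => (σ x + Ψ x) / 2) x = ew (fun x => σ x / 2) x * ew (fun x => Ψ x / 2) x := by
        simp only [ew, ← Complex.ofReal_mul, ← Real.exp_add]
        congr 2; ring
      simp only [F, G, this]; ring
    rw [setIntegral_eq_integral_of_forall_compl_eq_zero, integral_finsetSum]
    · simp only [hFG]
    · intro j _
      simp only [← hFG]
      refine (int_mul_L2 ((hu.dw I j).conj.mul_left (ew_sm ((hσ.add hΨ).div_const 2))) (hg j)).congr
        (ae_of_all _ fun x => ?_)
      simp only; ring!
    · intro x hx
      exact Finset.sum_eq_zero fun j _ => by simp [G, huW j x hx]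
  rw [e1]
  have h1 := cs_int (μ := volume.restrict W) (F := F) (G := G) (by simp only [nF]; exact hi)
    iG.integrableOn
  simp only [nF] at h1
  have h2 : ∫ x in W, nsq (fun j => G j x) = ∫ x, nsq (fun j => dw I j u x) * Real.exp (-Ψ x) := by
    rw [setIntegral_eq_integral_of_forall_compl_eq_zero]
    · simp only [nG]
    · intro x hx; rw [nG]; simp [nsq, huW _ x hx]
  rw [h2] at h1
  have h3 : 0 ≤ ∫ x, nsq (fun j => dw I j u x) * Real.exp (-Ψ x) :=
    integral_nonneg fun x => mul_nonneg (nsq_nonneg _) (Real.exp_pos _).le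
  calc _ ≤ c * _ := mul_le_mul_of_nonneg_left h1 hc.le
    _ = (∫ x, nsq (fun j => dw I j u x) * Real.exp (-Ψ x)) *
      (c * ∫ x in W, Real.exp (-σ x) * nsq (fun j => g j x)) := by ring
    _ ≤ _ := mul_le_mul_of_nonneg_left he h3

lemma dw_aff {s : (Fin n → ℂ) → ℝ} (hs : SmR s) (r t : ℝ) (c : ℂ) (j : Fin n) (x) :
    dw c j (oR fun x => r * s x + t) x = r * dw c j (oR s) x := by
  have h1 : HasDerivAt (fun y : ℝ => r * y + t) r (s x) := by
    simpa using ((hasDerivAt_id (s x)).const_mul r).add_const t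
  exact dw_compReal c j ((hs.differentiable (by simp)) x) h1

lemma dw_exp {s : (Fin n → ℂ) → ℝ} (hs : SmR s) (r : ℝ) (c : ℂ) (j : Fin n) (x) :
    dw c j (oR fun x => r * Real.exp (s x)) x
      = ((r * Real.exp (s x) : ℝ) : ℂ) * dw c j (oR s) x := by
  exact dw_compReal c j ((hs.differentiable (by simp)) x) ((Real.hasDerivAt_exp (s x)).const_mul r)

lemma Lev_aff {s : (Fin n → ℂ) → ℝ} (hs : SmR s) (r t : ℝ) (x a : Fin n → ℂ) :
    Lev (fun x => r * s x + t) x a = r * Lev s x a := by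
  have h : ∀ j k, Hs (fun x => r * s x + t) j k x = r * Hs s j k x := by
    intro j k
    unfold Hs
    rw [show dw (-I) j (oR fun x => r * s x + t) = fun y => (r : ℂ) * dw (-I) j (oR s) y from
      funext fun y => dw_aff hs r t _ _ y, dw_const_mul _ _ _ (((oR_sm hs).dw _ _).da x)]
  unfold Lev
  simp only [h]
  rw [← Complex.re_ofReal_mul]
  congr 1
  simp only [Finset.mul_sum]
  exact Finset.sum_congr rfl fun j _ => Finset.sum_congr rfl fun k _ => by ring

lemma Lev_add {s t : (Fin n → ℂ) → ℝ} (hs : SmR s) (ht : SmR t) (x a : Fin n → ℂ) :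
    Lev (fun x => s x + t x) x a = Lev s x a + Lev t x a := by
  have h0 : ∀ c j y, dw c j (oR fun x => s x + t x) y = dw c j (oR s) y + dw c j (oR t) y := by
    intro c j y
    rw [← dw_add _ _ ((oR_sm hs).da y) ((oR_sm ht).da y)]
    congr 1; ext z; simp
  have h : ∀ j k, Hs (fun x => s x + t x) j k x = Hs s j k x + Hs t j k x := by
    intro j k
    unfold Hs
    rw [funext (h0 (-I) j), dw_add _ _ (((oR_sm hs).dw _ _).da x) (((oR_sm ht).dw _ _).da x)]
  unfold Lev
  simp only [h]
  rw [← Complex.add_re]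
  congr 1
  simp only [← Finset.sum_add_distrib]
  exact Finset.sum_congr rfl fun j _ => Finset.sum_congr rfl fun k _ => by ring

lemma Lev_exp {s : (Fin n → ℂ) → ℝ} (hs : SmR s) {r : ℝ} (hr : 0 ≤ r) (x a : Fin n → ℂ) :
    r * Real.exp (s x) * Lev s x a ≤ Lev (fun x => r * Real.exp (s x)) x a := by
  have sk : SmR (fun x => r * Real.exp (s x)) := contDiff_const.mul (Real.contDiff_exp.comp hs)
  have h : ∀ j k, Hs (fun x => r * Real.exp (s x)) j k x
      = ((r * Real.exp (s x) : ℝ) : ℂ) * (Hs s j k x + gr s x j * conj (gr s x k)) := by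
    intro j k
    unfold Hs
    rw [funext (dw_exp hs r (-I) j), dw_mul _ _ ((oR_sm sk).da x) (((oR_sm hs).dw _ _).da x)]
    have := dw_exp hs r I k x
    rw [this, ← gr_bar hs]
    simp only [gr]; ring
  unfold Lev
  simp only [h]
  have e : ∑ j, ∑ k, ((r * Real.exp (s x) : ℝ) : ℂ) * (Hs s j k x + gr s x j * conj (gr s x k))
      * a j * conj (a k) = ((r * Real.exp (s x) : ℝ) : ℂ) * ((∑ j, ∑ k, Hs s j k x * a j * conj (a k))
        + (∑ j, gr s x j * a j) * conj (∑ j, gr s x j * a j)) := by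
    rw [map_sum, Finset.sum_mul_sum, ← Finset.sum_add_distrib, Finset.mul_sum]
    refine Finset.sum_congr rfl fun j _ => ?_
    rw [← Finset.sum_add_distrib, Finset.mul_sum]
    refine Finset.sum_congr rfl fun k _ => ?_
    rw [map_mul]; ring
  rw [e, Complex.re_ofReal_mul, Complex.add_re, Complex.mul_conj, Complex.ofReal_re]
  have h1 : 0 ≤ r * Real.exp (s x) := by positivity
  have h2 := mul_nonneg h1 (Complex.normSq_nonneg (∑ j, gr s x j * a j))
  rw [mul_add]; linarith

lemma gr_cont {s : (Fin n → ℂ) → ℝ} (hs : SmR s) : Continuous (fun x => nsq (gr s x)) := by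
  unfold nsq gr
  exact continuous_finsetSum _ fun j _ => (((oR_sm hs).dw (-I) j).continuous.norm.pow 2)

/-- The basic a priori estimate -/
lemma APRIORI {s ψ : (Fin n → ℂ) → ℝ} (hs : SmR s) (hψ : SmR ψ) {R c0 c : ℝ} (hc0 : 0 < c0)
    (hc : 0 < c) (hR : ∀ y, s y ≤ 0 → ‖y‖ < R) (hLs : ∀ x, s x ≤ 0 → ∀ a, c0 * nsq a ≤ Lev s x a)
    {W : Set (Fin n → ℂ)} (hW : MeasurableSet W) (hWs : ∀ x ∈ W, s x ≤ -1)
    (hLψ : ∀ x, s x ≤ 0 → ∀ a, W.indicator (fun _ => c) x * nsq a ≤ Lev ψ x a)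
    {A : Fin n → (Fin n → ℂ) → ℂ} (hA : ∀ j, Tst (A j)) (hAs : ∀ j, ∀ x ∈ tsupport (A j), s x ≤ -1)
    {u : (Fin n → ℂ) → ℂ} (hu : Tst u) (huW : ∀ j, ∀ x ∉ W, dw I j u x = 0) :
    c * ‖∑ j, ∫ x, A j x * conj (dw I j u x)‖ ^ 2 ≤
      (∫ x, nsq (fun j => dw I j u x) * Real.exp (-ψ x)) *
      (Real.exp 1 * ∫ x, ‖∑ j, dw (-I) j (A j) x‖ ^ 2 * Real.exp (ψ x)) := by
  let χ : (Fin n → ℂ) → ℝ := fun x => Real.smoothTransition (-1 - 4 * s x)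
  have hχ : SmR χ := Real.smoothTransition.contDiff.comp (contDiff_const.sub (contDiff_const.mul hs))
  have χ1 : ∀ x, s x ≤ -1/2 → χ x = 1 := fun x hx =>
    Real.smoothTransition.one_of_one_le (by linarith)
  have χ0 : ∀ x, -1/4 ≤ s x → χ x = 0 := fun x hx =>
    Real.smoothTransition.zero_of_nonpos (by linarith)
  have zχ : ∀ y, R ≤ ‖y‖ → χ y = 0 := fun y hy => χ0 y (by
    by_contra h
    have := hR y (by linarith)
    linarith)
  have hKc : IsCompact {x | s x ≤ 0} := by
    refine Metric.isCompact_of_isClosed_isBounded (isClosed_le hs.continuous continuous_const) ?_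
    exact Metric.isBounded_closedBall.subset (t := Metric.closedBall 0 R)
      fun x hx => by simpa using (hR x hx).le
  obtain ⟨M, hM⟩ := hKc.exists_bound_of_continuousOn (gr_cont hs).continuousOn
  obtain ⟨M', hM'⟩ := hKc.exists_bound_of_continuousOn (gr_cont hχ).continuousOn
  have hM0 : ∀ x, s x ≤ 0 → nsq (gr s x) ≤ max M 1 := fun x hx =>
    (le_abs_self _).trans ((hM x hx).trans (le_max_left _ _))
  have hM0' : ∀ x, s x ≤ 0 → nsq (gr χ x) ≤ M' := fun x hx => (le_abs_self _).trans (hM' x hx)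
  set m := max M 1 with hm
  have hm1 : 1 ≤ m := le_max_right _ _
  have grχ0 : ∀ x, (s x < -1/2 ∨ -1/4 < s x) → nsq (gr χ x) = 0 := by
    intro x hx
    have : ∃ v : ℂ, oR χ =ᶠ[𝓝 x] fun _ => v := by
      rcases hx with hx | hx
      · refine ⟨1, ?_⟩
        filter_upwards [hs.continuous.continuousAt.eventually (gt_mem_nhds hx)] with y hy
        simp [χ1 y hy.le]
      · refine ⟨0, ?_⟩
        filter_upwards [hs.continuous.continuousAt.eventually (lt_mem_nhds hx)] with y hy
        simp [χ0 y hy.le]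
    obtain ⟨v, hv⟩ := this
    simp [nsq, gr, dw_congr _ _ hv, dw_const]
  set P := ∫ x, nsq (fun j => dw I j u x) * Real.exp (-ψ x) with hP
  set Q := ∫ x, ‖∑ j, dw (-I) j (A j) x‖ ^ 2 * Real.exp (ψ x) with hQ
  set S := ∑ j, ∫ x, ‖A j x‖ ^ 2 * Real.exp (ψ x) with hS
  have hP0 : 0 ≤ P := integral_nonneg fun x => mul_nonneg (nsq_nonneg _) (Real.exp_pos _).le
  have iA : ∀ {f : (Fin n → ℂ) → ℝ}, SmR f → ∀ {v : (Fin n → ℂ) → ℂ}, Tst v →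
      Integrable fun x => ‖v x‖ ^ 2 * Real.exp (f x) := by
    intro f hf v hv
    refine Continuous.integrable_of_hasCompactSupport
      ((hv.sm.continuous.norm.pow 2).mul hf.continuous.rexp) ?_
    refine hv.cs.mono fun x hx => ?_
    simp only [Function.mem_support] at hx ⊢
    intro h; simp [h] at hx
  have tP0 : Tst fun x => ∑ j, dw (-I) j (A j) x := by
    refine ⟨ContDiff.sum fun j _ => ((hA j).dw _ _).sm, ?_⟩
    refine HasCompactSupport.intro (K := ⋃ j, tsupport (A j))
      (isCompact_iUnion fun j => (hA j).cs) fun x hx => ?_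
    refine Finset.sum_eq_zero fun j _ => dw_eq_zero (fun h => hx (Set.mem_iUnion.2 ⟨j, h⟩)) _ _
  have main : ∀ ε : ℝ, 0 < ε → c * ‖∑ j, ∫ x, A j x * conj (dw I j u x)‖ ^ 2 ≤
      P * (Real.exp 1 * Q + 3 * ε * (Real.exp 2 * S)) := by
    intro ε hε
    obtain ⟨N, hN0, hN1, hN2⟩ : ∃ N : ℝ, 0 < N ∧ N * m / c0 * Real.exp (-(N / 2)) ≤ 1 ∧
        M' ≤ ε * Real.exp (Real.exp (N / 4)) := by
      have t1 : Tendsto (fun N : ℝ => N * m / c0 * Real.exp (-(N / 2))) atTop (𝓝 0) := by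
        have h0 := (Real.tendsto_pow_mul_exp_neg_atTop_nhds_zero 1).comp
          (tendsto_id.atTop_div_const (show (0:ℝ) < 2 by norm_num))
        have h1 := h0.const_mul (2 * m / c0)
        rw [mul_zero] at h1
        refine h1.congr fun N => ?_
        simp only [Function.comp, id, pow_one]; ring
      have t2 : Tendsto (fun N : ℝ => ε * Real.exp (Real.exp (N / 4))) atTop atTop := by
        refine Tendsto.const_mul_atTop hε ?_
        exact Real.tendsto_exp_atTop.comp (Real.tendsto_exp_atTop.comp
          (tendsto_id.atTop_div_const (show (0:ℝ) < 4 by norm_num)))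
      obtain ⟨N, h⟩ := ((eventually_gt_atTop (0:ℝ)).and ((t1.eventually (ge_mem_nhds
        (show (0:ℝ) < 1 by norm_num))).and (t2.eventually (eventually_ge_atTop M')))).exists
      exact ⟨N, h.1, h.2.1, h.2.2⟩
    set l := N * m / c0 with hl
    have hl0 : 0 < l := by positivity
    let f : (Fin n → ℂ) → ℝ := fun x => N * s x + 3 * N / 4
    have hf : SmR f := (contDiff_const.mul hs).add contDiff_const
    let f2 : (Fin n → ℂ) → ℝ := fun x => (2 * N) * s x + 3 * N / 2
    have hf2 : SmR f2 := (contDiff_const.mul hs).add contDiff_const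
    let σ : (Fin n → ℂ) → ℝ := fun x => 1 * Real.exp (f x)
    have hσ : SmR σ := contDiff_const.mul (Real.contDiff_exp.comp hf)
    let κ : (Fin n → ℂ) → ℝ := fun x => l * Real.exp (f2 x)
    have hκ : SmR κ := contDiff_const.mul (Real.contDiff_exp.comp hf2)
    let Ψ : (Fin n → ℂ) → ℝ := fun x => ψ x + κ x
    have hΨ : SmR Ψ := hψ.add hκ
    have κ0 : ∀ x, 0 ≤ κ x := fun x => by positivity
    have κ1 : ∀ x, s x ≤ -1 → κ x ≤ 1 := by
      intro x hx
      refine le_trans (mul_le_mul_of_nonneg_left (Real.exp_le_exp.2 ?_) hl0.le) hN1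
      simp only [f2]; nlinarith
    have σ1 : ∀ x, s x ≤ -1 → σ x ≤ 1 := by
      intro x hx
      simp only [σ, one_mul]
      rw [Real.exp_le_one_iff]
      simp only [f]; nlinarith
    have H2 : ∀ x, nsq (gr χ x) ≤ ε * Real.exp (σ x) := by
      intro x
      by_cases h : s x < -1/2 ∨ -1/4 < s x
      · rw [grχ0 x h]; positivity
      · push Not at h
        refine (hM0' x (by linarith)).trans (hN2.trans ?_)
        gcongr
        simp only [σ, one_mul]
        gcongr
        simp only [f]; nlinarith
    have H3 : ∀ x, χ x ≠ 0 → ∀ a, 2 * nsq (gr σ x) * nsq a + W.indicator (fun _ => c) x * nsq a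
      ≤ Lev Ψ x a := by
      intro x hx a
      have hsx : s x ≤ 0 := by
        by_contra h
        exact hx (χ0 x (by linarith))
      have h1 : Lev Ψ x a = Lev ψ x a + Lev κ x a := Lev_add hψ hκ x a
      have h2 := Lev_exp hf2 hl0.le x a
      have h3 : Lev f2 x a = 2 * N * Lev s x a := Lev_aff hs _ _ x a
      have h4 : ∀ j, gr σ x j = ((N * Real.exp (f x) : ℝ) : ℂ) * gr s x j := by
        intro j
        simp only [gr, σ]
        rw [dw_exp hf, dw_aff hs]; push_cast; ring
      have h5 : nsq (gr σ x) = N ^ 2 * Real.exp (f2 x) * nsq (gr s x) := by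
        simp only [nsq, h4, norm_mul, mul_pow, ← Finset.mul_sum, Complex.norm_real, Real.norm_eq_abs,
          sq_abs]
        congr 2
        rw [← Real.exp_nat_mul]; congr 1; simp only [f, f2]; push_cast; ring
      have h6 := hLψ x hsx a
      have h7 := hLs x hsx a
      have h8 := hM0 x hsx
      have n1 := nsq_nonneg a
      have e1 := Real.exp_pos (f2 x)
      rw [h1, h5]
      rw [h3] at h2
      have h9 : 2 * (N ^ 2 * Real.exp (f2 x) * nsq (gr s x)) * nsq a ≤
          2 * (N ^ 2 * Real.exp (f2 x) * m) * nsq a := by gcongr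
      have h10 : 2 * (N ^ 2 * Real.exp (f2 x) * m) * nsq a =
          l * Real.exp (f2 x) * (2 * N * (c0 * nsq a)) := by
        rw [hl]; field_simp
      have h11 : l * Real.exp (f2 x) * (2 * N * (c0 * nsq a)) ≤
          l * Real.exp (f2 x) * (2 * N * Lev s x a) := by gcongr
      have h12 : Lev κ x a = Lev (fun x => l * Real.exp (f2 x)) x a := rfl
      rw [h12]
      linarith
    have hUo : IsOpen {x | s x < -1/2} := isOpen_lt hs.continuous continuous_const
    have C := CORE2 hΨ hσ hχ hA zχ hUo (fun x hx => χ1 x (le_of_lt hx))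
      (fun j x hx => by have := hAs j x hx; simp only [Set.mem_ofPred_eq]; linarith) hW
      (fun x hx => by have := hWs x hx; simp only [Set.mem_ofPred_eq]; linarith) hc H2 H3 hu huW
    refine C.trans ?_
    have iu : ∀ {g : (Fin n → ℂ) → ℝ}, SmR g →
        Integrable fun x => nsq (fun j => dw I j u x) * Real.exp (-g x) := by
      intro g hg
      simp only [nsq, Finset.sum_mul]
      exact integrable_finsetSum _ fun j _ => iA hg.neg (hu.dw I j)
    have b1 : ∫ x, nsq (fun j => dw I j u x) * Real.exp (-Ψ x) ≤ P := by
      refine integral_mono (iu hΨ) (iu hψ) fun x => ?_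
      have := κ0 x
      exact mul_le_mul_of_nonneg_left (Real.exp_le_exp.2 (by simp only [Ψ]; linarith)) (nsq_nonneg _)
    have b2 : ∫ x, ‖∑ j, dw (-I) j (A j) x‖ ^ 2 * Real.exp (Ψ x) ≤ Real.exp 1 * Q := by
      rw [hQ, ← integral_const_mul]
      refine integral_mono (iA hΨ tP0) ((iA hψ tP0).const_mul _) fun x => ?_
      by_cases hx : ∃ j, x ∈ tsupport (A j)
      · obtain ⟨j, hj⟩ := hx
        have := κ1 x (hAs j x hj)
        have h1 : Real.exp (Ψ x) ≤ Real.exp 1 * Real.exp (ψ x) := by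
          rw [← Real.exp_add]; exact Real.exp_le_exp.2 (by simp only [Ψ]; linarith)
        refine (mul_le_mul_of_nonneg_left h1 (sq_nonneg _)).trans (le_of_eq (by ring))
      · push Not at hx
        have : ∑ j, dw (-I) j (A j) x = 0 := Finset.sum_eq_zero fun j _ => dw_eq_zero (hx j) _ _
        simp [this]
    have b3 : ∑ j, ∫ x, ‖A j x‖ ^ 2 * Real.exp (σ x + Ψ x) ≤ Real.exp 2 * S := by
      rw [hS, Finset.mul_sum]
      refine Finset.sum_le_sum fun j _ => ?_
      rw [← integral_const_mul]
      refine integral_mono (iA (hσ.add hΨ) (hA j)) ((iA hψ (hA j)).const_mul _) fun x => ?_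
      by_cases hx : x ∈ tsupport (A j)
      · have k1 := κ1 x (hAs j x hx)
        have k2 := σ1 x (hAs j x hx)
        have h1 : Real.exp (σ x + Ψ x) ≤ Real.exp 2 * Real.exp (ψ x) := by
          rw [← Real.exp_add]; exact Real.exp_le_exp.2 (by simp only [Ψ]; linarith)
        refine (mul_le_mul_of_nonneg_left h1 (sq_nonneg _)).trans (le_of_eq (by ring))
      · simp [image_eq_zero_of_notMem_tsupport hx]
    have b4 : 0 ≤ ∫ x, ‖∑ j, dw (-I) j (A j) x‖ ^ 2 * Real.exp (Ψ x) :=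
      integral_nonneg fun x => mul_nonneg (sq_nonneg _) (Real.exp_pos _).le
    have b5 : 0 ≤ ∑ j, ∫ x, ‖A j x‖ ^ 2 * Real.exp (σ x + Ψ x) :=
      Finset.sum_nonneg fun j _ => integral_nonneg fun x => mul_nonneg (sq_nonneg _) (Real.exp_pos _).le
    gcongr
  have lim : Tendsto (fun ε : ℝ => P * (Real.exp 1 * Q + 3 * ε * (Real.exp 2 * S))) (𝓝[>] 0)
      (𝓝 (P * (Real.exp 1 * Q))) := by
    have : ContinuousAt (fun ε : ℝ => P * (Real.exp 1 * Q + 3 * ε * (Real.exp 2 * S))) 0 := by fun_prop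
    have := this.tendsto
    simp only [mul_zero, zero_mul, add_zero] at this
    exact this.mono_left nhdsWithin_le_nhds
  exact ge_of_tendsto lim (eventually_mem_nhdsWithin.mono fun ε hε => main ε hε)

lemma fderiv_dw (F : (Fin n → ℂ) → ℂ) (z h : Fin n → ℂ) :
    fderiv ℝ F z h = (∑ j, h j * dw (-I) j F z) + ∑ j, conj (h j) * dw I j F z := by
  have h1 : h = ∑ j, ((h j).re • (Pi.single j (1:ℂ) : Fin n → ℂ)
      + (h j).im • (Pi.single j I : Fin n → ℂ)) := by
    ext k
    simp [Finset.sum_apply, Pi.single_apply, Finset.sum_add_distrib]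
  conv_lhs => rw [h1]
  rw [map_sum, ← Finset.sum_add_distrib]
  refine Finset.sum_congr rfl fun j _ => ?_
  rw [map_add, map_smul, map_smul]
  simp only [dw, Complex.real_smul]
  have e1 : (h j) = (h j).re + (h j).im * I := (Complex.re_add_im _).symm
  have e2 : conj (h j) = (h j).re - (h j).im * I := by
    apply Complex.ext <;> simp
  rw [e2]
  conv_rhs => rw [e1]
  simp only [Complex.add_re, Complex.ofReal_re, Complex.mul_re, Complex.I_re, mul_zero,
    Complex.ofReal_im, Complex.I_im, mul_one, sub_self, add_zero, Complex.add_im, Complex.mul_im,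
    zero_add]
  linear_combination (((h j).im : ℂ) * fderiv ℝ F z (Pi.single j I)) * Complex.I_sq

/-- the holomorphic part of the second order Taylor polynomial -/
def qf (f : (Fin n → ℂ) → ℝ) (z h : Fin n → ℂ) : ℂ :=
  (∑ j, dw (-I) j (oR f) z * h j)
    + (1/2) * ∑ j, ∑ k, dw (-I) k (dw (-I) j (oR f)) z * h j * h k

lemma TAYLOR0 {f : (Fin n → ℂ) → ℝ} (hf : SmR f) (z : Fin n → ℂ) {ε : ℝ} (hε : 0 < ε) :
    ∃ δ > 0, ∀ h, ‖h‖ < δ → |f (z + h) - f z - fderiv ℝ f z h - (1/2) * fderiv ℝ (fderiv ℝ f) z h h|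
      ≤ ε * ‖h‖ ^ 2 := by
  have hd : Differentiable ℝ f := hf.differentiable (by simp)
  have hd2 : DifferentiableAt ℝ (fderiv ℝ f) z :=
    ((hf.fderiv_right (m := 1) (by norm_cast)).differentiable (by simp)) z
  have hs : IsSymmSndFDerivAt ℝ f z := hf.contDiffAt.isSymmSndFDerivAt (by simp; norm_cast)
  have ho := hd2.hasFDerivAt.isLittleO
  have h1 := ho.def hε
  obtain ⟨δ, hδ, hb⟩ := Metric.eventually_nhds_iff.1 h1
  refine ⟨δ, hδ, fun h hh => ?_⟩
  let B := fderiv ℝ (fderiv ℝ f) z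
  let L := fderiv ℝ f z
  let G : (Fin n → ℂ) → ℝ := fun h => f (z + h) - f z - L h - (1/2) * B h h
  have hG : ∀ h, HasFDerivAt G (fderiv ℝ f (z + h) - L - B h) h := by
    intro h
    have e1 : HasFDerivAt (fun h => f (z + h)) (fderiv ℝ f (z + h)) h := by
      have := (hd (z + h)).hasFDerivAt.comp h ((hasFDerivAt_id h).const_add z)
      exact this
    have e2 : HasFDerivAt (fun h => B h h) (B h + B.flip h) h := by
      have := (B.hasFDerivAt (x := h)).clm_apply (hasFDerivAt_id h)
      refine this.congr_fderiv ?_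
      ext v; simp
    have e3 := ((e1.sub_const (f z)).sub L.hasFDerivAt).sub (e2.const_mul (1/2))
    refine e3.congr_fderiv ?_
    ext v
    simp
    have := hs.eq v h
    change B v h = B h v at this
    rw [this]; ring
  have hbd : ∀ y ∈ Metric.closedBall (0 : Fin n → ℂ) ‖h‖, ‖fderiv ℝ G y‖ ≤ ε * ‖h‖ := by
    intro y hy
    rw [(hG y).fderiv]
    have hy' : ‖y‖ ≤ ‖h‖ := by simpa using hy
    have := hb (y := z + y) (by simpa using hy'.trans_lt hh)
    simp only [add_sub_cancel_left] at this
    exact this.trans (by gcongr)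
  have := (convex_closedBall (0 : Fin n → ℂ) ‖h‖).norm_image_sub_le_of_norm_fderiv_le
    (fun y _ => (hG y).differentiableAt) hbd (x := 0) (y := h) (by simp) (by simp)
  have g0 : G 0 = 0 := by simp [G]
  rw [g0, sub_zero, sub_zero] at this
  calc _ = ‖G h‖ := rfl
    _ ≤ _ := this.trans (le_of_eq (by ring))

lemma TAYLOR {f : (Fin n → ℂ) → ℝ} (hf : SmR f) (z : Fin n → ℂ) {ε : ℝ} (hε : 0 < ε) :
    ∃ δ > 0, ∀ h, ‖h‖ < δ → |f (z + h) - f z - 2 * (qf f z h).re - Lev f z h|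
      ≤ ε * ‖h‖ ^ 2 := by
  obtain ⟨δ, hδ, hb⟩ := TAYLOR0 hf z hε
  refine ⟨δ, hδ, fun h hh => ?_⟩
  refine le_trans (le_of_eq ?_) (hb h hh)
  congr 1
  have hF := oR_sm hf
  have hd : Differentiable ℝ f := hf.differentiable (by simp)
  have hd2 : DifferentiableAt ℝ (fderiv ℝ f) z :=
    ((hf.fderiv_right (m := 1) (by norm_cast)).differentiable (by simp)) z
  have c1 : ∀ y v, fderiv ℝ (oR f) y v = ((fderiv ℝ f y v : ℝ) : ℂ) := by
    intro y v
    have := (Complex.ofRealCLM.hasFDerivAt.comp y (hd y).hasFDerivAt).fderiv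
    have e : (⇑Complex.ofRealCLM ∘ f) = oR f := rfl
    rw [e] at this
    rw [this]; rfl
  have c2 : fderiv ℝ (fun y => fderiv ℝ (oR f) y h) z h
      = ((fderiv ℝ (fderiv ℝ f) z h h : ℝ) : ℂ) := by
    have e : (fun y => fderiv ℝ (oR f) y h) = ⇑Complex.ofRealCLM ∘ (fun y => fderiv ℝ f y h) := by
      ext y; simp [c1]
    have h1 : HasFDerivAt (fun y => fderiv ℝ f y h) ((fderiv ℝ (fderiv ℝ f) z).flip h) z := by
      have := hd2.hasFDerivAt.clm_apply (hasFDerivAt_const h z)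
      refine this.congr_fderiv ?_
      ext v; simp
    rw [e, (Complex.ofRealCLM.hasFDerivAt.comp z h1).fderiv]; rfl
  have k1 : fderiv ℝ f z h = 2 * (∑ j, dw (-I) j (oR f) z * h j).re := by
    have h1 := c1 z h
    rw [fderiv_dw] at h1
    have h2 : ∑ j, conj (h j) * dw I j (oR f) z = conj (∑ j, h j * dw (-I) j (oR f) z) := by
      rw [map_sum]
      refine Finset.sum_congr rfl fun j _ => ?_
      rw [gr_bar hf, map_mul]; rfl
    rw [h2, Complex.add_conj] at h1
    have h3 := Complex.ofReal_injective h1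
    rw [← h3]
    simp only [mul_comm]
  have k2 : fderiv ℝ (fderiv ℝ f) z h h =
      2 * (∑ j, ∑ k, dw (-I) k (dw (-I) j (oR f)) z * h j * h k).re + 2 * Lev f z h := by
    have hdd : ∀ c j, DifferentiableAt ℝ (dw c j (oR f)) z := fun c j => (hF.dw c j).da z
    have h1 := c2
    rw [funext fun y => fderiv_dw (oR f) y h, fderiv_dw] at h1
    have e : ∀ c k, dw c k (fun y => (∑ j, h j * dw (-I) j (oR f) y)
        + ∑ j, conj (h j) * dw I j (oR f) y) z = (∑ j, h j * dw c k (dw (-I) j (oR f)) z)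
        + ∑ j, conj (h j) * dw c k (dw I j (oR f)) z := by
      intro c k
      rw [dw_add _ _ (DifferentiableAt.fun_sum fun j _ => (hdd _ j).const_mul _)
        (DifferentiableAt.fun_sum fun j _ => (hdd _ j).const_mul _),
        dw_sum _ _ _ (fun j _ => (hdd _ j).const_mul _), dw_sum _ _ _ (fun j _ => (hdd _ j).const_mul _)]
      congr 1 <;> exact Finset.sum_congr rfl fun j _ => dw_const_mul _ _ _ (hdd _ j)
    simp only [e] at h1
    set X := ∑ j, ∑ k, dw (-I) k (dw (-I) j (oR f)) z * h j * h k with hX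
    set Y := ∑ j, ∑ k, Hs f j k z * h j * conj (h k) with hY
    have cjj : ∀ j k, dw I k (dw I j (oR f)) z = conj (dw (-I) k (dw (-I) j (oR f)) z) := by
      intro j k
      rw [show dw I j (oR f) = fun y => conj (dw (-I) j (oR f) y) from
        funext fun y => gr_bar hf y j, dw_conj _ _ (hdd _ j), Complex.conj_I]
    have s1 : ∑ k, h k * ∑ j, h j * dw (-I) k (dw (-I) j (oR f)) z = X := by
      simp only [hX, Finset.mul_sum]
      rw [Finset.sum_comm]
      exact Finset.sum_congr rfl fun j _ => Finset.sum_congr rfl fun k _ => by ring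
    have s2 : ∑ k, conj (h k) * ∑ j, h j * dw I k (dw (-I) j (oR f)) z = Y := by
      simp only [hY, Finset.mul_sum, Hs]
      rw [Finset.sum_comm]
      exact Finset.sum_congr rfl fun j _ => Finset.sum_congr rfl fun k _ => by ring
    have s3 : ∑ k, h k * ∑ j, conj (h j) * dw (-I) k (dw I j (oR f)) z = Y := by
      simp only [hY, Finset.mul_sum, Hs]
      refine Finset.sum_congr rfl fun j _ => Finset.sum_congr rfl fun k _ => ?_
      rw [hF.comm I (-I) k j]; ring
    have s4 : ∑ k, conj (h k) * ∑ j, conj (h j) * dw I k (dw I j (oR f)) z = conj X := by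
      simp only [hX, Finset.mul_sum, map_sum]
      rw [Finset.sum_comm]
      refine Finset.sum_congr rfl fun j _ => Finset.sum_congr rfl fun k _ => ?_
      rw [cjj]; simp only [map_mul]; ring
    simp only [mul_add, Finset.sum_add_distrib] at h1
    rw [s1, s2, s3, s4] at h1
    have := congrArg Complex.re h1
    simp only [Complex.add_re, Complex.conj_re, Complex.ofReal_re] at this
    rw [← this]
    change _ = 2 * X.re + 2 * Y.re
    ring
  rw [k1, k2]
  unfold qf
  have : ((1/2 : ℂ) * ∑ j, ∑ k, dw (-I) k (dw (-I) j (oR f)) z * h j * h k).re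
      = (1/2) * (∑ j, ∑ k, dw (-I) k (dw (-I) j (oR f)) z * h j * h k).re := by
    rw [← Complex.re_ofReal_mul]; norm_num
  rw [Complex.add_re, this]; ring

lemma SWAP {𝕜 : Type*} [RCLike 𝕜] {W : (Fin n → ℂ) → 𝕜} (hW : Integrable W) {R : ℝ}
    (zW : ∀ t, R < ‖t‖ → W t = 0) {g : (Fin n → ℂ) → ℝ → 𝕜}
    (hg : ContinuousOn (Function.uncurry g) (Metric.closedBall 0 R ×ˢ Set.univ)) :
    ∫ t, W t * ∫ θ in (0:ℝ)..(2*π), g t θ = ∫ θ in (0:ℝ)..(2*π), ∫ t, W t * g t θ := by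
  have hp : (0:ℝ) ≤ 2 * π := by positivity
  simp only [intervalIntegral.integral_of_le hp]
  simp only [← integral_const_mul]
  rw [integral_integral_swap]
  set ν : Measure ℝ := volume.restrict (Set.Ioc 0 (2*π)) with hν
  have h1 : IntegrableOn (fun p : (Fin n → ℂ) × ℝ => W p.1)
      (Metric.closedBall 0 R ×ˢ Set.Icc 0 (2*π)) ((volume : Measure (Fin n → ℂ)).prod ν) :=
    (hW.comp_fst ν).integrableOn
  have hK : IsCompact ((Metric.closedBall (0 : Fin n → ℂ) R) ×ˢ Set.Icc (0:ℝ) (2*π)) :=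
    (isCompact_closedBall _ _).prod isCompact_Icc
  have h2 := h1.mul_continuousOn (hg.mono (Set.prod_mono le_rfl (Set.subset_univ _))) hK
  refine (h2.integrable_of_ae_notMem_eq_zero ?_)
  have e : ((volume : Measure (Fin n → ℂ)).prod ν) =
      (volume.prod volume).restrict (Set.univ ×ˢ Set.Ioc 0 (2*π)) := by
    rw [hν, ← Measure.prod_restrict, Measure.restrict_univ]
  rw [e]
  filter_upwards [ae_restrict_mem (MeasurableSet.univ.prod measurableSet_Ioc)] with p hp hn
  have : R < ‖p.1‖ := by
    by_contra h
    push Not at h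
    exact hn ⟨by simpa using h, Set.Ioc_subset_Icc_self hp.2⟩
  change W p.1 * _ = 0
  simp [zW _ this]

lemma int_exp_circ (k : ℤ) (hk : k ≠ 0) : ∫ θ in (0:ℝ)..(2*π), Complex.exp (k * (θ * I)) = 0 := by
  have h := integral_exp_mul_complex (a := 0) (b := 2 * π) (c := k * I) (by simp [hk])
  rw [show (fun θ : ℝ => Complex.exp (k * (θ * I))) = fun θ : ℝ => Complex.exp (k * I * θ) from
    funext fun θ => by congr 1; ring, h]
  have : (k : ℂ) * I * ((2 * π : ℝ) : ℂ) = k * (2 * π * I) := by push_cast; ring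
  rw [this, Complex.exp_int_mul_two_pi_mul_I]; simp

lemma qf_rot (f : (Fin n → ℂ) → ℝ) (z h : Fin n → ℂ) (w : ℂ) :
    qf f z (w • h) = w * (∑ j, dw (-I) j (oR f) z * h j)
    + w ^ 2 * ((1/2) * ∑ j, ∑ k, dw (-I) k (dw (-I) j (oR f)) z * h j * h k) := by
  simp only [qf, Pi.smul_apply, smul_eq_mul, Finset.mul_sum]
  congr 1
  · exact Finset.sum_congr rfl fun j _ => by ring
  · exact Finset.sum_congr rfl fun j _ => Finset.sum_congr rfl fun k _ => by ring

lemma Lev_csmul (Ψ : (Fin n → ℂ) → ℝ) (x a : Fin n → ℂ) (w : ℂ) :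
    Lev Ψ x (w • a) = ‖w‖ ^ 2 * Lev Ψ x a := by
  simp only [Lev]
  rw [← Complex.re_ofReal_mul, Finset.mul_sum]
  congr 1
  refine Finset.sum_congr rfl fun j _ => ?_
  rw [Finset.mul_sum]
  refine Finset.sum_congr rfl fun k _ => ?_
  have : (((‖w‖ ^ 2 : ℝ)) : ℂ) = w * conj w := by
    rw [Complex.mul_conj, Complex.normSq_eq_norm_sq]
  rw [this]
  simp; ring

lemma circ_norm (θ : ℝ) : ‖Complex.exp (θ * I)‖ = 1 := Complex.norm_exp_ofReal_mul_I θ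

lemma SUBMEAN {P : (Fin n → ℂ) → ℝ} (hP : SmR P) (x a : Fin n → ℂ) {r0 : ℝ} (hr0 : 0 < r0)
    (h : ∀ r : ℝ, 0 < r → r < r0 →
      P x ≤ (2 * π)⁻¹ * ∫ θ in (0:ℝ)..(2*π), P (x + Complex.exp (θ * I) • ((r : ℂ) • a))) :
    0 ≤ Lev P x a := by
  by_contra hneg
  push Not at hneg
  obtain ⟨δ, hδ, hT⟩ := TAYLOR hP x (ε := - Lev P x a / (2 * (‖a‖ ^ 2 + 1)))
    (div_pos (by linarith) (by positivity))
  set ε := - Lev P x a / (2 * (‖a‖ ^ 2 + 1)) with hε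
  have hε2 : ε * ‖a‖ ^ 2 ≤ - Lev P x a / 2 := by
    rw [hε, div_mul_eq_mul_div, div_le_div_iff₀ (by positivity) (by norm_num)]
    nlinarith
  obtain ⟨r, hr, hr1, hr2⟩ : ∃ r : ℝ, 0 < r ∧ r < r0 ∧ r * ‖a‖ < δ := by
    refine ⟨min (r0 / 2) (δ / (2 * (‖a‖ + 1))), by positivity, ?_, ?_⟩
    · exact (min_le_left _ _).trans_lt (by linarith)
    · refine (mul_le_mul_of_nonneg_right (min_le_right _ _) (norm_nonneg _)).trans_lt ?_
      rw [div_mul_eq_mul_div, div_lt_iff₀ (by positivity)]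
      nlinarith [norm_nonneg a]
  have h1 := h r hr hr1
  set v := (r : ℂ) • a with hv
  have hvn : ‖v‖ = r * ‖a‖ := by rw [hv, norm_smul, Complex.norm_real, Real.norm_of_nonneg hr.le]
  set A := ∑ j, dw (-I) j (oR P) x * v j
  set B := (1/2) * ∑ j, ∑ k, dw (-I) k (dw (-I) j (oR P)) x * v j * v k
  have hLv : Lev P x v = r ^ 2 * Lev P x a := by
    rw [hv, Lev_csmul, Complex.norm_real, Real.norm_of_nonneg hr.le]
  have cQ : ∀ θ : ℝ, qf P x (Complex.exp (θ * I) • v)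
      = Complex.exp ((1:ℤ) * (θ * I)) * A + Complex.exp ((2:ℤ) * (θ * I)) * B := by
    intro θ
    rw [qf_rot]
    have : Complex.exp ((2:ℤ) * (θ * I)) = Complex.exp (θ * I) ^ 2 := by
      rw [← Complex.exp_nat_mul]; push_cast; rfl
    rw [this]; simp [A, B]
  have hpt : ∀ θ : ℝ, P (x + Complex.exp (θ * I) • v) ≤ (P x + r ^ 2 * (Lev P x a / 2))
      + 2 * (qf P x (Complex.exp (θ * I) • v)).re := by
    intro θ
    have hn : ‖Complex.exp (θ * I) • v‖ = r * ‖a‖ := by rw [norm_smul, circ_norm, one_mul, hvn]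
    have := (abs_le.1 (hT (Complex.exp (θ * I) • v) (by rw [hn]; exact hr2))).2
    rw [Lev_csmul, circ_norm, hLv, hn] at this
    have e : ε * (r * ‖a‖) ^ 2 ≤ r ^ 2 * (- Lev P x a / 2) := by
      rw [mul_pow]
      calc ε * (r ^ 2 * ‖a‖ ^ 2) = r ^ 2 * (ε * ‖a‖ ^ 2) := by ring
        _ ≤ _ := by gcongr
    nlinarith
  have cont1 : Continuous fun θ : ℝ => P (x + Complex.exp (θ * I) • v) :=
    hP.continuous.comp (by fun_prop)
  have cont2 : Continuous fun θ : ℝ => qf P x (Complex.exp (θ * I) • v) := by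
    simp only [cQ]; fun_prop
  have hI : ∫ θ in (0:ℝ)..(2*π), qf P x (Complex.exp (θ * I) • v) = 0 := by
    simp only [cQ]
    rw [intervalIntegral.integral_add (Continuous.intervalIntegrable (by fun_prop) _ _)
      (Continuous.intervalIntegrable (by fun_prop) _ _), intervalIntegral.integral_mul_const,
      intervalIntegral.integral_mul_const, int_exp_circ 1 (by norm_num), int_exp_circ 2 (by norm_num)]
    simp
  have hIr : ∫ θ in (0:ℝ)..(2*π), (qf P x (Complex.exp (θ * I) • v)).re = 0 := by
    have := Complex.reCLM.intervalIntegral_comp_comm (cont2.intervalIntegrable (μ := volume) 0 (2 * π))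
    simp only [Complex.reCLM_apply] at this
    rw [this, hI]; simp
  have h2 : ∫ θ in (0:ℝ)..(2*π), P (x + Complex.exp (θ * I) • v) ≤
      ∫ θ in (0:ℝ)..(2*π), ((P x + r ^ 2 * (Lev P x a / 2))
      + 2 * (qf P x (Complex.exp (θ * I) • v)).re) := by
    refine intervalIntegral.integral_mono_on (by positivity) (cont1.intervalIntegrable _ _)
      (Continuous.intervalIntegrable ?_ _ _) fun θ _ => hpt θ
    exact continuous_const.add (continuous_const.mul (Complex.continuous_re.comp cont2))
  have cont3 : Continuous fun θ : ℝ => 2 * (qf P x (Complex.exp (θ * I) • v)).re :=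
    continuous_const.mul (Complex.continuous_re.comp cont2)
  rw [intervalIntegral.integral_add (by simp) (cont3.intervalIntegrable _ _),
    intervalIntegral.integral_const_mul, hIr] at h2
  simp only [intervalIntegral.integral_const, sub_zero, smul_eq_mul, mul_zero, add_zero] at h2
  have h3 := mul_le_mul_of_nonneg_left h2 (show 0 ≤ (2 * π)⁻¹ by positivity)
  rw [← mul_assoc, inv_mul_cancel₀ (by positivity), one_mul] at h3
  have : r ^ 2 * (Lev P x a / 2) < 0 := mul_neg_of_pos_of_neg (by positivity) (by linarith)
  linarith

lemma dw_coord (c : ℂ) (j k : Fin n) (z) :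
    dw c j (fun x : Fin n → ℂ => x k) z = if k = j then (1/2) * (1 + c * I) else 0 := by
  have h : HasFDerivAt (fun x : Fin n → ℂ => x k)
      (ContinuousLinearMap.proj (R := ℝ) (φ := fun _ : Fin n => ℂ) k) z :=
    (ContinuousLinearMap.proj (R := ℝ) (φ := fun _ : Fin n => ℂ) k).hasFDerivAt
  simp only [dw, h.fderiv, ContinuousLinearMap.proj_apply, Pi.single_apply]
  split_ifs <;> simp

lemma Lev_nsq (x a : Fin n → ℂ) : Lev nsq x a = nsq a := by
  have h1 : ∀ j, dw (-I) j (oR (nsq (n := n))) = fun x => conj (x j) := by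
    intro j
    have e : oR (nsq (n := n)) = fun x => ∑ k, x k * conj (x k) := by
      ext x
      simp only [oR, nsq]
      push_cast
      refine Finset.sum_congr rfl fun k _ => ?_
      rw [Complex.mul_conj, Complex.normSq_eq_norm_sq]; push_cast; rfl
    ext z
    have d1 : ∀ k : Fin n, DifferentiableAt ℝ (fun x : Fin n → ℂ => x k) z := fun k => by fun_prop
    have d2 : ∀ k : Fin n, DifferentiableAt ℝ (fun x : Fin n → ℂ => conj (x k)) z := fun k =>
      Complex.conjCLE.differentiableAt.comp z (d1 k)
    rw [e, dw_sum _ _ _ (f := fun k x => x k * conj (x k)) (fun k _ => (d1 k).mul (d2 k))]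
    rw [Finset.sum_eq_single j]
    · rw [dw_mul _ _ (d1 j) (d2 j), dw_conj _ _ (d1 j), dw_coord, dw_coord]
      simp; norm_num
    · intro k _ hk
      rw [dw_mul _ _ (d1 k) (d2 k), dw_conj _ _ (d1 k), dw_coord, dw_coord]
      simp [hk]
    · simp
  have h2 : ∀ j k, Hs nsq j k x = if j = k then 1 else 0 := by
    intro j k
    rw [Hs, h1, dw_conj _ _ (by fun_prop), dw_coord]
    have h2 : (starRingEnd ℂ) 2 = 2 := map_ofNat _ 2
    split_ifs <;> simp [h2] <;> norm_num
  simp only [Lev, h2, nsq]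
  simp [Complex.mul_conj, Complex.normSq_eq_norm_sq, ← Complex.ofReal_pow, -Complex.ofReal_pow]

def mo (m : ℕ) (p : (Fin n → ℂ) → ℝ) (x : Fin n → ℂ) : ℝ := ∫ t, mol m t * p (x - t)

lemma mo_smooth (m : ℕ) {p : (Fin n → ℂ) → ℝ} (hp : Continuous p) : SmR (mo m p) := by
  have h := cv_smooth (etaC_smooth (n := n) m) (etaC_hcs m) (f := oR p)
    (Continuous.locallyIntegrable (by fun_prop))
  have e : mo m p = fun x => (cv (etaC m) (oR p) x).re := by
    ext x
    have : cv (etaC m) (oR p) x = ((mo m p x : ℝ) : ℂ) := by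
      rw [cv_apply, mo, ← integral_complex_ofReal]
      simp [etaC]
    rw [this, Complex.ofReal_re]
  rw [e]
  exact Complex.reCLM.contDiff.comp h

lemma mo_int (m : ℕ) {p : (Fin n → ℂ) → ℝ} (hp : Continuous p) (x) :
    Integrable fun t => mol m t * p (x - t) :=
  Continuous.integrable_of_hasCompactSupport ((eta_smooth m).continuous.mul (by fun_prop))
    (eta_hcs m).mul_right

lemma mo_near (m : ℕ) {p : (Fin n → ℂ) → ℝ} (hp : Continuous p) (x)
    (h : ∀ t : Fin n → ℂ, ‖t‖ < 1 / (m + 1 : ℝ) → |p (x - t) - p x| ≤ 1) : |mo m p x - p x| ≤ 1 := by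
  have hm := (eta_integrable (n := n) m)
  have e : mo m p x - p x = ∫ t, mol m t * (p (x - t) - p x) := by
    simp only [mul_sub]
    rw [integral_sub (mo_int m hp x) (hm.mul_const _), integral_mul_const, eta_int, one_mul]; rfl
  rw [e, ← Real.norm_eq_abs]
  refine (norm_integral_le_of_norm_le hm (ae_of_all _ fun t => ?_)).trans (eta_int m).le
  rw [norm_mul, Real.norm_of_nonneg (eta_nonneg m t), Real.norm_eq_abs]
  by_cases ht : 1 / (m + 1 : ℝ) ≤ ‖t‖
  · simp [eta_zero m ht]
  · push Not at ht
    nlinarith [h t ht, eta_nonneg m t]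

lemma mo_submean (m : ℕ) {p : (Fin n → ℂ) → ℝ} (hp : Continuous p) (x v)
    (h : ∀ t : Fin n → ℂ, ‖t‖ < 1 / (m + 1 : ℝ) →
      p (x - t) ≤ (2 * π)⁻¹ * ∫ θ in (0:ℝ)..(2*π), p (x - t + Complex.exp (θ * I) • v)) :
    mo m p x ≤ (2 * π)⁻¹ * ∫ θ in (0:ℝ)..(2*π), mo m p (x + Complex.exp (θ * I) • v) := by
  have hsw := SWAP (eta_integrable (n := n) m) (R := 1 / (m + 1 : ℝ)) (fun t ht => eta_zero m ht.le)
    (g := fun t θ => p (x - t + Complex.exp (θ * I) • v)) (Continuous.continuousOn (by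
      simp only [Function.uncurry_def]; fun_prop))
  have e : ∀ θ : ℝ, mo m p (x + Complex.exp (θ * I) • v)
      = ∫ t, mol m t * p (x - t + Complex.exp (θ * I) • v) := by
    intro θ
    rw [mo]
    congr 1; ext t; congr 2; abel
  simp only [e]
  rw [← hsw, ← integral_const_mul]
  refine integral_mono (mo_int m hp x) ?_ fun t => ?_
  · refine Integrable.const_mul ?_ _
    refine Continuous.integrable_of_hasCompactSupport ((eta_smooth m).continuous.mul ?_)
      (eta_hcs m).mul_right
    exact intervalIntegral.continuous_parametric_intervalIntegral_of_continuous' (by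
      simp only [Function.uncurry_def]; fun_prop) _ _
  · by_cases ht : 1 / (m + 1 : ℝ) ≤ ‖t‖
    · simp [eta_zero m ht]
    · push Not at ht
      dsimp only
      calc _ ≤ mol m t * _ := mul_le_mul_of_nonneg_left (h t ht) (eta_nonneg m t)
        _ = _ := by ring

lemma EXH {Ω : Set (Fin n → ℂ)} (hΩo : IsOpen Ω) (hb : Bornology.IsBounded Ω)
    (hp : Pseudoconvex Ω) {K0 : Set (Fin n → ℂ)} (hK : IsCompact K0) (hKΩ : K0 ⊆ Ω) :
    ∃ (s : (Fin n → ℂ) → ℝ) (R c0 : ℝ), SmR s ∧ 0 < c0 ∧ (∀ y, s y ≤ 0 → ‖y‖ < R) ∧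
      (∀ y, s y ≤ 0 → y ∈ Ω) ∧ (∀ x ∈ K0, s x ≤ -1) ∧
      (∀ x, s x ≤ 0 → ∀ a, c0 * nsq a ≤ Lev s x a) := by
  obtain ⟨R, hR⟩ := hb.subset_ball (0 : Fin n → ℂ)
  have hR' : ∀ y ∈ Ω, ‖y‖ < R := fun y hy => by simpa using hR hy
  set R0 := (n : ℝ) * R ^ 2 with hR0
  have hR0p : 0 ≤ R0 := by positivity
  have hnR : ∀ y ∈ Ω, nsq y ≤ R0 := fun y hy => (nsq_le y).trans (by
    have := hR' y hy
    rw [hR0]; gcongr)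
  rcases Set.eq_empty_or_nonempty Ωᶜ with hE | hE
  · have hu : ∀ y, y ∈ Ω := fun y => by
      by_contra h; exact Set.notMem_empty y (hE ▸ h)
    refine ⟨fun x => 1 * nsq x + (-(R0 + 1)), R, 1, (contDiff_const.mul nsq_smooth).add contDiff_const,
      one_pos, fun y _ => hR' y (hu y), fun y _ => hu y, fun x hx => ?_, fun x _ a => ?_⟩
    · have := hnR x (hu x); dsimp only; linarith
    · rw [Lev_aff nsq_smooth, Lev_nsq]
  set d : (Fin n → ℂ) → ℝ := fun x => Metric.infDist x Ωᶜ with hd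
  have hdc : Continuous d := Metric.continuous_infDist_pt _
  have hdL : ∀ x y, d x ≤ d y + ‖x - y‖ := fun x y => by
    rw [← dist_eq_norm]; exact Metric.infDist_le_infDist_add_dist
  have hdpos : ∀ x, x ∈ Ω ↔ 0 < d x := fun x => by
    rw [← hΩo.isClosed_compl.notMem_iff_infDist_pos hE]; simp
  obtain ⟨d0, hd0, hd0K⟩ := hK.exists_forall_le' hdc.continuousOn (a := 0)
    fun x hx => (hdpos x).1 (hKΩ hx)
  set d1 := d0 * Real.exp (-10) with hd1
  have hd1p : 0 < d1 := by positivity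
  obtain ⟨m, hm⟩ := exists_nat_one_div_lt hd1p
  set p : (Fin n → ℂ) → ℝ := fun x => - Real.log (max (d x) d1) with hpp
  have hmx : ∀ x, 0 < max (d x) d1 := fun x => lt_max_of_lt_right hd1p
  have hpc : Continuous p :=
    ((hdc.max continuous_const).log fun x => (hmx x).ne').neg
  have hlog2 : Real.log 2 ≤ 1 := by
    have := Real.log_le_sub_one_of_pos (x := 2) (by norm_num); linarith
  have hhalf : ∀ x y, ‖x - y‖ < d1 → p y ≤ p x + 1 := by
    intro x y hxy
    have h1 : max (d x) d1 ≤ 2 * max (d y) d1 := by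
      have := hdL x y
      have := le_max_left (d y) d1
      have := le_max_right (d y) d1
      exact max_le (by linarith) (by linarith)
    have h2 := Real.log_le_log (hmx x) h1
    rw [Real.log_mul two_ne_zero (hmx y).ne'] at h2
    simp only [hpp]; linarith
  have hnear : ∀ x, |mo m p x - p x| ≤ 1 := fun x => mo_near m hpc x fun t ht => by
    have ht' := ht.trans hm
    have h1 := hhalf (x - t) x (by simpa using ht')
    have h2 := hhalf x (x - t) (by simpa using ht')
    exact abs_le.2 ⟨by linarith, by linarith⟩
  set τ := 1 / (R0 + 1) with hτ
  have hτp : 0 < τ := by positivity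
  have hτR : τ * R0 ≤ 1 := by
    rw [hτ, div_mul_eq_mul_div, one_mul, div_le_one (by positivity)]; linarith
  set s : (Fin n → ℂ) → ℝ := fun x => mo m p x + (τ * nsq x + (Real.log d0 - 2 - τ * R0)) with hs
  have hsm : SmR (mo m p) := mo_smooth m hpc
  have hns : SmR (fun x : Fin n → ℂ => τ * nsq x + (Real.log d0 - 2 - τ * R0)) :=
    (contDiff_const.mul nsq_smooth).add contDiff_const
  have hdist : ∀ x, s x ≤ 0 → 4 * d1 < d x := by
    intro x hx
    have h1 := (abs_le.1 (hnear x)).1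
    have h2 : 0 ≤ τ * nsq x := mul_nonneg hτp.le (nsq_nonneg x)
    have h3 : Real.log d0 - 4 ≤ Real.log (max (d x) d1) := by
      simp only [hs, hpp] at hx h1; linarith
    have h4 : d0 * Real.exp (-4) ≤ max (d x) d1 := by
      have := Real.exp_le_exp.2 h3
      rw [Real.exp_log (hmx x), Real.exp_sub, Real.exp_log hd0] at this
      rw [Real.exp_neg]; exact this
    have h5 : d0 * Real.exp (-4) = d1 * Real.exp 6 := by
      rw [hd1, mul_assoc, ← Real.exp_add]; norm_num
    have h6 : (7:ℝ) ≤ Real.exp 6 := by have := Real.add_one_le_exp 6; linarith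
    rw [h5] at h4
    rcases le_max_iff.1 h4 with h | h <;> nlinarith
  refine ⟨s, R, τ, hsm.add hns, hτp, fun y hy => hR' y ((hdpos y).2 (by linarith [hdist y hy])),
    fun y hy => (hdpos y).2 (by linarith [hdist y hy]), fun x hx => ?_, fun x hx a => ?_⟩
  · have h1 := (abs_le.1 (hnear x)).2
    have h2 := Real.log_le_log hd0 ((hd0K x hx).trans (le_max_left _ d1))
    have h3 := mul_le_mul_of_nonneg_left (hnR x (hKΩ hx)) hτp.le
    simp only [hs, hpp] at h1 ⊢; linarith
  · rw [hs, Lev_add hsm hns, Lev_aff nsq_smooth, Lev_nsq]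
    have hdx := hdist x hx
    suffices 0 ≤ Lev (mo m p) x a by linarith
    refine SUBMEAN hsm x a (r0 := d1 / (‖a‖ + 1)) (by positivity) fun r hr hr1 => ?_
    have hv : ‖(r:ℂ) • a‖ ≤ d1 := by
      rw [norm_smul, Complex.norm_real, Real.norm_of_nonneg hr.le]
      rw [lt_div_iff₀ (by positivity)] at hr1; nlinarith
    refine mo_submean m hpc x _ fun t ht => ?_
    have hin : ∀ ζ : ℂ, ‖ζ‖ ≤ 1 → d1 < d (x - t + ζ • ((r:ℂ) • a)) := by
      intro ζ hζ
      have h1 := hdL x (x - t + ζ • ((r:ℂ) • a))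
      have h2 : ‖x - (x - t + ζ • ((r:ℂ) • a))‖ ≤ ‖t‖ + ‖ζ‖ * ‖(r:ℂ) • a‖ := by
        rw [← norm_smul, show x - (x - t + ζ • ((r:ℂ) • a)) = t - ζ • ((r:ℂ) • a) by abel]
        exact norm_sub_le _ _
      have h3 : ‖ζ‖ * ‖(r:ℂ) • a‖ ≤ 1 * d1 := by gcongr
      linarith
    have hpe : ∀ ζ : ℂ, ‖ζ‖ ≤ 1 → p (x - t + ζ • ((r:ℂ) • a))
        = - Real.log (Metric.infDist (x - t + ζ • ((r:ℂ) • a)) Ωᶜ) := by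
      intro ζ hζ
      have : max (d (x - t + ζ • ((r:ℂ) • a))) d1 = d (x - t + ζ • ((r:ℂ) • a)) :=
        max_eq_left (hin ζ hζ).le
      simp only [hpp]; rw [this]
    have key := hp.2 (x - t) ((r:ℂ) • a) fun ζ hζ => (hdpos _).2 (hd1p.trans (hin ζ hζ))
    have h0 := hpe 0 (by simp)
    simp only [zero_smul, add_zero] at h0
    simp only [hpe _ (circ_norm _).le]
    rw [h0]; exact key

lemma rot_mp (c : ℂ) (hc : ‖c‖ = 1) : MeasurePreserving (fun t : Fin n → ℂ => c • t) := by
  have h1 : MeasurePreserving (fun z : ℂ => c * z) := by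
    have := (rotation (⟨c, by simp [Submonoid.unitSphere, hc]⟩ : Circle)).measurePreserving
    exact this
  exact volume_preserving_pi (fun _ : Fin n => h1)

lemma rot_int {F : Type*} [NormedAddCommGroup F] [NormedSpace ℝ F] (c : ℂ) (hc : ‖c‖ = 1)
    (g : (Fin n → ℂ) → F) : ∫ t, g (c • t) = ∫ t, g t := by
  have hc0 : c ≠ 0 := fun h => by simp [h] at hc
  exact (rot_mp c hc).integral_comp (Homeomorph.smulOfNeZero c hc0).measurableEmbedding g

lemma circ_mean {h : (Fin n → ℂ) → ℂ} {R R' : ℝ} (hR : R < R')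
    (hh : DifferentiableOn ℂ h (Metric.ball 0 R')) {t : Fin n → ℂ} (ht : ‖t‖ ≤ R) :
    ∫ θ in (0:ℝ)..(2*π), h (Complex.exp (θ * I) • t) = 2 * π * h 0 := by
  have hd : DifferentiableOn ℂ (fun ζ : ℂ => h (ζ • t)) (Metric.closedBall 0 1) := by
    refine hh.comp (Differentiable.differentiableOn (by fun_prop)) fun ζ hζ => ?_
    simp only [Metric.mem_closedBall, dist_zero_right] at hζ
    simp only [Metric.mem_ball, dist_zero_right, norm_smul]
    nlinarith [norm_nonneg t]
  have h1 : DiffContOnCl ℂ (fun ζ : ℂ => h (ζ • t)) (Metric.ball 0 |1|) := by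
    rw [abs_one]
    refine DifferentiableOn.diffContOnCl ?_
    rwa [closure_ball _ one_ne_zero]
  have h2 := h1.circleAverage
  simp only [Real.circleAverage, circleMap, zero_smul, zero_add, Complex.ofReal_one, one_mul] at h2
  rw [← h2, Complex.real_smul]
  have hpi : (π : ℂ) ≠ 0 := by exact_mod_cast Real.pi_ne_zero
  push_cast
  rw [← mul_assoc, mul_inv_cancel₀ (by simp [hpi]), one_mul]

lemma MV {W : (Fin n → ℂ) → ℂ} (hW : Integrable W) {R R' : ℝ} (hR : R < R')
    (zW : ∀ t, R < ‖t‖ → W t = 0) (cW : ∀ c : ℂ, ‖c‖ = 1 → ∀ t, W (c • t) = W t)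
    {h : (Fin n → ℂ) → ℂ} (hh : DifferentiableOn ℂ h (Metric.ball 0 R')) :
    ∫ t, W t * h t = h 0 * ∫ t, W t := by
  have hsw := SWAP hW zW (g := fun t θ => h (Complex.exp (θ * I) • t)) (by
    refine hh.continuousOn.comp (Continuous.continuousOn (by fun_prop)) ?_
    rintro ⟨t, θ⟩ ⟨ht, _⟩
    simp only [Metric.mem_closedBall, dist_zero_right] at ht
    simp only [Metric.mem_ball, dist_zero_right, norm_smul, circ_norm, one_mul]
    linarith)
  have e1 : ∀ θ : ℝ, ∫ t, W t * h (Complex.exp (θ * I) • t) = ∫ t, W t * h t := by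
    intro θ
    rw [← rot_int _ (circ_norm θ) (fun t => W t * h t)]
    simp only [cW _ (circ_norm θ)]
  have e2 : ∀ t, W t * ∫ θ in (0:ℝ)..(2*π), h (Complex.exp (θ * I) • t) = W t * (2 * π * h 0) := by
    intro t
    by_cases ht : R < ‖t‖
    · simp [zW t ht]
    · rw [circ_mean hR hh (not_lt.1 ht)]
  simp only [e1, e2, integral_mul_const, intervalIntegral.integral_const, sub_zero,
    Complex.real_smul] at hsw
  have hpi : ((2 * π : ℝ) : ℂ) ≠ 0 := by exact_mod_cast (by positivity : (2 * π : ℝ) ≠ 0)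
  apply mul_left_cancel₀ hpi
  rw [← hsw]; push_cast; ring

lemma hol_of_dw {F : (Fin n → ℂ) → ℂ} {x} (hF : DifferentiableAt ℝ F x) (h : ∀ j, dw I j F x = 0) :
    DifferentiableAt ℂ F x := by
  refine (hasFDerivAt_of_restrictScalars ℝ (f' := ∑ j, (dw (-I) j F x) •
    (ContinuousLinearMap.proj (R := ℂ) (φ := fun _ : Fin n => ℂ) j)) hF.hasFDerivAt ?_).differentiableAt
  ext v
  rw [fderiv_dw]
  simp [h, mul_comm]

lemma dw_of_hol {F : (Fin n → ℂ) → ℂ} {x} (hF : DifferentiableAt ℂ F x) (j) : dw I j F x = 0 := by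
  have h := (hF.hasFDerivAt.restrictScalars ℝ).fderiv
  simp only [dw, h, ContinuousLinearMap.coe_restrictScalars']
  have : (Pi.single j I : Fin n → ℂ) = I • Pi.single j 1 := by
    ext k; by_cases hk : k = j
    · subst hk; simp
    · simp [hk]
  rw [this, map_smul, smul_eq_mul, ← mul_assoc, I_mul_I]; ring

lemma cv_swap {a b f : (Fin n → ℂ) → ℂ} (ha : Continuous a) (ha' : HasCompactSupport a)
    (hb : Continuous b) (hb' : HasCompactSupport b) (hf : Integrable f) (x) :
    cv a (cv b f) x = ∫ s, f s * cv a b (x - s) := by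
  rw [cv_apply]
  have e : ∀ t, a t * cv b f (x - t) = ∫ s, a t * f s * b (x - t - s) := by
    intro t
    rw [cv_apply', ← integral_const_mul]
    congr 1; ext s; ring
  simp only [e]
  rw [integral_integral_swap]
  · congr 1; ext s
    rw [cv_apply, ← integral_const_mul]
    congr 1; ext t
    rw [show x - t - s = x - s - t by abel]; ring
  · obtain ⟨C, hC⟩ := hb.bounded_above_of_compact_support hb'
    have h1 := (int_of_test ha ha').mul_prod hf
    exact h1.mul_bdd (c := C) (Continuous.aestronglyMeasurable (by fun_prop))
      (ae_of_all _ fun p => hC _)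

lemma cv_comm {a b f : (Fin n → ℂ) → ℂ} (ha : Continuous a) (ha' : HasCompactSupport a)
    (hb : Continuous b) (hb' : HasCompactSupport b) (hf : Integrable f) (x) :
    cv a (cv b f) x = cv b (cv a f) x := by
  rw [cv_swap ha ha' hb hb' hf, cv_swap hb hb' ha ha' hf]
  congr 1; ext s
  rw [cv_apply, cv_apply']
  simp only [mul_comm]

/-- local Weyl lemma -/
lemma WEYL0 {f : (Fin n → ℂ) → ℂ} (hf2 : MemLp f 2) (hf : Integrable f) (x0) {δ : ℝ} (hδ : 0 < δ)
    (hw : ∀ j, ∀ w, Tst w → tsupport w ⊆ Metric.ball x0 (3 * δ) → ∫ x, f x * dw I j w x = 0) :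
    ∃ F, DifferentiableOn ℂ F (Metric.ball x0 δ) ∧ f =ᵐ[volume.restrict (Metric.ball x0 δ)] F := by
  obtain ⟨m0, hm0⟩ := exists_nat_one_div_lt hδ
  have hmδ : ∀ m, m0 ≤ m → 1 / (m + 1 : ℝ) < δ := fun m hm =>
    (one_div_le_one_div_of_le (by positivity) (by gcongr)).trans_lt hm0
  have hol : ∀ m, m0 ≤ m → DifferentiableOn ℂ (cv (etaC m) f) (Metric.ball x0 (2 * δ)) := by
    intro m hm x hx
    have hs := cv_smooth (etaC_smooth (n := n) m) (etaC_hcs m) hf.locallyIntegrable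
    refine (hol_of_dw (hs.da x) fun j => ?_).differentiableWithinAt
    rw [cv_dw (etaC_smooth m) (etaC_hcs m) hf.locallyIntegrable, cv_apply']
    have := hw j (fun t => etaC m (x - t)) ⟨reflect_sm (etaC_smooth m) x, reflect_hcs (etaC_hcs m) x⟩ ?_
    · simp only [dw_reflect (etaC_smooth m), mul_neg, integral_neg, neg_eq_zero] at this
      simpa only [mul_comm] using this
    · have hx' : dist x x0 < 2 * δ := hx
      refine (closure_minimal (t := Metric.closedBall x (1 / (m + 1 : ℝ))) ?_
        Metric.isClosed_closedBall).trans (Metric.closedBall_subset_ball' ?_)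
      · intro t ht
        by_contra h
        simp only [Metric.mem_closedBall, dist_eq_norm', not_le] at h
        exact ht (by simp [etaC, eta_zero m h.le])
      · linarith [hmδ m hm]
  have key : ∀ m l, m0 ≤ m → m0 ≤ l → ∀ x ∈ Metric.ball x0 δ,
      cv (etaC l) (cv (etaC m) f) x = cv (etaC m) f x := by
    intro m l hm hl x hx
    have hx' : dist x x0 < δ := hx
    have := MV (W := etaC (n := n) l) (int_of_test (etaC_smooth l).continuous (etaC_hcs l)) (hmδ l hl)
      (fun t ht => by simp [etaC, eta_zero l ht.le]) (fun c hc t => by simp [etaC, eta_circ l c hc])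
      (h := fun t => cv (etaC m) f (x - t)) ((hol m hm).comp
        (Differentiable.differentiableOn (by fun_prop)) fun t ht => by
          simp only [Metric.mem_ball, dist_zero_right] at ht
          rw [Metric.mem_ball]
          have h3 : dist (x - t) x0 ≤ dist (x - t) x + dist x x0 := dist_triangle _ _ _
          have h4 : dist (x - t) x = ‖t‖ := by simp
          linarith)
    rw [cv_apply, this]
    have h1 : ∫ t, etaC (n := n) l t = 1 := by
      simp only [etaC]; rw [integral_complex_ofReal, eta_int]; simp
    rw [h1]; simp
  have indep : ∀ m, m0 ≤ m → ∀ x ∈ Metric.ball x0 δ, cv (etaC m) f x = cv (etaC m0) f x := by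
    intro m hm x hx
    rw [← key m m0 hm le_rfl x hx, ← key m0 m le_rfl hm x hx]
    exact cv_comm (etaC_smooth _).continuous (etaC_hcs _) (etaC_smooth _).continuous (etaC_hcs _) hf x
  refine ⟨cv (etaC m0) f, (hol m0 le_rfl).mono (Metric.ball_subset_ball (by linarith)), ?_⟩
  have hz : eLpNorm (fun x => cv (etaC m0) f x - f x) 2 (volume.restrict (Metric.ball x0 δ)) = 0 := by
    refine le_antisymm (ge_of_tendsto (moll_L2 hf2) ?_) bot_le
    filter_upwards [eventually_ge_atTop m0] with m hm
    calc _ = eLpNorm (fun x => cv (etaC m) f x - f x) 2 (volume.restrict (Metric.ball x0 δ)) := by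
          refine eLpNorm_congr_ae ?_
          filter_upwards [ae_restrict_mem measurableSet_ball] with x hx
          rw [indep m hm x hx]
      _ ≤ _ := eLpNorm_restrict_le _ _ _ _
  rw [eLpNorm_eq_zero_iff _ two_ne_zero] at hz
  · filter_upwards [hz] with x hx
    exact (sub_eq_zero.1 hx).symm
  · exact ((cv_smooth (etaC_smooth m0) (etaC_hcs m0)
      hf.locallyIntegrable).continuous.aestronglyMeasurable.sub hf2.1).restrict

lemma WEYL {Ω : Set (Fin n → ℂ)} (hΩ : IsOpen Ω) {f : (Fin n → ℂ) → ℂ}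
    (hf2 : ∀ K, IsCompact K → K ⊆ Ω → MemLp (K.indicator f) 2)
    (hw : ∀ j, ∀ w, Tst w → tsupport w ⊆ Ω → ∫ x, f x * dw I j w x = 0) :
    ∃ F, DifferentiableOn ℂ F Ω ∧ f =ᵐ[volume.restrict Ω] F := by
  have loc : ∀ x : Ω, ∃ δ > 0, ∃ F, DifferentiableOn ℂ F (Metric.ball (x : Fin n → ℂ) δ) ∧
      f =ᵐ[volume.restrict (Metric.ball (x : Fin n → ℂ) δ)] F := by
    rintro ⟨x, hx⟩
    obtain ⟨ε, hε, hεΩ⟩ := Metric.nhds_basis_closedBall.mem_iff.1 (hΩ.mem_nhds hx)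
    set K := Metric.closedBall x ε
    have hK : IsCompact K := isCompact_closedBall _ _
    have h2 := hf2 K hK hεΩ
    have h1 : Integrable (K.indicator f) := by
      have : MemLp (K.indicator f) 1 (volume.restrict K) := by
        have : IsFiniteMeasure (volume.restrict K) := ⟨by simpa using hK.measure_lt_top⟩
        exact (h2.restrict K).mono_exponent (by norm_num)
      rw [integrable_indicator_iff hK.measurableSet]
      refine (memLp_one_iff_integrable.1 this).congr ?_
      filter_upwards [ae_restrict_mem hK.measurableSet] with y hy
      simp [hy]
    obtain ⟨F, hF, hFe⟩ := WEYL0 h2 h1 x (δ := ε / 3) (by positivity) fun j w hwt hws => by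
      have hsK : tsupport w ⊆ K := hws.trans (by
        rw [show 3 * (ε / 3) = ε by ring]; exact Metric.ball_subset_closedBall)
      rw [← hw j w hwt (hsK.trans hεΩ)]
      congr 1; ext y
      by_cases hy : y ∈ K
      · simp [hy]
      · have : dw I j w y = 0 := by
          by_contra h
          exact hy (hsK (tsupport_dw_subset w I j (subset_tsupport _ h)))
        simp [this]
    refine ⟨ε / 3, by positivity, F, hF, ?_⟩
    filter_upwards [hFe, ae_restrict_mem measurableSet_ball] with y hy hyb
    rw [← hy, Set.indicator_of_mem]
    exact Metric.ball_subset_closedBall (Metric.ball_subset_ball (by linarith) hyb)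
  choose δ hδ G hG hGe using loc
  classical
  set F : (Fin n → ℂ) → ℂ := fun x => if h : x ∈ Ω then G ⟨x, h⟩ x else 0 with hF
  have hFG : ∀ x : Ω, ∀ y ∈ Metric.ball (x : Fin n → ℂ) (δ x), y ∈ Ω → F y = G x y := by
    intro x y hy hyΩ
    simp only [hF, hyΩ, dif_pos]
    have ho : IsOpen (Metric.ball (x : Fin n → ℂ) (δ x) ∩ Metric.ball y (δ ⟨y, hyΩ⟩)) :=
      Metric.isOpen_ball.inter Metric.isOpen_ball
    refine Measure.eqOn_open_of_ae_eq (μ := volume) (f := G ⟨y, hyΩ⟩) (g := G x) ?_ ho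
      ((hG _).continuousOn.mono Set.inter_subset_right)
      ((hG _).continuousOn.mono Set.inter_subset_left) ⟨hy, Metric.mem_ball_self (hδ _)⟩
    filter_upwards [ae_restrict_of_ae_restrict_of_subset Set.inter_subset_left (hGe x),
      ae_restrict_of_ae_restrict_of_subset Set.inter_subset_right (hGe ⟨y, hyΩ⟩)] with t h1 h2
    rw [← h1, ← h2]
  refine ⟨F, fun x hx => ?_, ?_⟩
  · have h1 := (hG ⟨x, hx⟩).differentiableAt (Metric.ball_mem_nhds x (hδ _))
    refine (h1.congr_of_eventuallyEq ?_).differentiableWithinAt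
    filter_upwards [Metric.ball_mem_nhds x (hδ ⟨x, hx⟩), hΩ.mem_nhds hx] with y hy hyΩ
    exact hFG ⟨x, hx⟩ y hy hyΩ
  · rw [Filter.EventuallyEq, ae_restrict_iff' hΩ.measurableSet, ae_iff]
    refine measure_null_of_locally_null _ fun x hx => ?_
    simp only [Set.mem_ofPred_eq, Classical.not_imp] at hx
    refine ⟨_ ∩ Metric.ball x (δ ⟨x, hx.1⟩), inter_mem_nhdsWithin _ (Metric.ball_mem_nhds x (hδ _)), ?_⟩
    have := hGe ⟨x, hx.1⟩
    rw [Filter.EventuallyEq, ae_restrict_iff' measurableSet_ball, ae_iff] at this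
    refine measure_mono_null ?_ this
    rintro y ⟨hy1, hy2⟩
    simp only [Set.mem_ofPred_eq, Classical.not_imp] at hy1 ⊢
    exact ⟨hy2, by rw [← hFG ⟨x, hx.1⟩ y hy2 hy1.1]; exact hy1.2⟩

lemma HILB {H : Type*} [NormedAddCommGroup H] [InnerProductSpace ℂ H] [CompleteSpace H]
    (V : Submodule ℂ H) (U : H) {C : ℝ} (h : ∀ g ∈ V, ‖inner ℂ g U‖ ≤ C * ‖g‖) :
    ∃ v, ‖v‖ ^ 2 ≤ C * ‖v‖ ∧ ∀ g ∈ V, inner ℂ g (U - v) = 0 := by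
  have hcl : ∀ g ∈ V.topologicalClosure, ‖inner ℂ g U‖ ≤ C * ‖g‖ := by
    have hc : IsClosed {g : H | ‖inner ℂ g U‖ ≤ C * ‖g‖} :=
      isClosed_le (by fun_prop) (by fun_prop)
    exact fun g hg => closure_minimal (fun x hx => h x hx) hc hg
  have : CompleteSpace V.topologicalClosure :=
    V.isClosed_topologicalClosure.completeSpace_coe
  set v := V.topologicalClosure.starProjection U with hv
  have hvm : v ∈ V.topologicalClosure := Submodule.starProjection_apply_mem _ _
  have ho : ∀ g ∈ V.topologicalClosure, inner ℂ g (U - v) = 0 := fun g hg =>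
    inner_eq_zero_symm.1 (Submodule.starProjection_inner_eq_zero _ _ hg)
  refine ⟨v, ?_, fun g hg => ho g (V.le_topologicalClosure hg)⟩
  have h1 := ho v hvm
  rw [inner_sub_right, sub_eq_zero] at h1
  have h2 := hcl v hvm
  rw [h1, inner_self_eq_norm_sq_to_K] at h2
  simpa using h2

lemma GLOB {Ω K : Set (Fin n → ℂ)} (hΩ : IsOpen Ω) (hK : IsCompact K) (hKΩ : K ⊆ Ω)
    {ψ : (Fin n → ℂ) → ℝ} (hψ : ContDiffOn ℝ (⊤ : ℕ∞) ψ Ω) :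
    ∃ ψ', SmR ψ' ∧ ∀ x ∈ K, ψ' =ᶠ[𝓝 x] ψ := by
  obtain ⟨L, hL, hKL, hLΩ⟩ := exists_compact_between hK hΩ hKΩ
  obtain ⟨χ, h1, h0, -⟩ := exists_contMDiffMap_one_nhds_of_subset_interior
    (modelWithCornersSelf ℝ (Fin n → ℂ)) (n := (⊤ : ℕ∞)) hK.isClosed hKL
  refine ⟨fun x => χ x * ψ x, ?_, fun x hx => ?_⟩
  · rw [SmR, contDiff_iff_contDiffAt]
    intro x
    by_cases hx : x ∈ L
    · exact χ.contMDiff.contDiff.contDiffAt.mul (hψ.contDiffAt (hΩ.mem_nhds (hLΩ hx)))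
    · refine (contDiffAt_const (c := (0:ℝ))).congr_of_eventuallyEq ?_
      filter_upwards [hL.isClosed.isOpen_compl.mem_nhds hx] with y hy
      simp [h0 y hy]
  · have := (eventually_nhdsSet_iff_forall.1 h1) x hx
    filter_upwards [this] with y hy
    simp [hy]

lemma Lev_congr {f g : (Fin n → ℂ) → ℝ} {x} (h : f =ᶠ[𝓝 x] g) (a) : Lev f x a = Lev g x a := by
  have h1 : ∀ j k, Hs f j k x = Hs g j k x := by
    intro j k
    refine dw_congr _ _ ?_
    filter_upwards [h.eventuallyEq_nhds] with y hy
    refine dw_congr _ _ ?_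
    filter_upwards [hy] with t ht
    simp [ht]
  simp only [Lev, h1]

lemma tst_glob {Ω : Set (Fin n → ℂ)} (hΩ : IsOpen Ω) {ψ : (Fin n → ℂ) → ℝ}
    (hψ : ContDiffOn ℝ (⊤ : ℕ∞) ψ Ω) {w : (Fin n → ℂ) → ℂ} (hw : Tst w) (hs : tsupport w ⊆ Ω) :
    Tst (fun x => ew ψ x * w x) := by
  obtain ⟨ψ', h1, h2⟩ := GLOB hΩ hw.cs.isCompact hs hψ
  have : (fun x => ew ψ x * w x) = fun x => ew ψ' x * w x := by
    ext x
    by_cases hx : x ∈ tsupport w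
    · simp only [ew]; rw [(h2 x hx).eq_of_nhds]
    · simp [image_eq_zero_of_notMem_tsupport hx]
  rw [this]
  exact hw.mul_left (ew_sm h1)

lemma ew_norm_sq (Θ : (Fin n → ℂ) → ℝ) (x) : ‖ew (fun x => Θ x / 2) x‖ ^ 2 = Real.exp (-Θ x) := by
  rw [Complex.norm_real, Real.norm_of_nonneg (Real.exp_pos _).le, ← Real.exp_nat_mul]
  congr 1; push_cast; ring

lemma APRIORI2 {Ω : Set (Fin n → ℂ)} (hΩ : IsOpen Ω) (hb : Bornology.IsBounded Ω)
    (hp : Pseudoconvex Ω) {ψ : (Fin n → ℂ) → ℝ} (hψ : ContDiffOn ℝ (⊤ : ℕ∞) ψ Ω)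
    (hL0 : ∀ x ∈ Ω, ∀ a, 0 ≤ Lev ψ x a) {W : Set (Fin n → ℂ)} (hW : IsCompact W) (hWΩ : W ⊆ Ω)
    {c : ℝ} (hc : 0 < c) (hLW : ∀ x ∈ W, ∀ a, c * nsq a ≤ Lev ψ x a)
    {u : (Fin n → ℂ) → ℂ} (hu : Tst u) (huW : ∀ j, ∀ x ∉ W, dw I j u x = 0)
    {A : Fin n → (Fin n → ℂ) → ℂ} (hA : ∀ j, Tst (A j)) (hAΩ : ∀ j, tsupport (A j) ⊆ Ω) :
    c * ‖∫ x, (∑ j, dw (-I) j (A j) x) * conj (u x)‖ ^ 2 ≤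
      (∫ x, nsq (fun j => dw I j u x) * Real.exp (-ψ x)) *
      (Real.exp 1 * ∫ x, ‖∑ j, dw (-I) j (A j) x‖ ^ 2 * Real.exp (ψ x)) := by
  have hK0 : IsCompact (W ∪ ⋃ j, tsupport (A j)) := hW.union (isCompact_iUnion fun j => (hA j).cs)
  obtain ⟨s, R, c0, hs, hc0, hR, hsΩ, hsK, hLs⟩ := EXH hΩ hb hp hK0
    (Set.union_subset hWΩ (Set.iUnion_subset hAΩ))
  have hKs : IsCompact {y | s y ≤ 0} :=
    (isCompact_closedBall (0 : Fin n → ℂ) R).of_isClosed_subset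
      (isClosed_le hs.continuous continuous_const) fun y hy => by simpa using (hR y hy).le
  obtain ⟨ψ', h1, h2⟩ := GLOB hΩ hKs hsΩ hψ
  have hWs : ∀ x ∈ W, s x ≤ -1 := fun x hx => hsK x (Or.inl hx)
  have hAs : ∀ j, ∀ x ∈ tsupport (A j), s x ≤ -1 := fun j x hx =>
    hsK x (Or.inr (Set.mem_iUnion.2 ⟨j, hx⟩))
  have e0 : ∀ x, s x ≤ -1 → ψ' x = ψ x := fun x hx =>
    (h2 x (show s x ≤ 0 by linarith)).eq_of_nhds
  have key := APRIORI hs h1 hc0 hc hR hLs hW.measurableSet hWs (fun x hx a => by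
    rw [Lev_congr (h2 x hx)]
    by_cases hxW : x ∈ W
    · simpa [hxW] using hLW x hxW a
    · simpa [hxW] using hL0 x (hsΩ x hx) a) hA hAs hu huW
  have e1 : ∫ x, nsq (fun j => dw I j u x) * Real.exp (-ψ' x)
      = ∫ x, nsq (fun j => dw I j u x) * Real.exp (-ψ x) := by
    congr 1; ext x
    by_cases hx : x ∈ W
    · rw [e0 x (hWs x hx)]
    · simp [huW _ x hx, nsq]
  have e2 : ∫ x, ‖∑ j, dw (-I) j (A j) x‖ ^ 2 * Real.exp (ψ' x)
      = ∫ x, ‖∑ j, dw (-I) j (A j) x‖ ^ 2 * Real.exp (ψ x) := by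
    congr 1; ext x
    by_cases hx : s x ≤ -1
    · rw [e0 x hx]
    · have : ∀ j, dw (-I) j (A j) x = 0 := fun j => dw_eq_zero (fun h => hx (hAs j x h)) _ _
      simp [this]
  have e3 : ∑ j, ∫ x, A j x * conj (dw I j u x)
      = - ∫ x, (∑ j, dw (-I) j (A j) x) * conj (u x) := by
    simp only [Finset.sum_mul]
    rw [integral_finsetSum _ fun j _ => L2int ((hA j).dw (-I) j).memLp hu.memLp, ← Finset.sum_neg_distrib]
    refine Finset.sum_congr rfl fun j _ => ?_
    rw [← ibp (hA j).sm hu.conj.sm hu.conj.cs]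
    congr 1; ext x
    rw [dw_conj _ _ (hu.sm.da x)]; simp
  rw [e1, e2, e3, norm_neg] at key
  exact key

lemma HORM {Ω : Set (Fin n → ℂ)} (hΩ : IsOpen Ω) (hb : Bornology.IsBounded Ω)
    (hp : Pseudoconvex Ω) {ψ : (Fin n → ℂ) → ℝ} (hψ : ContDiffOn ℝ (⊤ : ℕ∞) ψ Ω)
    (hL0 : ∀ x ∈ Ω, ∀ a, 0 ≤ Lev ψ x a) {W : Set (Fin n → ℂ)} (hW : IsCompact W) (hWΩ : W ⊆ Ω)
    {c : ℝ} (hc : 0 < c) (hLW : ∀ x ∈ W, ∀ a, c * nsq a ≤ Lev ψ x a)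
    {u : (Fin n → ℂ) → ℂ} (hu : Tst u) (huΩ : tsupport u ⊆ Ω)
    (huW : ∀ j, ∀ x ∉ W, dw I j u x = 0) :
    ∃ F, DifferentiableOn ℂ F Ω ∧
      ∫⁻ x in Ω, ENNReal.ofReal (‖u x - F x‖ ^ 2 * Real.exp (-ψ x)) ≤
        ENNReal.ofReal (Real.exp 1 / c * ∫ x, nsq (fun j => dw I j u x) * Real.exp (-ψ x)) := by
  set M := ∫ x, nsq (fun j => dw I j u x) * Real.exp (-ψ x) with hM
  have hM0 : 0 ≤ M := integral_nonneg fun x => mul_nonneg (nsq_nonneg _) (Real.exp_pos _).le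
  set C := √(Real.exp 1 / c * M) with hC
  have hψm : ContDiffOn ℝ (⊤ : ℕ∞) (fun x => ψ x / 2) Ω := hψ.div_const _
  have hψp : ContDiffOn ℝ (⊤ : ℕ∞) (fun x => -(ψ x / 2)) Ω := hψm.neg
  set em := ew (fun x => ψ x / 2) with hem
  set ep := ew (fun x => -(ψ x / 2)) with hep
  have hpm : ∀ x, em x * ep x = 1 := ew_mul_neg ψ
  have cep : ∀ x, conj (ep x) = ep x := fun x => Complex.conj_ofReal _
  let adm : (Fin n → (Fin n → ℂ) → ℂ) → Prop := fun A => ∀ j, Tst (A j) ∧ tsupport (A j) ⊆ Ω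
  have hdiv : ∀ A, adm A → Tst (fun x => ∑ j, dw (-I) j (A j) x) ∧
      tsupport (fun x => ∑ j, dw (-I) j (A j) x) ⊆ Ω := by
    intro A hA
    have hK : IsCompact (⋃ j, tsupport (A j)) := isCompact_iUnion fun j => (hA j).1.cs
    have hsub : tsupport (fun x => ∑ j, dw (-I) j (A j) x) ⊆ ⋃ j, tsupport (A j) := by
      refine closure_minimal (fun x hx => ?_) hK.isClosed
      by_contra h
      simp only [Set.mem_iUnion, not_exists] at h
      exact hx (Finset.sum_eq_zero fun j _ => dw_eq_zero (h j) _ _)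
    exact ⟨⟨ContDiff.sum fun j _ => ((hA j).1.dw (-I) j).sm, hK.of_isClosed_subset
      (isClosed_tsupport _) hsub⟩, hsub.trans (Set.iUnion_subset fun j => (hA j).2)⟩
  have hg : ∀ A, adm A → Tst (fun x => ep x * ∑ j, dw (-I) j (A j) x) := fun A hA =>
    tst_glob hΩ hψp (hdiv A hA).1 (hdiv A hA).2
  have hU : Tst (fun x => em x * u x) := tst_glob hΩ hψm hu huΩ
  let V : Submodule ℂ (L2C n) :=
    { carrier := {g | ∃ A, adm A ∧ g =ᵐ[volume] fun x => ep x * ∑ j, dw (-I) j (A j) x}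
      add_mem' := by
        rintro g g' ⟨A, hA, h1⟩ ⟨B, hB, h2⟩
        refine ⟨fun j x => A j x + B j x, fun j => ⟨⟨(hA j).1.sm.add (hB j).1.sm,
          (hA j).1.cs.add (hB j).1.cs⟩, (tsupport_add _ _).trans
            (Set.union_subset (hA j).2 (hB j).2)⟩, ?_⟩
        filter_upwards [h1, h2, Lp.coeFn_add g g'] with x e1 e2 e3
        rw [e3, Pi.add_apply, e1, e2, ← mul_add, ← Finset.sum_add_distrib]
        congr 1
        exact Finset.sum_congr rfl fun j _ => (dw_add _ _ ((hA j).1.sm.da x) ((hB j).1.sm.da x)).symm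
      zero_mem' := by
        refine ⟨fun j x => 0, fun j => ⟨⟨contDiff_const, HasCompactSupport.zero⟩, by
          simp [tsupport]⟩, ?_⟩
        filter_upwards [Lp.coeFn_zero ℂ 2 (volume : Measure (Fin n → ℂ))] with x e
        rw [e]; simp [dw_const]
      smul_mem' := by
        rintro r g ⟨A, hA, h1⟩
        refine ⟨fun j x => r * A j x, fun j => ⟨(hA j).1.mul_left contDiff_const,
          (tsupport_mul_subset_right).trans (hA j).2⟩, ?_⟩
        filter_upwards [h1, Lp.coeFn_smul r g] with x e1 e3
        rw [e3, Pi.smul_apply, e1, smul_eq_mul, mul_left_comm, Finset.mul_sum]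
        congr 1
        exact Finset.sum_congr rfl fun j _ => (dw_const_mul _ _ _ ((hA j).1.sm.da x)).symm }
  obtain ⟨v, hv1, hv2⟩ := HILB V hU.L (C := C) (by
    rintro g ⟨A, hA, h1⟩
    have e1 : inner ℂ g hU.L = conj (∫ x, (∑ j, dw (-I) j (A j) x) * conj (u x)) := by
      rw [inner_L2 (g := hU.L) h1 hU.memLp.coeFn_toLp, ← integral_conj]
      congr 1; ext x
      rw [map_mul, cep, map_mul, Complex.conj_conj]
      linear_combination (u x * conj (∑ j, dw (-I) j (A j) x)) * hpm x
    have e2 : ‖g‖ ^ 2 = ∫ x, ‖∑ j, dw (-I) j (A j) x‖ ^ 2 * Real.exp (ψ x) := by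
      rw [norm_sq_L2 h1]
      congr 1; ext x
      have := ew_norm_sq (fun x => -ψ x) x
      simp only [neg_div, neg_neg] at this
      rw [norm_mul, mul_pow, hep, this, mul_comm]
    have key := APRIORI2 hΩ hb hp hψ hL0 hW hWΩ hc hLW hu huW (fun j => (hA j).1) (fun j => (hA j).2)
    rw [e1, RCLike.norm_conj]
    refine abs_le_of_sq_le_sq' ?_ (by positivity) |>.2
    rw [mul_pow, hC, Real.sq_sqrt (by positivity), e2, div_mul_eq_mul_div, div_mul_eq_mul_div,
      le_div_iff₀ hc]
    linarith)
  have hvC : ‖v‖ ^ 2 ≤ Real.exp 1 / c * M := by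
    have : ‖v‖ ≤ C := by
      rcases (norm_nonneg v).eq_or_lt with h | h
      · rw [← h]; positivity
      · nlinarith
    calc ‖v‖ ^ 2 ≤ C ^ 2 := by gcongr
      _ = _ := Real.sq_sqrt (by positivity)
  obtain ⟨F, hF, hFe⟩ := WEYL hΩ (f := fun x => u x - ep x * v x) (fun K hK hKΩ => by
      obtain ⟨ψ', h1, h2⟩ := GLOB hΩ hK hKΩ hψp
      obtain ⟨R, hR⟩ := hK.isBounded.subset_ball (0 : Fin n → ℂ)
      have h3 := memLp_cmul (ew_sm h1).continuous (R := R) ((Lp.memLp v).indicator hK.measurableSet)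
        fun y hy => Set.indicator_of_notMem (fun h => by
          have := hR h; simp at this; linarith) _
      convert (hu.memLp.indicator hK.measurableSet).sub h3 using 1
      ext x
      by_cases hx : x ∈ K
      · simp only [hx, Set.indicator_of_mem, Pi.sub_apply, hep, ew]
        rw [(h2 x hx).eq_of_nhds]
      · simp [hx])
    (fun j w hw hwΩ => by
      classical
      let A : Fin n → (Fin n → ℂ) → ℂ := fun k => if k = j then fun x => conj (w x) else fun _ => 0
      have hA : adm A := by
        intro k
        by_cases hk : k = j
        · simp only [A, hk, if_true]
          refine ⟨hw.conj, ?_⟩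
          refine (closure_mono fun x hx => ?_).trans hwΩ
          intro h; exact hx (by simp [h])
        · simp only [A, hk, if_false]
          exact ⟨⟨contDiff_const, HasCompactSupport.zero⟩, by simp [tsupport]⟩
      have hsum : ∀ x, ∑ k, dw (-I) k (A k) x = conj (dw I j w x) := by
        intro x
        rw [Finset.sum_eq_single j]
        · simp only [A, if_true]
          rw [dw_conj _ _ (hw.sm.da x)]; simp
        · intro k _ hk
          simp only [A, hk, if_false, dw_const]
        · simp
      have h0 := hv2 (hg A hA).L ⟨A, hA, (hg A hA).memLp.coeFn_toLp⟩
      have hUv : (hU.L - v : L2C n) =ᵐ[volume] fun x => em x * u x - v x := by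
        filter_upwards [Lp.coeFn_sub hU.L v, hU.memLp.coeFn_toLp] with x e1 e2
        rw [e1, Pi.sub_apply]; congr 1
      rw [inner_L2 (f := (hg A hA).L) (hg A hA).memLp.coeFn_toLp hUv] at h0
      rw [← h0]
      congr 1; ext x
      rw [hsum, map_mul, cep, Complex.conj_conj]
      linear_combination (-(u x * dw I j w x)) * hpm x)
  refine ⟨F, hF, ?_⟩
  have hint : ∫⁻ x, ENNReal.ofReal (‖v x‖ ^ 2) = ENNReal.ofReal (‖v‖ ^ 2) := by
    rw [norm_sq_L2 (ae_eq_refl v), ofReal_integral_eq_lintegral_ofReal]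
    · exact (memLp_two_iff_integrable_sq_norm (Lp.memLp v).1).1 (Lp.memLp v)
    · exact ae_of_all _ fun x => by positivity
  calc _ = ∫⁻ x in Ω, ENNReal.ofReal (‖v x‖ ^ 2) := by
        refine lintegral_congr_ae ?_
        filter_upwards [hFe] with x hx
        have e : v x = em x * (u x - F x) := by
          rw [← hx]; linear_combination (-v x) * hpm x
        rw [e, norm_mul, mul_pow, hem, ew_norm_sq, mul_comm]
    _ ≤ ∫⁻ x, ENNReal.ofReal (‖v x‖ ^ 2) := setLIntegral_le_lintegral _ _
    _ ≤ _ := by rw [hint]; exact ENNReal.ofReal_le_ofReal hvC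

lemma FACT {φ : (Fin n → ℂ) → ℝ} {z : Fin n → ℂ} (hH : (cHessian φ z).PosDef) :
    ∃ C : Matrix (Fin n) (Fin n) ℂ, C.det ≠ 0 ∧ Complex.normSq C.det = (cHessian φ z).det.re ∧
      ∀ a, Lev φ z a = nsq (C.mulVec a) := by
  open scoped MatrixOrder in
  obtain ⟨B, hB⟩ := CStarAlgebra.nonneg_iff_eq_star_mul_self.mp hH.posSemidef.nonneg
  have hd : (B.map conj).det = conj B.det := ((starRingEnd ℂ).map_det B).symm
  have hdet : (cHessian φ z).det = Complex.normSq B.det := by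
    rw [hB, Matrix.det_mul, Matrix.star_eq_conjTranspose, Matrix.det_conjTranspose,
      Complex.normSq_eq_conj_mul_self]; rfl
  have h0 : B.det ≠ 0 := by
    intro h
    rw [h] at hdet
    exact hH.det_pos.ne' (by simpa using hdet)
  refine ⟨B.map conj, by rw [hd]; simpa using h0, by rw [hd, hdet, Complex.normSq_conj, ofReal_re],
    fun a => ?_⟩
  have hs : ∀ j k, Hs φ j k z = ∑ l, conj (B l j) * B l k := fun j k => by
    have := cHessian_eq φ z j k
    rw [hB, Matrix.mul_apply] at this
    exact this.symm
  have : (∑ j, ∑ k, Hs φ j k z * a j * conj (a k))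
      = ((nsq ((B.map conj).mulVec a) : ℝ) : ℂ) := by
    unfold nsq
    push_cast
    simp_rw [hs, ← Complex.mul_conj', Matrix.mulVec, dotProduct, Matrix.map_apply, map_sum, map_mul,
      Complex.conj_conj, Finset.sum_mul_sum, Finset.sum_mul]
    refine (Finset.sum_congr rfl fun j _ => Finset.sum_comm).trans ?_
    rw [Finset.sum_comm]
    refine Finset.sum_congr rfl fun l _ => Finset.sum_congr rfl fun j _ =>
      Finset.sum_congr rfl fun k _ => by ring
  unfold Lev
  rw [this, ofReal_re]

lemma GAUSS0 : ∫ a : Fin n → ℂ, Real.exp (-nsq a) = π ^ n := by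
  have : ∀ a : Fin n → ℂ, Real.exp (-nsq a) = ∏ i, Real.exp (-1 * ‖a i‖ ^ 2) := fun a => by
    rw [← Real.exp_sum]; congr 1; simp [nsq]
  simp_rw [this]
  rw [integral_fintype_prod_volume_eq_pow (fun w : ℂ => Real.exp (-1 * ‖w‖ ^ 2)),
    GaussianFourier.integral_rexp_neg_mul_sq_norm one_pos]
  simp

lemma GAUSS {C : Matrix (Fin n) (Fin n) ℂ} (hC : C.det ≠ 0) :
    ∫ a : Fin n → ℂ, Real.exp (-nsq (C.mulVec a)) = π ^ n / Complex.normSq C.det := by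
  set f : (Fin n → ℂ) →ₗ[ℝ] (Fin n → ℂ) := (Matrix.toLin' C).restrictScalars ℝ
  have hf : LinearMap.det f = Complex.normSq C.det := by
    rw [LinearMap.det_restrictScalars, LinearMap.det_toLin', Algebra.norm_complex_apply]
  have hp : 0 < Complex.normSq C.det := Complex.normSq_pos.2 hC
  have hm := Measure.map_linearMap_addHaar_eq_smul_addHaar (volume : Measure (Fin n → ℂ))
    (f := f) (by rw [hf]; exact hp.ne')
  have hfc : Continuous f := f.continuous_of_finiteDimensional
  have h1 := integral_map (μ := volume) hfc.aemeasurable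
    (f := fun a : Fin n → ℂ => Real.exp (-nsq a))
    (Real.continuous_exp.comp nsq_smooth.continuous.neg).aestronglyMeasurable
  rw [hm, integral_smul_measure, GAUSS0, hf, ENNReal.toReal_ofReal (abs_nonneg _),
    abs_of_pos (inv_pos.2 hp)] at h1
  rw [div_eq_inv_mul]
  exact h1.symm

lemma SCALE {L : (Fin n → ℂ) → ℝ} (hs : ∀ (w : ℂ) a, L (w • a) = ‖w‖ ^ 2 * L a)
    {t : ℝ} (ht : 0 < t) {S S' : Set (Fin n → ℂ)} (hS : MeasurableSet S) (hS' : MeasurableSet S')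
    (hSS : ∀ x, (Real.sqrt t) • x ∈ S ↔ x ∈ S') :
    t ^ n * ∫ h in S', Real.exp (-(t * L h)) = ∫ h in S, Real.exp (-L h) := by
  have h1 := Measure.integral_comp_smul (volume : Measure (Fin n → ℂ))
    (S.indicator fun h => Real.exp (-L h)) (Real.sqrt t)
  have h2 : ∀ x, S.indicator (fun h => Real.exp (-L h)) (Real.sqrt t • x)
      = S'.indicator (fun h => Real.exp (-(t * L h))) x := fun x => by
    by_cases hx : x ∈ S'
    · rw [Set.indicator_of_mem hx, Set.indicator_of_mem ((hSS x).2 hx)]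
      have := hs (Real.sqrt t : ℂ) x
      rw [Complex.norm_real, Real.norm_eq_abs, sq_abs, Real.sq_sqrt ht.le] at this
      rw [← this]; rfl
    · rw [Set.indicator_of_notMem hx, Set.indicator_of_notMem (mt (hSS x).1 hx)]
  simp_rw [h2] at h1
  rw [integral_indicator hS, integral_indicator hS'] at h1
  have hf : Module.finrank ℝ (Fin n → ℂ) = 2 * n := by
    simp [Module.finrank_pi_fintype, Complex.finrank_real_complex, mul_comm]
  rw [hf, pow_mul, Real.sq_sqrt ht.le, abs_of_pos (by positivity), smul_eq_mul] at h1
  rw [h1, mul_inv_cancel_left₀ (by positivity)]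

lemma JLIM {L : (Fin n → ℂ) → ℝ} (hs : ∀ (w : ℂ) a, L (w • a) = ‖w‖ ^ 2 * L a)
    (hi : Integrable fun h => Real.exp (-L h)) {r : ℝ} (hr : 0 < r) :
    Tendsto (fun t : ℝ => t ^ n * ∫ h in Metric.closedBall 0 r, Real.exp (-(t * L h))) atTop
      (𝓝 (∫ h, Real.exp (-L h))) := by
  have h1 : Tendsto (fun t : ℝ => ∫ h in Metric.closedBall (0 : Fin n → ℂ) (Real.sqrt t * r),
      Real.exp (-L h)) atTop (𝓝 (∫ h, Real.exp (-L h))) :=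
    (aecover_closedBall (Real.tendsto_sqrt_atTop.atTop_mul_const hr)).integral_tendsto_of_countably_generated hi
  refine h1.congr' ?_
  filter_upwards [eventually_gt_atTop 0] with t ht
  refine (SCALE hs ht Metric.isClosed_closedBall.measurableSet
    Metric.isClosed_closedBall.measurableSet fun x => ?_).symm
  simp [norm_smul, abs_of_nonneg (Real.sqrt_nonneg t), mul_le_mul_iff_right₀ (Real.sqrt_pos.2 ht)]

lemma JALL {L : (Fin n → ℂ) → ℝ} (hs : ∀ (w : ℂ) a, L (w • a) = ‖w‖ ^ 2 * L a)
    {t : ℝ} (ht : 0 < t) :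
    t ^ n * ∫ h, Real.exp (-(t * L h)) = ∫ h, Real.exp (-L h) := by
  simpa using SCALE hs ht (S := Set.univ) (S' := Set.univ) .univ .univ (by simp)

lemma INTT {L : (Fin n → ℂ) → ℝ} (hs : ∀ (w : ℂ) a, L (w • a) = ‖w‖ ^ 2 * L a)
    (hi : Integrable fun h => Real.exp (-L h))
    {t : ℝ} (ht : 0 < t) : Integrable fun h => Real.exp (-(t * L h)) := by
  have := hi.comp_smul (Real.sqrt_pos.2 ht).ne'
  refine this.congr (Eventually.of_forall fun x => ?_)
  have := hs (Real.sqrt t : ℂ) x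
  rw [Complex.norm_real, Real.norm_eq_abs, sq_abs, Real.sq_sqrt ht.le] at this
  simp only [← this]; rfl

lemma UB {L φ : (Fin n → ℂ) → ℝ} {q f : (Fin n → ℂ) → ℂ} {z : Fin n → ℂ} {r r' s k : ℝ}
    (hL : Continuous L) (hs : ∀ (w : ℂ) a, L (w • a) = ‖w‖ ^ 2 * L a)
    (hq : Differentiable ℂ q) (hq0 : q 0 = 0) (hr : r < r') (hk : 0 ≤ k)
    (hle : ∀ h, ‖h‖ ≤ r → φ (z + h) ≤ φ z + 2 * (q h).re + s * L h)
    (hf : DifferentiableOn ℂ f (Metric.ball z r')) :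
    ENNReal.ofReal (‖f z‖ ^ 2 * Real.exp (-(k * φ z)) *
      ∫ h in Metric.closedBall 0 r, Real.exp (-(k * s * L h)))
      ≤ ∫⁻ x in Metric.closedBall z r, ENNReal.ofReal (‖f x‖ ^ 2 * Real.exp (-(k * φ x))) := by
  set cB := Metric.closedBall (0 : Fin n → ℂ) r
  have hcB : MeasurableSet cB := Metric.isClosed_closedBall.measurableSet
  set W : (Fin n → ℂ) → ℂ := cB.indicator fun h => ((Real.exp (-(k * s * L h)) : ℝ) : ℂ)
  have hW : Integrable W := by
    refine (ContinuousOn.integrableOn_compact (isCompact_closedBall _ _) ?_).integrable_indicator hcB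
    exact Continuous.continuousOn (by fun_prop)
  have hWi : ∫ t, W t = ((∫ h in cB, Real.exp (-(k * s * L h)) : ℝ) : ℂ) := by
    rw [integral_indicator hcB, integral_complex_ofReal]
  have hmv := MV hW hr (fun t ht => by
      refine Set.indicator_of_notMem ?_ _
      simpa [cB] using ht)
    (fun c hc t => by
      have : c • t ∈ cB ↔ t ∈ cB := by simp [cB, norm_smul, hc]
      by_cases ht : t ∈ cB
      · simp only [W]
        rw [Set.indicator_of_mem ht, Set.indicator_of_mem (this.2 ht), hs, hc]; simp
      · simp only [W]
        rw [Set.indicator_of_notMem ht, Set.indicator_of_notMem (mt this.1 ht)])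
    (h := fun t => f (z + t) ^ 2 * Complex.exp (-(2 * k * q t))) (by
      have h1 : DifferentiableOn ℂ (fun t => f (z + t)) (Metric.ball 0 r') :=
        hf.comp (by fun_prop) (fun t ht => by simpa using ht)
      have h2 : Differentiable ℂ (fun t => Complex.exp (-(2 * k * q t))) := by fun_prop
      exact (h1.pow 2).mul h2.differentiableOn)
  simp only [add_zero, hq0, mul_zero, neg_zero, Complex.exp_zero, mul_one, hWi] at hmv
  have hI : 0 ≤ ∫ h in cB, Real.exp (-(k * s * L h)) := integral_nonneg fun _ => (Real.exp_pos _).le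
  have e1 : ENNReal.ofReal (‖f z‖ ^ 2 * ∫ h in cB, Real.exp (-(k * s * L h)))
      ≤ ∫⁻ t, ‖W t * (f (z + t) ^ 2 * Complex.exp (-(2 * k * q t)))‖ₑ := by
    refine le_trans (le_of_eq ?_) (enorm_integral_le_lintegral_enorm _)
    rw [hmv, ← ofReal_norm, norm_mul, norm_pow, Complex.norm_real, Real.norm_of_nonneg hI]
  have e2 : ∫⁻ x in Metric.closedBall z r, ENNReal.ofReal (‖f x‖ ^ 2 * Real.exp (-(k * φ x)))
      = ∫⁻ t in cB, ENNReal.ofReal (‖f (z + t)‖ ^ 2 * Real.exp (-(k * φ (z + t)))) := by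
    rw [← lintegral_indicator Metric.isClosed_closedBall.measurableSet, ← lintegral_indicator hcB,
      ← lintegral_add_left_eq_self _ z]
    congr 1
    ext t
    by_cases ht : t ∈ cB
    · rw [Set.indicator_of_mem ht, Set.indicator_of_mem (by simpa [cB] using ht)]
    · rw [Set.indicator_of_notMem ht, Set.indicator_of_notMem (by simpa [cB] using ht)]
  rw [e2, mul_right_comm, mul_comm, ENNReal.ofReal_mul (Real.exp_pos _).le]
  refine (mul_le_mul_right e1 _).trans ?_
  rw [← lintegral_const_mul' _ _ ENNReal.ofReal_ne_top, ← lintegral_indicator hcB]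
  refine lintegral_mono fun t => ?_
  by_cases ht : t ∈ cB
  · simp only [W]
    rw [Set.indicator_of_mem ht, Set.indicator_of_mem ht, ← ofReal_norm,
      ← ENNReal.ofReal_mul (Real.exp_pos _).le]
    refine ENNReal.ofReal_le_ofReal ?_
    rw [norm_mul, norm_mul, norm_pow, Complex.norm_real, Real.norm_of_nonneg (Real.exp_pos _).le,
      Complex.norm_exp]
    have h3 : (-(2 * k * q t)).re = -(2 * k * (q t).re) := by simp
    have h4 := mul_le_mul_of_nonneg_left (hle t (by simpa [cB] using ht)) hk
    calc _ = ‖f (z + t)‖ ^ 2 * Real.exp (-(k * φ z) + -(k * s * L t) + -(2 * k * (q t).re)) := by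
          rw [h3, Real.exp_add, Real.exp_add]; ring
      _ ≤ _ := by gcongr; linarith
  · simp [W, ht]

lemma Lev_cont {ψ : (Fin n → ℂ) → ℝ} (h : SmR ψ) :
    Continuous fun p : (Fin n → ℂ) × (Fin n → ℂ) => Lev ψ p.1 p.2 := by
  have hc : ∀ j k, Continuous (Hs ψ j k) := fun j k => ((h.ofReal.dw (-I) j).dw I k).continuous
  unfold Lev
  refine Complex.continuous_re.comp (continuous_finsetSum _ fun j _ => continuous_finsetSum _ fun k _ => ?_)
  have := hc j k
  fun_prop

lemma LEVC {Ω : Set (Fin n → ℂ)} (hΩ : IsOpen Ω) {φ : (Fin n → ℂ) → ℝ} (hφ : SPSHOn Ω φ)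
    {W : Set (Fin n → ℂ)} (hW : IsCompact W) (hWΩ : W ⊆ Ω) :
    ∃ c > 0, ∀ x ∈ W, ∀ a, c * nsq a ≤ Lev φ x a := by
  obtain ⟨ψ, hψ, he⟩ := GLOB hΩ hW hWΩ hφ.1
  have hS : IsCompact {a : Fin n → ℂ | nsq a = 1} := by
    refine Metric.isCompact_of_isClosed_isBounded
      (isClosed_eq nsq_smooth.continuous continuous_const) ?_
    refine Metric.isBounded_closedBall (x := 0) (r := 1) |>.subset fun a ha => ?_
    have := norm_sq_le_nsq a
    rw [show nsq a = 1 from ha] at this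
    rw [mem_closedBall_zero_iff]
    nlinarith [norm_nonneg a]
  obtain ⟨c, hc, hb⟩ := (hW.prod hS).exists_forall_le' (Lev_cont hψ).continuousOn (a := 0)
    (fun p hp => by
      obtain ⟨C, hC, -, hL⟩ := FACT (hφ.2 _ (hWΩ hp.1))
      rw [← Lev_congr (he _ hp.1).symm, hL]
      refine lt_of_lt_of_le ?_ (norm_sq_le_nsq _)
      have : C.mulVec p.2 ≠ 0 := fun h0 => by
        have h1 := Matrix.eq_zero_of_mulVec_eq_zero hC h0
        have h2 : nsq p.2 = 1 := hp.2
        rw [h1] at h2; simp [nsq] at h2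
      positivity)
  refine ⟨c, hc, fun x hx a => ?_⟩
  rcases (nsq_nonneg a).eq_or_lt with h0 | h0
  · have : a = 0 := by
      have := norm_sq_le_nsq a
      rw [← h0] at this
      exact norm_eq_zero.1 (by nlinarith [norm_nonneg a])
    subst this
    simp [nsq, Lev]
  · have hs : Real.sqrt (nsq a) ^ 2 = nsq a := Real.sq_sqrt h0.le
    have hp := Real.sqrt_pos.2 h0
    have hn : nsq (((Real.sqrt (nsq a))⁻¹ : ℂ) • a) = 1 := by
      rw [nsq_smul, norm_inv, Complex.norm_real, Real.norm_of_nonneg hp.le, inv_pow, hs,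
        inv_mul_cancel₀ h0.ne']
    have := hb (x, ((Real.sqrt (nsq a))⁻¹ : ℂ) • a) ⟨hx, hn⟩
    simp only at this
    rw [← Lev_congr (he _ hx).symm, Lev_csmul, norm_inv, Complex.norm_real,
      Real.norm_of_nonneg hp.le, inv_pow, hs, le_inv_mul_iff₀ h0] at this
    linarith

lemma LOCAL {Ω : Set (Fin n → ℂ)} (hΩ : IsOpen Ω) {φ : (Fin n → ℂ) → ℝ} (hφ : SPSHOn Ω φ)
    {z : Fin n → ℂ} (hz : z ∈ Ω) {ε : ℝ} (hε : 0 < ε) :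
    ∃ q : (Fin n → ℂ) → ℂ, ContDiff ℂ (⊤ : ℕ∞) q ∧ q 0 = 0 ∧ ∃ r > 0, Metric.closedBall z r ⊆ Ω ∧
      ∀ h, ‖h‖ ≤ r → φ (z + h) ≤ φ z + 2 * (q h).re + (1 + ε) * Lev φ z h ∧
        φ z + 2 * (q h).re + (1 - ε) * Lev φ z h ≤ φ (z + h) := by
  obtain ⟨R, hR, hRΩ⟩ := Metric.nhds_basis_closedBall.mem_iff.1 (hΩ.mem_nhds hz)
  obtain ⟨ψ, hψ, he⟩ := GLOB hΩ (isCompact_closedBall z R) hRΩ hφ.1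
  obtain ⟨c, hc, hb⟩ := LEVC hΩ hφ (isCompact_singleton (x := z)) (by simpa using hz)
  obtain ⟨δ, hδ, ht⟩ := TAYLOR hψ z (mul_pos hε hc)
  refine ⟨qf ψ z, by unfold qf; fun_prop, by simp [qf], min R (δ / 2), by positivity,
    (Metric.closedBall_subset_closedBall (min_le_left _ _)).trans hRΩ, fun h hh => ?_⟩
  have h1 := ht h (by linarith [min_le_right R (δ / 2)])
  have hzB : z ∈ Metric.closedBall z R := Metric.mem_closedBall_self hR.le
  have hhB : z + h ∈ Metric.closedBall z R := by simpa using hh.trans (min_le_left _ _)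
  rw [(he _ hzB).self_of_nhds, (he _ hhB).self_of_nhds, Lev_congr (he _ hzB)] at h1
  have h2 : ε * c * ‖h‖ ^ 2 ≤ ε * Lev φ z h := by
    rw [mul_assoc]
    exact mul_le_mul_of_nonneg_left
      ((mul_le_mul_of_nonneg_left (norm_sq_le_nsq h) hc.le).trans (hb z rfl h)) hε.le
  have h3 := abs_le.1 h1
  constructor <;> linarith [h3.1, h3.2]

lemma Lev_mulc {Ω : Set (Fin n → ℂ)} (hΩ : IsOpen Ω) {φ : (Fin n → ℂ) → ℝ}
    (hφ : ContDiffOn ℝ (⊤ : ℕ∞) φ Ω) {x : Fin n → ℂ} (hx : x ∈ Ω) (k : ℝ) (a : Fin n → ℂ) :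
    Lev (fun w => k * φ w) x a = k * Lev φ x a := by
  obtain ⟨ψ, hψ, he⟩ := GLOB hΩ (isCompact_singleton (x := x)) (by simpa using hx) hφ
  rw [← Lev_congr (he x rfl), ← Lev_aff hψ k 0]
  refine Lev_congr ?_ a
  filter_upwards [he x rfl] with y hy
  simp [hy]

lemma DBAR {Ω : Set (Fin n → ℂ)} (hΩ : IsOpen Ω) (hb : Bornology.IsBounded Ω) (hp : Pseudoconvex Ω)
    {φ : (Fin n → ℂ) → ℝ} (hφ : SPSHOn Ω φ) {z : Fin n → ℂ} {q : (Fin n → ℂ) → ℂ}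
    (hq : ContDiff ℂ (⊤ : ℕ∞) q) (χ : ContDiffBump (0 : Fin n → ℂ)) {ε : ℝ} (hε : ε < 1)
    (hrΩ : Metric.closedBall z χ.rOut ⊆ Ω)
    (hge : ∀ h, ‖h‖ ≤ χ.rOut → φ z + 2 * (q h).re + (1 - ε) * Lev φ z h ≤ φ (z + h)) :
    ∃ D > 0, ∃ β > 0, ∀ k : ℝ, 1 ≤ k → ∃ F, DifferentiableOn ℂ F Ω ∧
      ∫⁻ x in Ω, ENNReal.ofReal (‖(χ (x - z) : ℂ) * Complex.exp (k * q (x - z)) - F x‖ ^ 2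
        * Real.exp (-(k * φ x))) ≤ ENNReal.ofReal (D * Real.exp (-(β * k)) * Real.exp (-(k * φ z))) := by
  set r := χ.rOut
  have hr : 0 < r := χ.rOut_pos
  set cB := Metric.closedBall z r
  obtain ⟨c, hc, hcb⟩ := LEVC hΩ hφ (isCompact_closedBall z r) hrΩ
  set X : (Fin n → ℂ) → ℂ := fun x => (χ (x - z) : ℂ)
  have hX : Sm X := SmR.ofReal (χ.contDiff.comp (contDiff_id.sub contDiff_const))
  have hXs : tsupport X ⊆ cB := by
    refine closure_minimal (fun x hx => ?_) Metric.isClosed_closedBall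
    by_contra h
    apply hx
    have : χ (x - z) = 0 := χ.zero_of_le_dist (by
      rw [dist_zero_right]
      rw [Metric.mem_closedBall, dist_eq_norm] at h
      exact (not_le.1 h).le)
    simp [X, this]
  have hN : Continuous fun x => nsq fun j => dw I j X x :=
    nsq_smooth.continuous.comp (continuous_pi fun j => (hX.dw I j).continuous)
  obtain ⟨M, hM⟩ := (isCompact_closedBall z r).exists_bound_of_continuousOn hN.continuousOn
  set β := (1 - ε) * c * χ.rIn ^ 2
  have hβ : 0 < β := by have := χ.rIn_pos; have := sub_pos.2 hε; positivity
  have hM0 : 0 ≤ M := (norm_nonneg _).trans (hM z (Metric.mem_closedBall_self hr.le))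
  set V := volume.real cB
  have hV : 0 ≤ V := measureReal_nonneg
  refine ⟨Real.exp 1 / c * (M * V) + 1, by positivity, β, hβ, fun k hk => ?_⟩
  have hk0 : 0 < k := by linarith
  set G : (Fin n → ℂ) → ℂ := fun x => Complex.exp (k * q (x - z))
  have hG : ContDiff ℂ (⊤ : ℕ∞) G := by
    have : ContDiff ℂ (⊤ : ℕ∞) fun x => q (x - z) := hq.comp (contDiff_id.sub contDiff_const)
    exact (contDiff_const.mul this).cexp
  have hGs : Sm G := hG.restrict_scalars ℝ
  have hdu : ∀ j x, dw I j (fun x => X x * G x) x = dw I j X x * G x := fun j x => by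
    rw [dw_mul _ _ (hX.da x) (hGs.da x), dw_of_hol (hG.differentiable (by simp) x)]; ring
  have hu : Tst fun x => X x * G x :=
    ⟨hX.mul hGs, HasCompactSupport.of_support_subset_isCompact (isCompact_closedBall z r)
      (fun x hx => hXs (subset_tsupport _ fun h0 => hx (by simp [h0])))⟩
  have huB : tsupport (fun x => X x * G x) ⊆ cB := by
    refine closure_minimal (fun x hx => hXs (subset_tsupport _ fun h0 => hx ?_)) Metric.isClosed_closedBall
    simp [h0]
  set W := cB \ Metric.ball z χ.rIn
  have hdW : ∀ j, ∀ x ∉ W, dw I j X x = 0 := fun j x hx => by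
    by_cases hxB : x ∈ cB
    · have hxb : x ∈ Metric.ball z χ.rIn := by_contra fun h => hx ⟨hxB, h⟩
      have : X =ᶠ[𝓝 x] fun _ => 1 := by
        filter_upwards [Metric.isOpen_ball.mem_nhds hxb] with y hy
        have : χ (y - z) = 1 := χ.one_of_mem_closedBall (by
          rw [mem_closedBall_zero_iff, ← dist_eq_norm]; exact (Metric.mem_ball.1 hy).le)
        simp [X, this]
      rw [dw_congr _ _ this, dw_const]
    · exact dw_eq_zero (fun h => hxB (hXs h)) _ _
  obtain ⟨F, hF, hFi⟩ := HORM hΩ hb hp (ψ := fun x => k * φ x) (contDiffOn_const.mul hφ.1)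
    (fun x hx a => by
      obtain ⟨C, -, -, hL⟩ := FACT (hφ.2 x hx)
      rw [Lev_mulc hΩ hφ.1 hx, hL]
      exact mul_nonneg hk0.le (nsq_nonneg _))
    (W := W) ((isCompact_closedBall z r).diff Metric.isOpen_ball) (Set.sdiff_subset.trans hrΩ)
    (mul_pos hk0 hc) (fun x hx a => by
      rw [Lev_mulc hΩ hφ.1 (hrΩ hx.1), mul_assoc]
      exact mul_le_mul_of_nonneg_left (hcb x hx.1 a) hk0.le)
    hu (huB.trans hrΩ) (fun j x hx => by rw [hdu, hdW j x hx, zero_mul])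
  refine ⟨F, hF, hFi.trans (ENNReal.ofReal_le_ofReal ?_)⟩
  have hint : ∫ x, nsq (fun j => dw I j (fun x => X x * G x) x) * Real.exp (-(k * φ x))
      ≤ M * V * Real.exp (-(β * k)) * Real.exp (-(k * φ z)) := by
    have h2 : ∫ x, cB.indicator (fun _ => M * Real.exp (-(β * k)) * Real.exp (-(k * φ z))) x
      = M * V * Real.exp (-(β * k)) * Real.exp (-(k * φ z)) := by
      rw [integral_indicator Metric.isClosed_closedBall.measurableSet, setIntegral_const, smul_eq_mul]
      ring
    rw [← h2]
    refine integral_mono_of_nonneg (Eventually.of_forall fun x =>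
      mul_nonneg (nsq_nonneg _) (Real.exp_pos _).le) ?_ (Eventually.of_forall fun x => ?_)
    · refine IntegrableOn.integrable_indicator ?_ Metric.isClosed_closedBall.measurableSet
      exact integrableOn_const (isCompact_closedBall z r).measure_lt_top.ne
    · have e0 : nsq (fun j => dw I j (fun x => X x * G x) x)
          = ‖G x‖ ^ 2 * nsq (fun j => dw I j X x) := by
        rw [← nsq_smul]; congr 1; ext j; rw [hdu, Pi.smul_apply, smul_eq_mul, mul_comm]
      simp only [e0]
      by_cases hx : x ∈ W
      · rw [Set.indicator_of_mem hx.1]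
        have h1 := hM x hx.1
        rw [Real.norm_of_nonneg (nsq_nonneg _)] at h1
        have hxr : ‖x - z‖ ≤ r := by rw [← dist_eq_norm]; exact hx.1
        have hxi : χ.rIn ≤ ‖x - z‖ := by
          rw [← dist_eq_norm]; exact not_lt.1 fun h => hx.2 h
        have h3 := hge _ hxr
        rw [add_sub_cancel] at h3
        have h4 : β ≤ (1 - ε) * Lev φ z (x - z) := by
          simp only [β]
          rw [mul_assoc]
          refine mul_le_mul_of_nonneg_left ?_ (sub_pos.2 hε).le
          refine le_trans ?_ (hcb z (Metric.mem_closedBall_self hr.le) _)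
          refine mul_le_mul_of_nonneg_left ?_ hc.le
          exact (pow_le_pow_left₀ χ.rIn_pos.le hxi 2).trans (norm_sq_le_nsq _)
        have h5 : ‖G x‖ ^ 2 = Real.exp (2 * k * (q (x - z)).re) := by
          simp only [G]
          rw [Complex.norm_exp, ← Real.exp_nat_mul]
          congr 1; simp; ring
        calc _ = nsq (fun j => dw I j X x) * Real.exp (2 * k * (q (x - z)).re + -(k * φ x)) := by
              rw [h5, Real.exp_add]; ring
          _ ≤ M * Real.exp (-(β * k) + -(k * φ z)) := by
              refine mul_le_mul h1 (Real.exp_le_exp.2 ?_) (Real.exp_pos _).le hM0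
              nlinarith [mul_le_mul_of_nonneg_left h3 hk0.le, mul_le_mul_of_nonneg_left h4 hk0.le]
          _ = _ := by rw [Real.exp_add]; ring
      · have : (fun j => dw I j X x) = 0 := funext fun j => hdW j x hx
        rw [this]
        simp only [nsq, Pi.zero_apply, norm_zero]
        simp only [ne_eq, OfNat.ofNat_ne_zero, not_false_eq_true, zero_pow, Finset.sum_const_zero,
          mul_zero, zero_mul]
        exact Set.indicator_nonneg (fun _ _ => by positivity) _
  have hi0 : 0 ≤ ∫ x, nsq (fun j => dw I j (fun x => X x * G x) x) * Real.exp (-(k * φ x)) :=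
    integral_nonneg fun x => mul_nonneg (nsq_nonneg _) (Real.exp_pos _).le
  calc _ ≤ Real.exp 1 / c * (M * V * Real.exp (-(β * k)) * Real.exp (-(k * φ z))) := by
        refine mul_le_mul ?_ hint hi0 (by positivity)
        gcongr
        nlinarith
    _ ≤ _ := by
        have : 0 ≤ Real.exp (-(β * k)) * Real.exp (-(k * φ z)) := by positivity
        nlinarith

lemma CAND {Ω : Set (Fin n → ℂ)} (hΩ : IsOpen Ω) (hb : Bornology.IsBounded Ω) (hp : Pseudoconvex Ω)
    {φ : (Fin n → ℂ) → ℝ} (hφ : SPSHOn Ω φ) {z : Fin n → ℂ} (hz : z ∈ Ω)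
    (hi : Integrable fun h => Real.exp (-Lev φ z h)) {ε : ℝ} (hε0 : 0 < ε) (hε : ε < 1) :
    ∃ r > 0, ∃ D > 0, ∃ β > 0, ∀ k : ℝ, 1 ≤ k →
      (∀ f, DifferentiableOn ℂ f Ω → wnorm2 Ω (fun w => k * φ w) f ≤ 1 →
        ‖f z‖ ^ 2 * Real.exp (-(k * φ z)) *
          ∫ h in Metric.closedBall 0 r, Real.exp (-(k * (1 + ε) * Lev φ z h)) ≤ 1) ∧
      ∃ F, DifferentiableOn ℂ F Ω ∧ wnorm2 Ω (fun w => k * φ w) F ≤ ENNReal.ofReal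
          (Real.exp (-(k * φ z)) * ((1 + ε) * ((∫ h, Real.exp (-Lev φ z h)) / (k * (1 - ε)) ^ n)
            + (1 + 1 / ε) * (D * Real.exp (-(β * k))))) ∧
        ‖1 - F z‖ ^ 2 * ∫ h in Metric.closedBall 0 r, Real.exp (-(k * (1 + ε) * Lev φ z h))
          ≤ D * Real.exp (-(β * k)) := by
  obtain ⟨q, hq, hq0, r, hr, hrΩ, hloc⟩ := LOCAL hΩ hφ hz hε0
  set L := Lev φ z with hLdef
  have hLs : ∀ (w : ℂ) a, L (w • a) = ‖w‖ ^ 2 * L a := fun w a => Lev_csmul φ z a w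
  have hLc : Continuous L := by
    obtain ⟨C, -, -, hC⟩ := FACT (hφ.2 z hz)
    rw [show L = fun a => nsq (C.mulVec a) from funext hC]
    exact nsq_smooth.continuous.comp (Continuous.matrix_mulVec continuous_const continuous_id)
  set χ : ContDiffBump (0 : Fin n → ℂ) := ⟨r / 2, r, by positivity, by linarith⟩ with hχ
  obtain ⟨D, hD, β, hβ, hDB⟩ := DBAR hΩ hb hp hφ hq χ hε hrΩ fun h hh => (hloc h hh).2
  have hqd : Differentiable ℂ q := hq.differentiable (by simp)
  have hle : ∀ h, ‖h‖ ≤ r / 4 → φ (z + h) ≤ φ z + 2 * (q h).re + (1 + ε) * L h :=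
    fun h hh => (hloc h (by linarith)).1
  have hsub : Metric.closedBall z (r / 4) ⊆ Ω :=
    (Metric.closedBall_subset_closedBall (by linarith)).trans hrΩ
  refine ⟨r / 4, by positivity, D, hD, β, hβ, fun k hk => ⟨fun f hf hf1 => ?_, ?_⟩⟩
  · have := UB (k := k) hLc hLs hqd hq0 (show r / 4 < r / 2 by linarith) (by linarith) hle
      (hf.mono ((Metric.ball_subset_closedBall.trans
        (Metric.closedBall_subset_closedBall (by linarith))).trans hrΩ))
    have h2 := this.trans ((lintegral_mono_set hsub).trans hf1)
    rwa [ENNReal.ofReal_le_one] at h2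
  obtain ⟨F, hF, hFi⟩ := hDB k hk
  set u : (Fin n → ℂ) → ℂ := fun x => (χ (x - z) : ℂ) * Complex.exp (k * q (x - z)) with hu
  refine ⟨F, hF, ?_, ?_⟩
  · have ht : 0 < k * (1 - ε) := mul_pos (by linarith) (by linarith)
    set m : (Fin n → ℂ) → ℝ := fun x =>
      (1 + ε) * Real.exp (-(k * φ z)) * Real.exp (-(k * (1 - ε) * L (x - z)))
    have hmi : Integrable m := ((INTT hLs hi ht).comp_sub_right z).const_mul _
    have hm0 : ∀ x, 0 ≤ m x := fun x => by positivity
    have hmI : ∫ x, m x = (1 + ε) * Real.exp (-(k * φ z)) *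
        ((∫ h, Real.exp (-L h)) / (k * (1 - ε)) ^ n) := by
      rw [integral_const_mul, integral_sub_right_eq_self (fun h => Real.exp (-(k * (1 - ε) * L h))),
        ← JALL hLs ht, mul_div_cancel_left₀ _ (by positivity)]
    have hpt : ∀ x, ENNReal.ofReal (‖F x‖ ^ 2 * Real.exp (-(k * φ x))) ≤ ENNReal.ofReal (m x)
        + ENNReal.ofReal (1 + 1 / ε) * ENNReal.ofReal (‖u x - F x‖ ^ 2 * Real.exp (-(k * φ x))) := by
      intro x
      rw [← ENNReal.ofReal_mul (by positivity), ← ENNReal.ofReal_add (hm0 x) (by positivity)]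
      refine ENNReal.ofReal_le_ofReal ?_
      have h1 : (1 + ε) * (‖u x‖ ^ 2 * Real.exp (-(k * φ x))) ≤ m x := by
        simp only [m]
        rw [mul_assoc]
        refine mul_le_mul_of_nonneg_left ?_ (by linarith)
        by_cases hx : ‖x - z‖ ≤ r
        · have h3 := (hloc _ hx).2
          rw [add_sub_cancel] at h3
          have h4 : ‖u x‖ ^ 2 ≤ Real.exp (2 * k * (q (x - z)).re) := by
            simp only [u]
            rw [norm_mul, Complex.norm_real, Real.norm_of_nonneg χ.nonneg, Complex.norm_exp, mul_pow,
              ← Real.exp_nat_mul]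
            refine (mul_le_of_le_one_left (Real.exp_pos _).le
              (pow_le_one₀ χ.nonneg χ.le_one)).trans (le_of_eq ?_)
            congr 1; simp; ring
          calc _ ≤ Real.exp (2 * k * (q (x - z)).re) * Real.exp (-(k * φ x)) := by gcongr
            _ ≤ _ := by
              rw [← Real.exp_add, ← Real.exp_add]
              refine Real.exp_le_exp.2 ?_
              nlinarith [mul_le_mul_of_nonneg_left h3 (show 0 ≤ k by linarith)]
        · have : χ (x - z) = 0 := χ.zero_of_le_dist (by
            rw [dist_zero_right]; exact (not_le.1 hx).le)
          rw [show u x = 0 by simp [u, this], norm_zero, zero_pow two_ne_zero, zero_mul]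
          positivity
      have h2 : ‖F x‖ ^ 2 ≤ (1 + ε) * ‖u x‖ ^ 2 + (1 + 1 / ε) * ‖u x - F x‖ ^ 2 := by
        have h5 : ‖F x‖ ≤ ‖u x‖ + ‖u x - F x‖ := by
          have := norm_sub_le (u x) (u x - F x)
          rwa [sub_sub_cancel] at this
        have h6 : (1 + ε) * ‖u x‖ ^ 2 + (1 + 1 / ε) * ‖u x - F x‖ ^ 2
            - (‖u x‖ + ‖u x - F x‖) ^ 2 = (ε * ‖u x‖ - ‖u x - F x‖) ^ 2 / ε := by
          field_simp; ring
        have h7 : 0 ≤ (ε * ‖u x‖ - ‖u x - F x‖) ^ 2 / ε := by positivity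
        have h8 := pow_le_pow_left₀ (norm_nonneg _) h5 2
        linarith
      have h9 := mul_le_mul_of_nonneg_right h2 (Real.exp_pos (-(k * φ x))).le
      linarith
    calc wnorm2 Ω (fun w => k * φ w) F ≤ ∫⁻ x in Ω, (ENNReal.ofReal (m x) + ENNReal.ofReal (1 + 1 / ε)
          * ENNReal.ofReal (‖u x - F x‖ ^ 2 * Real.exp (-(k * φ x)))) := lintegral_mono hpt
      _ = (∫⁻ x in Ω, ENNReal.ofReal (m x)) + ENNReal.ofReal (1 + 1 / ε) * ∫⁻ x in Ω,
          ENNReal.ofReal (‖u x - F x‖ ^ 2 * Real.exp (-(k * φ x))) := by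
        rw [lintegral_add_left (by fun_prop), lintegral_const_mul' _ _ ENNReal.ofReal_ne_top]
      _ ≤ ENNReal.ofReal (∫ x, m x) + ENNReal.ofReal (1 + 1 / ε) *
          ENNReal.ofReal (D * Real.exp (-(β * k)) * Real.exp (-(k * φ z))) := by
        rw [ofReal_integral_eq_lintegral_ofReal hmi (Eventually.of_forall hm0)]
        gcongr
        exact Measure.restrict_le_self
      _ = _ := by
        rw [← ENNReal.ofReal_mul (by positivity), ← ENNReal.ofReal_add (integral_nonneg hm0)
          (by positivity), hmI]
        congr 1; ring
  · have hv : DifferentiableOn ℂ (fun x => u x - F x) (Metric.ball z (r / 2)) := by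
      have h1 : DifferentiableOn ℂ (fun x => Complex.exp (k * q (x - z)) - F x)
          (Metric.ball z (r / 2)) := by
        refine DifferentiableOn.sub ?_ (hF.mono ((Metric.ball_subset_closedBall.trans
          (Metric.closedBall_subset_closedBall (by linarith))).trans hrΩ))
        have : Differentiable ℂ fun x => q (x - z) := hqd.comp (by fun_prop)
        exact (Differentiable.cexp (this.const_mul _)).differentiableOn
      refine h1.congr fun x hx => ?_
      have : χ (x - z) = 1 := χ.one_of_mem_closedBall (by
        rw [mem_closedBall_zero_iff, ← dist_eq_norm]; exact (Metric.mem_ball.1 hx).le)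
      simp [u, this]
    have := UB (k := k) hLc hLs hqd hq0 (show r / 4 < r / 2 by linarith) (by linarith) hle hv
    have h2 := this.trans ((lintegral_mono_set hsub).trans hFi)
    have h3 : u z = 1 := by
      have : χ (0 : Fin n → ℂ) = 1 := χ.one_of_mem_closedBall (by simp; positivity)
      simp [u, hq0, this]
    rw [ENNReal.ofReal_le_ofReal_iff (by positivity), h3, mul_right_comm] at h2
    exact le_of_mul_le_mul_right h2 (Real.exp_pos _)

lemma SAND {Ω : Set (Fin n → ℂ)} (hΩ : IsOpen Ω) (hb : Bornology.IsBounded Ω) (hp : Pseudoconvex Ω)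
    {φ : (Fin n → ℂ) → ℝ} (hφ : SPSHOn Ω φ) {z : Fin n → ℂ} (hz : z ∈ Ω)
    (hi : Integrable fun h => Real.exp (-Lev φ z h)) {J : ℝ} (hJ : 0 < J)
    (hJe : ∫ h, Real.exp (-Lev φ z h) = J) {ε : ℝ} (hε0 : 0 < ε) (hε : ε < 1) :
    ∃ lo up : ℕ → ℝ, Tendsto lo atTop (𝓝 (1 / ((1 + ε) * (J / (1 - ε) ^ n)))) ∧
      Tendsto up atTop (𝓝 (1 / (J / (1 + ε) ^ n))) ∧ ∀ᶠ k : ℕ in atTop,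
        lo k ≤ ((k : ℝ) ^ n)⁻¹ * bergmanDiag Ω (fun w => k * φ w) z * Real.exp (-(k * φ z)) ∧
        ((k : ℝ) ^ n)⁻¹ * bergmanDiag Ω (fun w => k * φ w) z * Real.exp (-(k * φ z)) ≤ up k := by
  obtain ⟨r, hr, D, hD, β, hβ, hk⟩ := CAND hΩ hb hp hφ hz hi hε0 hε
  rw [hJe] at hk
  set L := Lev φ z
  have hLs : ∀ (w : ℂ) a, L (w • a) = ‖w‖ ^ 2 * L a := fun w a => Lev_csmul φ z a w
  set A : ℕ → ℝ := fun k => (k : ℝ) ^ n *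
    ∫ h in Metric.closedBall 0 r, Real.exp (-(k * (1 + ε) * L h)) with hA
  set E : ℕ → ℝ := fun k => (k : ℝ) ^ n * (D * Real.exp (-(β * k))) with hE
  have hAl : Tendsto A atTop (𝓝 (J / (1 + ε) ^ n)) := by
    have h1 : Tendsto (fun k : ℕ => (k : ℝ) * (1 + ε)) atTop atTop :=
      tendsto_natCast_atTop_atTop.atTop_mul_const (by linarith)
    have h2 := ((JLIM hLs hi hr).comp h1).div_const ((1 + ε) ^ n)
    rw [hJe] at h2
    refine h2.congr fun k => ?_
    simp only [Function.comp, A, mul_pow]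
    field_simp
  have hEl : Tendsto E atTop (𝓝 0) := by
    have h1 := (Real.tendsto_pow_mul_exp_neg_atTop_nhds_zero n).comp
      (tendsto_natCast_atTop_atTop.atTop_mul_const hβ : Tendsto (fun k : ℕ => (k : ℝ) * β) _ _)
    have h2 := h1.const_mul (D / β ^ n)
    rw [mul_zero] at h2
    refine h2.congr fun k => ?_
    simp only [Function.comp, E, mul_pow, mul_comm β]
    field_simp
  have hlp : 0 < J / (1 + ε) ^ n := by positivity
  have h1ε : 0 < 1 - ε := by linarith
  refine ⟨fun k => (1 - 2 * Real.sqrt (E k / A k)) /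
    ((1 + ε) * (J / (1 - ε) ^ n) + (1 + 1 / ε) * E k), fun k => 1 / A k, ?_,
    tendsto_const_nhds.div hAl hlp.ne', ?_⟩
  · have h1 : Tendsto (fun k => Real.sqrt (E k / A k)) atTop (𝓝 0) := by
      have := (hEl.div hAl hlp.ne').sqrt
      simpa using this
    have h2 := (tendsto_const_nhds (x := (1 : ℝ))).sub (h1.const_mul 2)
    have h3 := (tendsto_const_nhds (x := (1 + ε) * (J / (1 - ε) ^ n))).add (hEl.const_mul (1 + 1 / ε))
    rw [mul_zero, sub_zero] at h2
    rw [mul_zero, add_zero] at h3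
    exact h2.div h3 (by positivity)
  filter_upwards [eventually_ge_atTop 1, hAl.eventually_const_lt hlp] with k hk1 hAk
  have hk1' : (1 : ℝ) ≤ k := by exact_mod_cast hk1
  have hkn : (0 : ℝ) < (k : ℝ) ^ n := by positivity
  obtain ⟨hub, F, hF, hFn, hFz⟩ := hk k hk1'
  set Jk := ∫ h in Metric.closedBall 0 r, Real.exp (-(k * (1 + ε) * L h))
  have hAk' : A k = (k : ℝ) ^ n * Jk := rfl
  have hJk : 0 < Jk := pos_of_mul_pos_right (hAk' ▸ hAk) hkn.le
  set e := Real.exp (-(k * φ z))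
  have he : 0 < e := Real.exp_pos _
  have hbd : ∀ t ∈ {t : ℝ | ∃ f, DifferentiableOn ℂ f Ω ∧ wnorm2 Ω (fun w => k * φ w) f ≤ 1 ∧
      t = ‖f z‖ ^ 2}, t ≤ 1 / (e * Jk) := by
    rintro t ⟨f, hf, hf1, rfl⟩
    rw [le_div_iff₀ (by positivity), ← mul_assoc]
    exact hub f hf hf1
  have hBu : bergmanDiag Ω (fun w => k * φ w) z ≤ 1 / (e * Jk) :=
    csSup_le ⟨0, 0, differentiableOn_const 0, by simp [wnorm2], by simp⟩ hbd
  constructor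
  · set N := (1 + ε) * (J / (k * (1 - ε)) ^ n) + (1 + 1 / ε) * (D * Real.exp (-(β * k)))
    have hN : 0 < N := by positivity
    have hNe : (1 + ε) * (J / (1 - ε) ^ n) + (1 + 1 / ε) * E k = (k : ℝ) ^ n * N := by
      simp only [E, N, mul_pow]; field_simp
    have hB : ‖F z‖ ^ 2 / (e * N) ≤ bergmanDiag Ω (fun w => k * φ w) z := by
      refine le_csSup ⟨_, hbd⟩ ⟨fun x => (((Real.sqrt (e * N))⁻¹ : ℝ) : ℂ) * F x,
        hF.const_mul _, ?_, ?_⟩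
      · have : wnorm2 Ω (fun w => k * φ w) (fun x => (((Real.sqrt (e * N))⁻¹ : ℝ) : ℂ) * F x)
            = ENNReal.ofReal (e * N)⁻¹ * wnorm2 Ω (fun w => k * φ w) F := by
          unfold wnorm2
          rw [← lintegral_const_mul' _ _ ENNReal.ofReal_ne_top]
          refine lintegral_congr fun x => ?_
          rw [← ENNReal.ofReal_mul (by positivity), norm_mul, mul_pow, Complex.norm_real,
            Real.norm_eq_abs, sq_abs, inv_pow, Real.sq_sqrt (by positivity), mul_assoc]
        rw [this]
        refine (mul_le_mul_right hFn _).trans ?_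
        rw [← ENNReal.ofReal_mul (by positivity), inv_mul_cancel₀ (by positivity)]
        simp
      · rw [norm_mul, mul_pow, Complex.norm_real, Real.norm_eq_abs, sq_abs, inv_pow,
          Real.sq_sqrt (by positivity), div_eq_inv_mul]
    have hEA : E k / A k = D * Real.exp (-(β * k)) / Jk := by
      rw [hAk']; simp only [E]; field_simp
    have hδ : ‖1 - F z‖ ≤ Real.sqrt (E k / A k) := by
      refine Real.le_sqrt_of_sq_le ?_
      rwa [hEA, le_div_iff₀ hJk]
    have hF2 : 1 - 2 * Real.sqrt (E k / A k) ≤ ‖F z‖ ^ 2 := by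
      have h1 : 1 - ‖F z‖ ≤ ‖1 - F z‖ := by simpa using norm_sub_norm_le (1 : ℂ) (F z)
      nlinarith [sq_nonneg (1 - ‖F z‖)]
    rw [hNe, div_le_iff₀ (by positivity)]
    rw [div_le_iff₀ (by positivity)] at hB
    refine hF2.trans (hB.trans (le_of_eq ?_))
    field_simp
  · rw [hAk']
    calc _ ≤ ((k : ℝ) ^ n)⁻¹ * (1 / (e * Jk)) * e := by gcongr
      _ = _ := by field_simp

/-- For a bounded pseudoconvex domain `Ω ⊆ ℂⁿ` and `φ ∈ SPSH(Ω)`,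
for every `z ∈ Ω` one has `k^{-n} B_{kφ}(z) e^{-kφ(z)} → π^{-n} det H_φ(z)` as `k → ∞`. -/
theorem bergman_kernel_asymptotics
    (Ω : Set (Fin n → ℂ)) (hΩo : IsOpen Ω) (hΩconn : IsConnected Ω)
    (hΩb : Bornology.IsBounded Ω) (hΩp : Pseudoconvex Ω)
    (φ : (Fin n → ℂ) → ℝ) (hφ : SPSHOn Ω φ)
    (z : Fin n → ℂ) (hz : z ∈ Ω) :
    Tendsto
      (fun k : ℕ =>
        ((k : ℝ) ^ n)⁻¹ * bergmanDiag Ω (fun w => k * φ w) z * Real.exp (-(k * φ z)))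
      atTop (𝓝 (((π : ℝ) ^ n)⁻¹ * (cHessian φ z).det.re)) := by
  obtain ⟨C, hC, hCd, hL⟩ := FACT (hφ.2 z hz)
  have hd : 0 < Complex.normSq C.det := Complex.normSq_pos.2 hC
  have hJe := GAUSS hC
  simp_rw [← hL] at hJe
  set J := π ^ n / Complex.normSq C.det with hJd
  have hJ : 0 < J := by have := Real.pi_pos; positivity
  have hi : Integrable fun h => Real.exp (-Lev φ z h) := by
    by_contra h
    rw [integral_undef h] at hJe
    exact hJ.ne hJe
  have hlim : ((π : ℝ) ^ n)⁻¹ * (cHessian φ z).det.re = 1 / J := by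
    rw [← hCd, hJd]; field_simp
  rw [hlim]
  have hε : ∀ᶠ ε : ℝ in 𝓝[>] 0, 0 < ε ∧ ε < 1 :=
    Ioo_mem_nhdsGT one_pos
  refine tendsto_order.2 ⟨fun a ha => ?_, fun a ha => ?_⟩
  · have hc : Tendsto (fun ε : ℝ => 1 / ((1 + ε) * (J / (1 - ε) ^ n))) (𝓝[>] 0) (𝓝 (1 / J)) := by
      have : ContinuousAt (fun ε : ℝ => 1 / ((1 + ε) * (J / (1 - ε) ^ n))) 0 := by
        fun_prop (disch := simp [hJ.ne'])
      have h := this.tendsto.mono_left (nhdsWithin_le_nhds (s := Set.Ioi 0))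
      simpa using h
    obtain ⟨ε, h1, h2, h3⟩ := ((hc.eventually_const_lt ha).and hε).exists
    obtain ⟨lo, up, hlo, -, hk⟩ := SAND hΩo hΩb hΩp hφ hz hi hJ hJe h2 h3
    filter_upwards [hlo.eventually_const_lt h1, hk] with k ha hb using ha.trans_le hb.1
  · have hc : Tendsto (fun ε : ℝ => 1 / (J / (1 + ε) ^ n)) (𝓝[>] 0) (𝓝 (1 / J)) := by
      have : ContinuousAt (fun ε : ℝ => 1 / (J / (1 + ε) ^ n)) 0 := by
        fun_prop (disch := simp [hJ.ne'])
      have h := this.tendsto.mono_left (nhdsWithin_le_nhds (s := Set.Ioi 0))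
      simpa using h
    obtain ⟨ε, h1, h2, h3⟩ := ((hc.eventually_lt_const ha).and hε).exists
    obtain ⟨lo, up, -, hup, hk⟩ := SAND hΩo hΩb hΩp hφ hz hi hJ hJe h2 h3
    filter_upwards [hup.eventually_lt_const h1, hk] with k ha hb using hb.2.trans_lt ha
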